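/- (Performance of Robust-TD.) Suppose the Markov chain (s_t) induced by the policy is irreducible and aperiodic and is started from its stationary distribution π, and suppose ε ≤ 1/192. Let ω > 0 be the smallest eigenvalue of Σ = ΦᵀDΦ, let G = K/(ω²(1−γ)²), σ₁ = max{1, r̄, ρ}, σ = max{‖θ*‖₂, ‖θ₀‖₂, σ₁}, and τ̄_mix = max{τ′, τ_mix}. There exist universal constants c₁, c₂, c₃, c₄ ≥ 1 such that if the step size is α = (4/(ω(1−γ))) · log(T)/T, the burn-in time is T̄ = ⌈c₁ τ_mix log²(KT)⌉, and T ≥ max{ T̄ + τ′, c₂ τ′ log(T)/(ω²(1−γ)²) }, then the Robust-TD iterates satisfy E[ ‖θ_T − θ*‖₂² ] ≤ c₃ · τ̄_mix σ² G log³(KT) / T + c₄ · ε σ₁² G. -/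

import Mathlib

open Matrix MeasureTheory

/-- `med` is a median of the `L` values `vals 0, …, vals (L−1)`. -/
def IsMedianOf (L : ℕ) (vals : ℕ → ℝ) (med : ℝ) : Prop :=
  L ≤ 2 * ((Finset.range L).filter fun i => vals i ≤ med).card ∧
    L ≤ 2 * ((Finset.range L).filter fun i => med ≤ vals i).card

/-- The mixing quantity `d_mix(t)` of a finite-state chain `(P, π)`. -/
noncomputable def dmixMat {𝒳 : Type*} [Fintype 𝒳] [DecidableEq 𝒳]
    (P : Matrix 𝒳 𝒳 ℝ) (π : 𝒳 → ℝ) (t : ℕ) : ℝ :=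
  ⨆ x, (1 / 2) * ∑ y, |(P ^ t) x y - π y|

/-- The mixing time `τ_mix = inf{t ≥ 1 : d_mix(t) ≤ 1/4}`. -/
noncomputable def tmixMat {𝒳 : Type*} [Fintype 𝒳] [DecidableEq 𝒳]
    (P : Matrix 𝒳 𝒳 ℝ) (π : 𝒳 → ℝ) : ℕ :=
  sInf {t | 1 ≤ t ∧ dmixMat P π t ≤ 1 / 4}

/-- Mean of the `i`-th bucket (of size `M`) of the data `y` subsampled at gap `τ`. -/
noncomputable def subsampledBucketMean (τ M : ℕ) (y : ℕ → ℝ) (i : ℕ) : ℝ :=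
  (∑ j ∈ Finset.range M, y ((i * M + j) * τ)) / M

/-- RUMEM subsampling gap `τ = ⌈log₂(6N/δ) τ_mix⌉`. -/
noncomputable def rumemTau (tmix N : ℕ) (δ : ℝ) : ℕ :=
  ⌈Real.logb 2 (6 * N / δ) * (tmix : ℝ)⌉₊

/-- RUMEM subsample size `n = ⌊(N−1)/τ⌋ + 1`. -/
noncomputable def rumemn (tmix N : ℕ) (δ : ℝ) : ℕ :=
  (N - 1) / rumemTau tmix N δ + 1

/-- RUMEM effective corruption level `ε′ = ε + (32/(3n)) log(24/δ)`. -/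
noncomputable def rumemEps' (tmix N : ℕ) (δ ε : ℝ) : ℝ :=
  ε + 32 / (3 * (rumemn tmix N δ : ℝ)) * Real.log (24 / δ)

/-- RUMEM number of buckets `L = ⌈12ε′n + (256/7) log(N/δ)⌉`. -/
noncomputable def rumemL (tmix N : ℕ) (δ ε : ℝ) : ℕ :=
  ⌈12 * rumemEps' tmix N δ ε * (rumemn tmix N δ : ℝ) + (256 / 7) * Real.log (N / δ)⌉₊

/-- `out` is an output of the RUMEM estimator on the data `y 0, …, y (N−1)`. -/
def IsRumemOutput (tmix N : ℕ) (δ ε : ℝ) (y : ℕ → ℝ) (out : ℝ) : Prop :=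
  IsMedianOf (rumemL tmix N δ ε)
    (subsampledBucketMean (rumemTau tmix N δ) (rumemn tmix N δ / rumemL tmix N δ ε) y) out

/-- The squared Euclidean norm of a vector in `ℝ^K`. -/
def sqNorm {K : ℕ} (v : Fin K → ℝ) : ℝ := v ⬝ᵥ v

/-- The TD random matrix `A_t = γ φ(s_t) φ(s_{t+1})ᵀ − φ(s_t) φ(s_t)ᵀ`
as a function of the two consecutive states. -/
noncomputable def tdMat {m K : ℕ} (Φ : Matrix (Fin m) (Fin K) ℝ) (γ : ℝ)
    (u v : Fin m) : Matrix (Fin K) (Fin K) ℝ :=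
  Matrix.of fun i j => γ * Φ u i * Φ v j - Φ u i * Φ u j

/-- The conditional expectation `E[A_k | s₀ = x]` of the TD matrix. -/
noncomputable def condTdMat {m K : ℕ} (P : Matrix (Fin m) (Fin m) ℝ)
    (Φ : Matrix (Fin m) (Fin K) ℝ) (γ : ℝ) (k : ℕ) (x : Fin m) :
    Matrix (Fin K) (Fin K) ℝ :=
  Matrix.of fun i j =>
    ∑ u, (P ^ k) x u * (γ * Φ u i * (∑ v, P u v * Φ v j) - Φ u i * Φ u j)

/-- The mixing time `τ′ = min{t ≥ 1 : ‖E[A_k | X₀] − Ā‖₂ ≤ α ∀ k ≥ t, ∀ X₀}`. -/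
noncomputable def tdMixTime {m K : ℕ} (P : Matrix (Fin m) (Fin m) ℝ)
    (Φ : Matrix (Fin m) (Fin K) ℝ) (γ : ℝ) (Abar : Matrix (Fin K) (Fin K) ℝ)
    (α : ℝ) : ℕ :=
  sInf {t | 1 ≤ t ∧ ∀ k, t ≤ k → ∀ x,
    ‖Matrix.toEuclideanCLM (𝕜 := ℝ) (condTdMat P Φ γ k x) -
      Matrix.toEuclideanCLM (𝕜 := ℝ) Abar‖ ≤ α}

section MarkovMixing

variable {m : ℕ} {P : Matrix (Fin m) (Fin m) ℝ} {π : Fin m → ℝ}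

/-- The `ℓ¹` distance between the `t`-step law from `x` and `π`. -/
noncomputable def rowDist (P : Matrix (Fin m) (Fin m) ℝ) (π : Fin m → ℝ) (t : ℕ) (x : Fin m) : ℝ :=
  ∑ y, |(P ^ t) x y - π y|

lemma sum_pow_apply (hP1 : ∀ x, ∑ y, P x y = 1) (t : ℕ) : ∀ x, ∑ y, (P ^ t) x y = 1 := by
  induction t with
  | zero => intro x; simp [Matrix.one_apply]
  | succ t ih =>
    intro x
    simp_rw [pow_succ, Matrix.mul_apply]
    rw [Finset.sum_comm]
    simp_rw [← Finset.mul_sum, hP1, mul_one, ih]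

lemma vecMul_pow_eq (hst : Matrix.vecMul π P = π) (t : ℕ) : Matrix.vecMul π (P ^ t) = π := by
  induction t with
  | zero => simp
  | succ t ih => rw [pow_succ, ← Matrix.vecMul_vecMul, ih, hst]

lemma sum_mul_pow_apply (hst : Matrix.vecMul π P = π) (t : ℕ) (y : Fin m) :
    ∑ x, π x * (P ^ t) x y = π y := by
  have := congrFun (vecMul_pow_eq hst t) y
  simpa [Matrix.vecMul, dotProduct] using this

/-- A row of `P ^ (k + t)` is contracted towards `π` whenever the rows of `P ^ t` are `c`-close
to a common vector. -/
lemma rowDist_add_le (hP1 : ∀ x, ∑ y, P x y = 1) (hπ1 : ∑ x, π x = 1)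
    (hst : Matrix.vecMul π P = π) {t : ℕ} {c : ℝ} (q : Fin m → ℝ)
    (hq : ∀ z, ∑ y, |(P ^ t) z y - q y| ≤ c) (k : ℕ) (x : Fin m) :
    rowDist P π (k + t) x ≤ c * rowDist P π k x := by
  have key : ∀ y, (P ^ (k + t)) x y - π y
      = ∑ z, ((P ^ k) x z - π z) * ((P ^ t) z y - q y) := by
    intro y
    have h1 : ∑ z, ((P ^ k) x z - π z) * q y = 0 := by
      rw [← Finset.sum_mul, Finset.sum_sub_distrib, sum_pow_apply hP1, hπ1]; simp
    have h2 : ∑ z, ((P ^ k) x z - π z) * (P ^ t) z y = (P ^ (k + t)) x y - π y := by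
      simp_rw [sub_mul]
      rw [Finset.sum_sub_distrib, sum_mul_pow_apply hst, pow_add, Matrix.mul_apply]
    simp_rw [mul_sub]
    rw [Finset.sum_sub_distrib, h1, h2, sub_zero]
  unfold rowDist
  calc ∑ y, |(P ^ (k + t)) x y - π y|
      ≤ ∑ y, ∑ z, |(P ^ k) x z - π z| * |(P ^ t) z y - q y| := by
        refine Finset.sum_le_sum fun y _ => ?_
        rw [key]
        refine (Finset.abs_sum_le_sum_abs _ _).trans (le_of_eq ?_)
        exact Finset.sum_congr rfl fun z _ => abs_mul _ _
    _ = ∑ z, |(P ^ k) x z - π z| * ∑ y, |(P ^ t) z y - q y| := by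
        rw [Finset.sum_comm]; simp_rw [Finset.mul_sum]
    _ ≤ ∑ z, |(P ^ k) x z - π z| * c :=
        Finset.sum_le_sum fun z _ => mul_le_mul_of_nonneg_left (hq z) (abs_nonneg _)
    _ = c * ∑ y, |(P ^ k) x y - π y| := by rw [← Finset.sum_mul, mul_comm]

lemma rowDist_add_right_le (hP : ∀ x y, 0 ≤ P x y) (hP1 : ∀ x, ∑ y, P x y = 1)
    (hπ1 : ∑ x, π x = 1) (hst : Matrix.vecMul π P = π) (k t : ℕ) (x : Fin m) :
    rowDist P π (k + t) x ≤ rowDist P π k x := by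
  have := rowDist_add_le (t := t) (c := 1) hP1 hπ1 hst 0 (fun z => by
    simp only [Pi.zero_apply, sub_zero]
    rw [← sum_pow_apply hP1 t z]
    exact Finset.sum_le_sum fun y _ => (abs_of_nonneg (pow_apply_nonneg hP t z y)).le) k x
  linarith

lemma rowDist_anti (hP : ∀ x y, 0 ≤ P x y) (hP1 : ∀ x, ∑ y, P x y = 1)
    (hπ1 : ∑ x, π x = 1) (hst : Matrix.vecMul π P = π) {k l : ℕ} (h : k ≤ l) (x : Fin m) :
    rowDist P π l x ≤ rowDist P π k x := by
  obtain ⟨t, rfl⟩ := Nat.exists_eq_add_of_le h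
  exact rowDist_add_right_le hP hP1 hπ1 hst k t x

lemma rowDist_le_two (hP : ∀ x y, 0 ≤ P x y) (hP1 : ∀ x, ∑ y, P x y = 1)
    (hπ : ∀ x, 0 < π x) (hπ1 : ∑ x, π x = 1) (t : ℕ) (x : Fin m) :
    rowDist P π t x ≤ 2 := by
  unfold rowDist
  calc ∑ y, |(P ^ t) x y - π y| ≤ ∑ y, ((P ^ t) x y + π y) := by
        refine Finset.sum_le_sum fun y _ => ?_
        have h1 := pow_apply_nonneg hP t x y
        have h2 := (hπ y).le
        rw [abs_le]; constructor <;> linarith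
    _ = 2 := by rw [Finset.sum_add_distrib, sum_pow_apply hP1, hπ1]; norm_num

lemma rowDist_mul_le (hP : ∀ x y, 0 ≤ P x y) (hP1 : ∀ x, ∑ y, P x y = 1)
    (hπ : ∀ x, 0 < π x) (hπ1 : ∑ x, π x = 1) (hst : Matrix.vecMul π P = π)
    {t : ℕ} {c : ℝ} (hc : 0 ≤ c) (q : Fin m → ℝ)
    (hq : ∀ z, ∑ y, |(P ^ t) z y - q y| ≤ c) (j : ℕ) (x : Fin m) :
    rowDist P π (j * t) x ≤ 2 * c ^ j := by
  induction j with
  | zero => simpa using rowDist_le_two hP hP1 hπ hπ1 0 x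
  | succ j ih =>
    rw [Nat.succ_mul]
    refine (rowDist_add_le hP1 hπ1 hst q hq (j * t) x).trans ?_
    calc c * rowDist P π (j * t) x ≤ c * (2 * c ^ j) := mul_le_mul_of_nonneg_left ih hc
      _ = 2 * c ^ (j + 1) := by ring

/-- Convergence to stationarity, uniformly in the initial state. -/
lemma exists_rowDist_le (hP : ∀ x y, 0 ≤ P x y) (hP1 : ∀ x, ∑ y, P x y = 1)
    (herg : ∃ k : ℕ, ∀ x y, 0 < (P ^ k) x y)
    (hπ : ∀ x, 0 < π x) (hπ1 : ∑ x, π x = 1) (hst : Matrix.vecMul π P = π)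
    {η : ℝ} (hη : 0 < η) : ∃ t, 1 ≤ t ∧ ∀ k, t ≤ k → ∀ x, rowDist P π k x ≤ η := by
  obtain ⟨k₀, hk₀⟩ := herg
  obtain ⟨c, hc0, hc1, hc⟩ : ∃ c : ℝ, 0 < c ∧ c ≤ 1 ∧ ∀ x y, c ≤ (P ^ k₀) x y := by
    rcases isEmpty_or_nonempty (Fin m) with he | hne
    · exact ⟨1, one_pos, le_rfl, fun x => he.elim x⟩
    · obtain ⟨p, hp⟩ := Finite.exists_min (fun p : Fin m × Fin m => (P ^ k₀) p.1 p.2)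
      exact ⟨min 1 ((P ^ k₀) p.1 p.2), lt_min one_pos (hk₀ _ _), min_le_left _ _,
        fun x y => (min_le_right _ _).trans (hp (x, y))⟩
  have hπle : ∀ y, π y ≤ 1 := fun y => by
    rw [← hπ1]
    exact Finset.single_le_sum (f := π) (fun z _ => (hπ z).le) (Finset.mem_univ y)
  have hq : ∀ z, ∑ y, |(P ^ k₀) z y - c * π y| ≤ 1 - c := by
    intro z
    have : ∀ y, |(P ^ k₀) z y - c * π y| = (P ^ k₀) z y - c * π y := fun y => by
      apply abs_of_nonneg
      have h1 := hc z y
      have h2 := mul_le_mul_of_nonneg_left (hπle y) hc0.le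
      linarith
    simp_rw [this]
    rw [Finset.sum_sub_distrib, ← Finset.mul_sum, sum_pow_apply hP1, hπ1, mul_one]
  obtain ⟨j, hj⟩ := exists_pow_lt_of_lt_one (show 0 < η / 2 by positivity)
    (show 1 - c < 1 by linarith)
  refine ⟨j * k₀ + 1, by omega, fun k hk x => ?_⟩
  have h1 := rowDist_anti hP hP1 hπ1 hst (show j * k₀ ≤ k by omega) x
  have h2 := rowDist_mul_le hP hP1 hπ hπ1 hst (sub_nonneg.2 hc1) _ hq j x
  linarith

lemma tmixMat_spec (hP : ∀ x y, 0 ≤ P x y) (hP1 : ∀ x, ∑ y, P x y = 1)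
    (herg : ∃ k : ℕ, ∀ x y, 0 < (P ^ k) x y)
    (hπ : ∀ x, 0 < π x) (hπ1 : ∑ x, π x = 1) (hst : Matrix.vecMul π P = π) :
    1 ≤ tmixMat P π ∧ ∀ x, rowDist P π (tmixMat P π) x ≤ 1 / 2 := by
  have hne : {t | 1 ≤ t ∧ dmixMat P π t ≤ 1 / 4}.Nonempty := by
    obtain ⟨t, ht1, ht⟩ := exists_rowDist_le hP hP1 herg hπ hπ1 hst
      (show (0 : ℝ) < 1 / 2 by norm_num)
    refine ⟨t, ht1, ?_⟩
    refine Real.iSup_le (fun x => ?_) (by norm_num)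
    have := ht t le_rfl x
    unfold rowDist at this
    linarith
  have hmem := Nat.sInf_mem hne
  refine ⟨hmem.1, fun x => ?_⟩
  have h1 : (1 / 2) * rowDist P π (tmixMat P π) x ≤ dmixMat P π (tmixMat P π) :=
    le_ciSup (f := fun x => (1 / 2) * ∑ y, |(P ^ tmixMat P π) x y - π y|)
      (Set.finite_range _).bddAbove x
  have h2 : dmixMat P π (tmixMat P π) ≤ 1 / 4 := hmem.2
  linarith

lemma rowDist_le_of_mul_tmixMat_le (hP : ∀ x y, 0 ≤ P x y) (hP1 : ∀ x, ∑ y, P x y = 1)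
    (herg : ∃ k : ℕ, ∀ x y, 0 < (P ^ k) x y)
    (hπ : ∀ x, 0 < π x) (hπ1 : ∑ x, π x = 1) (hst : Matrix.vecMul π P = π)
    {j k : ℕ} (h : j * tmixMat P π ≤ k) (x : Fin m) :
    rowDist P π k x ≤ 2 * (1 / 2) ^ j :=
  (rowDist_anti hP hP1 hπ1 hst h x).trans
    (rowDist_mul_le hP hP1 hπ hπ1 hst (by norm_num) π
      (tmixMat_spec hP hP1 herg hπ hπ1 hst).2 j x)

/-- The subsampling gap makes consecutive samples nearly independent. -/
lemma rowDist_rumemTau_le (hP : ∀ x y, 0 ≤ P x y) (hP1 : ∀ x, ∑ y, P x y = 1)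
    (herg : ∃ k : ℕ, ∀ x y, 0 < (P ^ k) x y)
    (hπ : ∀ x, 0 < π x) (hπ1 : ∑ x, π x = 1) (hst : Matrix.vecMul π P = π)
    {N : ℕ} {δ : ℝ} (hδ : 1 ≤ N / δ) {k : ℕ}
    (h : rumemTau (tmixMat P π) N δ ≤ k) (x : Fin m) :
    rowDist P π k x ≤ (N / δ)⁻¹ := by
  have ha : (6 : ℝ) * N / δ = 6 * (N / δ) := by ring
  have hpos : (0 : ℝ) < 6 * (N / δ) := by linarith
  set b := Real.logb 2 (6 * N / δ) with hb
  have hb0 : 0 ≤ b := Real.logb_nonneg (by norm_num) (by rw [ha]; linarith)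
  have hfl : (⌊b⌋₊ : ℝ) ≤ b := Nat.floor_le hb0
  have hk : ⌊b⌋₊ * tmixMat P π ≤ k := by
    refine le_trans ?_ h
    have : (⌊b⌋₊ : ℝ) * (tmixMat P π : ℝ) ≤ (rumemTau (tmixMat P π) N δ : ℕ) := by
      unfold rumemTau
      refine le_trans ?_ (Nat.le_ceil _)
      gcongr
    exact_mod_cast this
  refine (rowDist_le_of_mul_tmixMat_le hP hP1 herg hπ hπ1 hst hk x).trans ?_
  have h2 : 6 * (N / δ) ≤ 2 ^ (⌊b⌋₊ + 1) := by
    have h3 : (2 : ℝ) ^ b = 6 * (N / δ) := by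
      rw [hb, ha, Real.rpow_logb (by norm_num) (by norm_num) hpos]
    rw [← h3, ← Real.rpow_natCast]
    apply Real.rpow_le_rpow_of_exponent_le (by norm_num)
    push_cast
    exact (Nat.lt_floor_add_one b).le
  rw [one_div, inv_pow]
  rw [le_inv_comm₀ (by positivity) (by linarith)]
  rw [mul_inv, inv_inv]
  rw [pow_succ] at h2
  linarith

end MarkovMixing

section MarkovProcess

variable {Ω : Type*} {mΩ : MeasurableSpace Ω} {μ : Measure Ω} {m : ℕ}

/-- `s` is a Markov chain with transition matrix `P` with respect to the filtration `F`. -/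
structure IsMarkovChain (F : Filtration ℕ mΩ) (s : ℕ → Ω → Fin m)
    (P : Matrix (Fin m) (Fin m) ℝ) (μ : Measure Ω) : Prop where
  measurable : ∀ n, Measurable[F n] (s n)
  step : ∀ n (y : Fin m) (g : Ω → ℝ), Measurable[F n] g → (∃ C, ∀ ω, |g ω| ≤ C) →
    ∫ ω, g ω * (if s (n + 1) ω = y then 1 else 0) ∂μ = ∫ ω, g ω * P (s n ω) y ∂μ

lemma integrable_of_measurable_of_bounded [IsFiniteMeasure μ] {g : Ω → ℝ} (hg : Measurable g)
    (hb : ∃ C, ∀ ω, |g ω| ≤ C) : Integrable g μ := by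
  obtain ⟨C, hC⟩ := hb
  exact Integrable.of_bound hg.aestronglyMeasurable C (Filter.Eventually.of_forall hC)

variable {F : Filtration ℕ mΩ} {s : ℕ → Ω → Fin m} {P : Matrix (Fin m) (Fin m) ℝ}

lemma measurable_comp_finite {m' : MeasurableSpace Ω} {X : Ω → Fin m} (hX : Measurable[m'] X)
    {β : Type*} [MeasurableSpace β] (f : Fin m → β) : Measurable[m'] fun ω => f (X ω) :=
  (measurable_of_finite f).comp hX

lemma measurable_ite_eq {m' : MeasurableSpace Ω} {X : Ω → Fin m} (hX : Measurable[m'] X)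
    (u : Fin m) : Measurable[m'] fun ω => (if X ω = u then (1 : ℝ) else 0) :=
  measurable_comp_finite hX fun x => if x = u then (1 : ℝ) else 0

lemma bounded_mul {g h : Ω → ℝ} (hg : ∃ C, ∀ ω, |g ω| ≤ C) (hh : ∃ C, ∀ ω, |h ω| ≤ C) :
    ∃ C, ∀ ω, |g ω * h ω| ≤ C := by
  obtain ⟨C, hC⟩ := hg
  obtain ⟨D, hD⟩ := hh
  refine ⟨C * D, fun ω => ?_⟩
  rw [abs_mul]
  exact mul_le_mul (hC ω) (hD ω) (abs_nonneg _) ((abs_nonneg _).trans (hC ω))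

lemma bounded_comp_finite (X : Ω → Fin m) (f : Fin m → ℝ) : ∃ C, ∀ ω, |f (X ω)| ≤ C := by
  refine ⟨∑ x, |f x|, fun ω => ?_⟩
  exact Finset.single_le_sum (f := fun x => |f x|) (fun _ _ => abs_nonneg _)
    (Finset.mem_univ (X ω))

lemma bounded_ite_eq (X : Ω → Fin m) (u : Fin m) :
    ∃ C, ∀ ω, |(if X ω = u then (1 : ℝ) else 0)| ≤ C :=
  bounded_comp_finite X fun x => if x = u then (1 : ℝ) else 0

namespace IsMarkovChain

variable [IsFiniteMeasure μ]

lemma integral_mul_comp (hs : IsMarkovChain F s P μ) (n : ℕ) {g : Ω → ℝ}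
    (hg : Measurable[F n] g) (hb : ∃ C, ∀ ω, |g ω| ≤ C) (f : Fin m → ℝ) :
    ∫ ω, g ω * f (s (n + 1) ω) ∂μ = ∫ ω, g ω * ∑ y, P (s n ω) y * f y ∂μ := by
  have hgm : Measurable g := hg.mono (F.le n) le_rfl
  have hsm : ∀ k, Measurable (s k) := fun k => (hs.measurable k).mono (F.le k) le_rfl
  have e1 : ∀ ω, g ω * f (s (n + 1) ω)
      = ∑ y, f y * (g ω * (if s (n + 1) ω = y then 1 else 0)) := by
    intro ω; simp [mul_comm]
  have e2 : ∀ ω, g ω * ∑ y, P (s n ω) y * f y = ∑ y, f y * (g ω * P (s n ω) y) := by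
    intro ω; rw [Finset.mul_sum]; exact Finset.sum_congr rfl fun y _ => by ring
  simp_rw [e1, e2]
  rw [integral_finsetSum, integral_finsetSum]
  · refine Finset.sum_congr rfl fun y _ => ?_
    rw [integral_const_mul, integral_const_mul, hs.step n y g hg hb]
  · intro y _
    exact (integrable_of_measurable_of_bounded
      (hgm.mul (measurable_comp_finite (hsm n) fun x => P x y))
      (bounded_mul hb (bounded_comp_finite _ fun x => P x y))).const_mul _
  · intro y _
    exact (integrable_of_measurable_of_bounded
      (hgm.mul (measurable_ite_eq (hsm (n + 1)) y))
      (bounded_mul hb (bounded_ite_eq _ _))).const_mul _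

lemma integral_mul_comp_pow (hs : IsMarkovChain F s P μ) (n k : ℕ) {g : Ω → ℝ}
    (hg : Measurable[F n] g) (hb : ∃ C, ∀ ω, |g ω| ≤ C) (f : Fin m → ℝ) :
    ∫ ω, g ω * f (s (n + k) ω) ∂μ = ∫ ω, g ω * ∑ y, (P ^ k) (s n ω) y * f y ∂μ := by
  induction k generalizing f with
  | zero => simp [Matrix.one_apply]
  | succ k ih =>
    rw [← add_assoc, hs.integral_mul_comp (n + k) (hg.mono (F.mono (by omega)) le_rfl) hb f,
      ih fun x => ∑ y, P x y * f y]
    congr 1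
    ext ω
    congr 1
    simp_rw [pow_succ, Matrix.mul_apply, Finset.sum_mul, Finset.mul_sum]
    rw [Finset.sum_comm]
    exact Finset.sum_congr rfl fun y _ => Finset.sum_congr rfl fun z _ => by ring

/-- Integrating a past-measurable function of two consecutive future states. -/
lemma integral_pair (hs : IsMarkovChain F s P μ) (n k : ℕ) {G : Fin m → Fin m → Ω → ℝ}
    (hG : ∀ u v, Measurable[F n] (G u v)) (hb : ∀ u v, ∃ C, ∀ ω, |G u v ω| ≤ C) :
    ∫ ω, G (s (n + k) ω) (s (n + k + 1) ω) ω ∂μ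
      = ∫ ω, ∑ u, ∑ v, (P ^ k) (s n ω) u * P u v * G u v ω ∂μ := by
  have hsm : ∀ k, Measurable (s k) := fun k => (hs.measurable k).mono (F.le k) le_rfl
  have hGm : ∀ u v, Measurable (G u v) := fun u v => (hG u v).mono (F.le n) le_rfl
  have e1 : ∀ ω, G (s (n + k) ω) (s (n + k + 1) ω) ω
      = ∑ u, ∑ v, (G u v ω * (if s (n + k) ω = u then 1 else 0)) *
          (if s (n + k + 1) ω = v then 1 else 0) := by
    intro ω; simp
  simp_rw [e1]
  have i1 : ∀ u v, Integrable (fun ω => (G u v ω * (if s (n + k) ω = u then 1 else 0)) *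
          (if s (n + k + 1) ω = v then 1 else 0)) μ := fun u v =>
    integrable_of_measurable_of_bounded
      (((hGm u v).mul (measurable_ite_eq (hsm _) u)).mul (measurable_ite_eq (hsm _) v))
      (bounded_mul (bounded_mul (hb u v) (bounded_ite_eq _ _)) (bounded_ite_eq _ _))
  have i2 : ∀ u v, Integrable (fun ω => (P ^ k) (s n ω) u * P u v * G u v ω) μ := fun u v =>
    integrable_of_measurable_of_bounded
      ((measurable_comp_finite (hsm n) fun x => (P ^ k) x u * P u v).mul (hGm u v))
      (bounded_mul (bounded_comp_finite _ fun x => (P ^ k) x u * P u v) (hb u v))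
  rw [integral_finsetSum _ fun u _ => integrable_finsetSum _ fun v _ => i1 u v,
    integral_finsetSum _ fun u _ => integrable_finsetSum _ fun v _ => i2 u v]
  refine Finset.sum_congr rfl fun u _ => ?_
  rw [integral_finsetSum _ fun v _ => i1 u v, integral_finsetSum _ fun v _ => i2 u v]
  refine Finset.sum_congr rfl fun v _ => ?_
  rw [hs.step (n + k) v (fun ω => G u v ω * (if s (n + k) ω = u then 1 else 0))
    (((hG u v).mono (F.mono (by omega)) le_rfl).mul (measurable_ite_eq (hs.measurable _) u))
    (bounded_mul (hb u v) (bounded_ite_eq _ _))]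
  have e3 : ∀ ω, G u v ω * (if s (n + k) ω = u then 1 else 0) * P (s (n + k) ω) v
      = (P u v * G u v ω) * (if s (n + k) ω = u then 1 else 0) := by
    intro ω; split_ifs with h
    · rw [h]; ring
    · simp
  simp_rw [e3]
  have := hs.integral_mul_comp_pow n k (g := fun ω => P u v * G u v ω) ((hG u v).const_mul _)
    (bounded_mul ⟨|P u v|, fun _ => le_rfl⟩ (hb u v)) (fun x => if x = u then 1 else 0)
  rw [this]
  congr 1
  ext ω
  simp
  ring

end IsMarkovChain

end MarkovProcess

section LinearRecursion

variable {E : Type*} [NormedAddCommGroup E] [InnerProductSpace ℝ E]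
variable {Ω : Type*} {m : ℕ}

/-- The linear recursion `y ↦ y + α (A y + (A - Ā) w)` driven by the chain from time `a` on. -/
noncomputable def linIter (α : ℝ) (A : Fin m → Fin m → E →L[ℝ] E) (Ab : E →L[ℝ] E) (w : E)
    (s : ℕ → Ω → Fin m) (a : ℕ) (y₀ : E) : ℕ → Ω → E
  | 0 => fun _ => y₀
  | n + 1 => fun ω => linIter α A Ab w s a y₀ n ω +
      α • (A (s (a + n) ω) (s (a + n + 1) ω) (linIter α A Ab w s a y₀ n ω) +
        (A (s (a + n) ω) (s (a + n + 1) ω) - Ab) w)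

/-- One-step expansion of the squared norm, comparing with an earlier iterate `p`. -/
lemma norm_sq_step_le {B Ab : E →L[ℝ] E} (hB : ‖B‖ ≤ 2) (hAb : ‖Ab‖ ≤ 2) {lam α t : ℝ}
    (hneg : ∀ v, inner ℝ v (Ab v) ≤ -lam * ‖v‖ ^ 2) (hα : 0 ≤ α) (ht : 1 ≤ t)
    (hαt : 8 * (α * t) ≤ 1) {Y p w : E}
    (hYp : ‖Y - p‖ ≤ 2 * α * t * (2 * ‖p‖ + 4 * ‖w‖)) :
    ‖Y + α • (B Y + (B - Ab) w)‖ ^ 2 ≤ (1 - 2 * α * lam) * ‖Y‖ ^ 2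
      + 2 * α * inner ℝ p ((B - Ab) (p + w)) + 800 * (α ^ 2 * t) * (‖Y‖ ^ 2 + ‖w‖ ^ 2) ∧
    ‖p‖ ≤ 2 * ‖Y‖ + 2 * ‖w‖ := by
  have hαt0 : 0 ≤ α * t := mul_nonneg hα (by linarith)
  have hp1 : ‖p‖ ≤ ‖Y‖ + ‖Y - p‖ := by
    have := norm_sub_norm_le p Y
    rw [norm_sub_rev] at this; linarith
  have hd1 : ‖Y - p‖ ≤ 8 * (α * t) * (‖Y‖ + 2 * ‖w‖) := by
    have h1 : ‖Y - p‖ ≤ 4 * (α * t) * (‖Y‖ + ‖Y - p‖) + 8 * (α * t) * ‖w‖ := by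
      refine hYp.trans ?_
      have := mul_le_mul_of_nonneg_left hp1 (show 0 ≤ 4 * (α * t) by linarith)
      nlinarith
    have h2 : 4 * (α * t) * ‖Y - p‖ ≤ 1 / 2 * ‖Y - p‖ :=
      mul_le_mul_of_nonneg_right (by linarith) (norm_nonneg _)
    nlinarith
  have hd2 : ‖Y - p‖ ≤ ‖Y‖ + 2 * ‖w‖ := by
    refine hd1.trans ?_
    have : 0 ≤ ‖Y‖ + 2 * ‖w‖ := by positivity
    nlinarith
  have hp2 : ‖p‖ ≤ 2 * ‖Y‖ + 2 * ‖w‖ := by linarith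
  refine ⟨?_, hp2⟩
  have hD : ‖B - Ab‖ ≤ 4 := (norm_sub_le _ _).trans (by linarith)
  have hDv : ∀ v, ‖(B - Ab) v‖ ≤ 4 * ‖v‖ := fun v =>
    ((B - Ab).le_opNorm v).trans (mul_le_mul_of_nonneg_right hD (norm_nonneg _))
  have hBv : ∀ v, ‖B v‖ ≤ 2 * ‖v‖ := fun v =>
    (B.le_opNorm v).trans (mul_le_mul_of_nonneg_right hB (norm_nonneg _))
  have hexp : ‖Y + α • (B Y + (B - Ab) w)‖ ^ 2
      = ‖Y‖ ^ 2 + 2 * α * inner ℝ Y (B Y + (B - Ab) w) + α ^ 2 * ‖B Y + (B - Ab) w‖ ^ 2 := by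
    rw [norm_add_sq_real, inner_smul_right, norm_smul, mul_pow, Real.norm_eq_abs, sq_abs]
    ring
  have hin : inner ℝ Y (B Y + (B - Ab) w) = inner ℝ Y (Ab Y) + inner ℝ p ((B - Ab) (p + w))
      + inner ℝ (Y - p) ((B - Ab) (Y + w)) + inner ℝ p ((B - Ab) (Y - p)) := by
    simp only [inner_add_right, inner_sub_left, _root_.sub_apply, map_add, map_sub,
      inner_sub_right]
    ring
  have hYw : ‖Y + w‖ ≤ ‖Y‖ + ‖w‖ := norm_add_le _ _
  have hn0 := norm_nonneg Y
  have hn1 := norm_nonneg w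
  have hn2 := norm_nonneg (Y - p)
  have hn3 := norm_nonneg p
  have hQ : (‖Y‖ + ‖w‖) ^ 2 ≤ 2 * (‖Y‖ ^ 2 + ‖w‖ ^ 2) := by nlinarith [sq_nonneg (‖Y‖ - ‖w‖)]
  have b1 : inner ℝ (Y - p) ((B - Ab) (Y + w)) ≤ ‖Y - p‖ * (4 * (‖Y‖ + ‖w‖)) :=
    (real_inner_le_norm _ _).trans
      (mul_le_mul_of_nonneg_left ((hDv _).trans (by linarith)) hn2)
  have b2 : inner ℝ p ((B - Ab) (Y - p)) ≤ ‖Y - p‖ * (8 * (‖Y‖ + ‖w‖)) := by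
    refine (real_inner_le_norm _ _).trans ?_
    calc ‖p‖ * ‖(B - Ab) (Y - p)‖ ≤ (2 * ‖Y‖ + 2 * ‖w‖) * (4 * ‖Y - p‖) :=
          mul_le_mul hp2 (hDv _) (norm_nonneg _) (by linarith)
      _ = _ := by ring
  have b3 : ‖Y - p‖ * (12 * (‖Y‖ + ‖w‖)) ≤ 384 * (α * t) * (‖Y‖ ^ 2 + ‖w‖ ^ 2) := by
    calc ‖Y - p‖ * (12 * (‖Y‖ + ‖w‖))
        ≤ (8 * (α * t) * (‖Y‖ + 2 * ‖w‖)) * (12 * (‖Y‖ + ‖w‖)) :=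
          mul_le_mul_of_nonneg_right hd1 (by linarith)
      _ ≤ (8 * (α * t) * (2 * (‖Y‖ + ‖w‖))) * (12 * (‖Y‖ + ‖w‖)) := by
          gcongr; linarith
      _ = 192 * (α * t) * (‖Y‖ + ‖w‖) ^ 2 := by ring
      _ ≤ 192 * (α * t) * (2 * (‖Y‖ ^ 2 + ‖w‖ ^ 2)) :=
          mul_le_mul_of_nonneg_left hQ (by linarith)
      _ = _ := by ring
  have b4 : ‖B Y + (B - Ab) w‖ ^ 2 ≤ 32 * (‖Y‖ ^ 2 + ‖w‖ ^ 2) := by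
    have h : ‖B Y + (B - Ab) w‖ ≤ 4 * (‖Y‖ + ‖w‖) := by
      refine (norm_add_le _ _).trans ?_
      have := hBv Y
      have := hDv w
      linarith
    have := pow_le_pow_left₀ (norm_nonneg _) h 2
    nlinarith
  have b5 : α ^ 2 * ‖B Y + (B - Ab) w‖ ^ 2 ≤ 32 * (α ^ 2 * t) * (‖Y‖ ^ 2 + ‖w‖ ^ 2) := by
    calc α ^ 2 * ‖B Y + (B - Ab) w‖ ^ 2 ≤ α ^ 2 * (32 * (‖Y‖ ^ 2 + ‖w‖ ^ 2)) :=
          mul_le_mul_of_nonneg_left b4 (sq_nonneg _)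
      _ = 32 * (α ^ 2 * 1) * (‖Y‖ ^ 2 + ‖w‖ ^ 2) := by ring
      _ ≤ _ := by gcongr
  have b6 := hneg Y
  rw [hexp, hin]
  have b7 : 2 * α * (inner ℝ Y (Ab Y) + inner ℝ p ((B - Ab) (p + w))
      + inner ℝ (Y - p) ((B - Ab) (Y + w)) + inner ℝ p ((B - Ab) (Y - p)))
      ≤ 2 * α * (-lam * ‖Y‖ ^ 2 + inner ℝ p ((B - Ab) (p + w))
        + 384 * (α * t) * (‖Y‖ ^ 2 + ‖w‖ ^ 2)) := by
    apply mul_le_mul_of_nonneg_left _ (by linarith)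
    linarith
  have b8 : 2 * α * (384 * (α * t) * (‖Y‖ ^ 2 + ‖w‖ ^ 2))
      = 768 * (α ^ 2 * t) * (‖Y‖ ^ 2 + ‖w‖ ^ 2) := by ring
  linarith

variable {α : ℝ} {A : Fin m → Fin m → E →L[ℝ] E} {Ab : E →L[ℝ] E} {w : E}
  {s : ℕ → Ω → Fin m} {a : ℕ} {y₀ : E}

/-- Over few steps the recursion stays close to its starting point. -/
lemma norm_linIter_sub_le (hA : ∀ u v, ‖A u v‖ ≤ 2) (hAb : ‖Ab‖ ≤ 2) (hα : 0 ≤ α)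
    (n j : ℕ) (hj : 4 * (α * j) ≤ 1) (ω : Ω) :
    ‖linIter α A Ab w s a y₀ (n + j) ω - linIter α A Ab w s a y₀ n ω‖
      ≤ 2 * α * j * (2 * ‖linIter α A Ab w s a y₀ n ω‖ + 4 * ‖w‖) := by
  induction j with
  | zero => simp
  | succ j ih =>
    push_cast at hj ⊢
    have hj' : 4 * (α * j) ≤ 1 := by nlinarith
    have ih := ih hj'
    set p := linIter α A Ab w s a y₀ n ω
    set Y := linIter α A Ab w s a y₀ (n + j) ω with hY
    have hstep : linIter α A Ab w s a y₀ (n + (j + 1)) ω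
        = Y + α • (A (s (a + (n + j)) ω) (s (a + (n + j) + 1) ω) Y +
          (A (s (a + (n + j)) ω) (s (a + (n + j) + 1) ω) - Ab) w) := rfl
    rw [hstep]
    set B := A (s (a + (n + j)) ω) (s (a + (n + j) + 1) ω)
    have hB : ‖B‖ ≤ 2 := hA _ _
    have hD : ‖B - Ab‖ ≤ 4 := (norm_sub_le _ _).trans (by linarith)
    have h1 : ‖B Y‖ ≤ 2 * (‖p‖ + ‖Y - p‖) := by
      refine (B.le_opNorm Y).trans ?_
      have h3 : ‖Y‖ ≤ ‖p‖ + ‖Y - p‖ := by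
        have := norm_sub_norm_le Y p; linarith
      exact mul_le_mul hB h3 (norm_nonneg _) (by norm_num)
    have h2 : ‖(B - Ab) w‖ ≤ 4 * ‖w‖ :=
      ((B - Ab).le_opNorm w).trans (mul_le_mul_of_nonneg_right hD (norm_nonneg _))
    have h3 : ‖Y + α • (B Y + (B - Ab) w) - p‖ ≤ ‖Y - p‖ + α * (‖B Y‖ + ‖(B - Ab) w‖) := by
      rw [add_sub_right_comm]
      refine (norm_add_le _ _).trans ?_
      rw [norm_smul, Real.norm_of_nonneg hα]
      gcongr
      exact norm_add_le _ _
    refine h3.trans ?_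
    have h4 : α * (‖B Y‖ + ‖(B - Ab) w‖) ≤ α * (2 * (‖p‖ + ‖Y - p‖) + 4 * ‖w‖) := by gcongr
    have h5 : 2 * α * ‖Y - p‖ ≤ 2 * α * (2 * α * j * (2 * ‖p‖ + 4 * ‖w‖)) := by gcongr
    have h6 : 2 * α * (2 * α * j * (2 * ‖p‖ + 4 * ‖w‖)) ≤ α * (2 * ‖p‖ + 4 * ‖w‖) := by
      have h7 : 0 ≤ α * (2 * ‖p‖ + 4 * ‖w‖) := by positivity
      calc 2 * α * (2 * α * j * (2 * ‖p‖ + 4 * ‖w‖))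
          = 4 * (α * j) * (α * (2 * ‖p‖ + 4 * ‖w‖)) := by ring
        _ ≤ 1 * (α * (2 * ‖p‖ + 4 * ‖w‖)) := mul_le_mul_of_nonneg_right hj' h7
        _ = _ := one_mul _
    nlinarith

lemma exists_norm_linIter_le (hA : ∀ u v, ‖A u v‖ ≤ 2) (n : ℕ) :
    ∃ C, ∀ ω, ‖linIter α A Ab w s a y₀ n ω‖ ≤ C := by
  induction n with
  | zero => exact ⟨‖y₀‖, fun _ => le_rfl⟩
  | succ n ih =>
    obtain ⟨C, hC⟩ := ih
    refine ⟨C + |α| * (2 * C + (2 + ‖Ab‖) * ‖w‖), fun ω => ?_⟩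
    rw [linIter]
    refine (norm_add_le _ _).trans (add_le_add (hC ω) ?_)
    rw [norm_smul, Real.norm_eq_abs]
    refine mul_le_mul_of_nonneg_left ((norm_add_le _ _).trans (add_le_add ?_ ?_)) (abs_nonneg _)
    · exact (ContinuousLinearMap.le_opNorm _ _).trans
        (mul_le_mul (hA _ _) (hC ω) (norm_nonneg _) zero_le_two)
    · exact (ContinuousLinearMap.le_opNorm _ _).trans
        (mul_le_mul_of_nonneg_right ((norm_sub_le _ _).trans (by gcongr; exact hA _ _))
          (norm_nonneg _))

variable [MeasurableSpace E] [BorelSpace E] [SecondCountableTopology E]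
variable {mΩ : MeasurableSpace Ω} {μ : Measure Ω} {F : Filtration ℕ mΩ}
  {P : Matrix (Fin m) (Fin m) ℝ}

lemma measurable_linIter (hs : ∀ n, Measurable[F n] (s n)) (n : ℕ) :
    Measurable[F (a + n)] (linIter α A Ab w s a y₀ n) := by
  induction n with
  | zero => exact measurable_const
  | succ n ih =>
    have ih' : Measurable[F (a + (n + 1))] (linIter α A Ab w s a y₀ n) :=
      ih.mono (F.mono (by omega)) le_rfl
    have h1 : Measurable[F (a + (n + 1))] (s (a + n)) :=
      (hs (a + n)).mono (F.mono (by omega)) le_rfl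
    have h2 : Measurable[F (a + (n + 1))] (s (a + n + 1)) := hs (a + (n + 1))
    have hpair : Measurable[F (a + (n + 1))] fun ω => (s (a + n) ω, s (a + n + 1) ω) :=
      h1.prodMk h2
    have h3 : Measurable[F (a + (n + 1))] fun ω =>
        (A (s (a + n) ω) (s (a + n + 1) ω) - Ab) w :=
      (measurable_of_finite fun p : Fin m × Fin m => (A p.1 p.2 - Ab) w).comp hpair
    have h4 : Measurable[F (a + (n + 1))] fun ω =>
        A (s (a + n) ω) (s (a + n + 1) ω) (linIter α A Ab w s a y₀ n ω) := by
      have h5 : Measurable fun q : (Fin m × Fin m) × E => A q.1.1 q.1.2 q.2 :=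
        measurable_from_prod_countable_right fun p => (A p.1 p.2).continuous.measurable
      exact h5.comp (hpair.prodMk ih')
    exact ih'.add ((h4.add h3).const_smul α)

end LinearRecursion

section MeanSquare

variable {E : Type*} [NormedAddCommGroup E] [InnerProductSpace ℝ E]
variable {Ω : Type*} {m : ℕ} {α : ℝ} {A : Fin m → Fin m → E →L[ℝ] E} {Ab : E →L[ℝ] E} {w : E}
  {s : ℕ → Ω → Fin m} {a : ℕ} {y₀ : E}
variable [MeasurableSpace E] [BorelSpace E] [SecondCountableTopology E]
variable {mΩ : MeasurableSpace Ω} {μ : Measure Ω} [IsFiniteMeasure μ] {F : Filtration ℕ mΩ}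
  {P : Matrix (Fin m) (Fin m) ℝ} {χ : Ω → ℝ} {τ : ℕ} {lam : ℝ}

/-- The noise term correlated with an iterate `τ` steps in the past is small in expectation. -/
lemma integral_inner_noise_le (hs : IsMarkovChain F s P μ) (hP1 : ∀ x, ∑ y, P x y = 1)
    (hA : ∀ u v, ‖A u v‖ ≤ 2)
    (hmix : ∀ x, ‖(∑ u, ∑ v, ((P ^ τ) x u * P u v) • A u v) - Ab‖ ≤ α)
    (hχ : Measurable[F a] χ) (hχ0 : ∀ ω, 0 ≤ χ ω) (hχ1 : ∀ ω, χ ω ≤ 1) (n : ℕ) :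
    ∫ ω, χ ω * inner ℝ (linIter α A Ab w s a y₀ n ω)
      ((A (s (a + n + τ) ω) (s (a + n + τ + 1) ω) - Ab) (linIter α A Ab w s a y₀ n ω + w)) ∂μ
    ≤ ∫ ω, χ ω * (α * (‖linIter α A Ab w s a y₀ n ω‖ *
        (‖linIter α A Ab w s a y₀ n ω‖ + ‖w‖))) ∂μ := by
  set p := linIter α A Ab w s a y₀ n with hp
  have hpm : Measurable[F (a + n)] p := measurable_linIter hs.measurable n
  have hχm : Measurable[F (a + n)] χ := hχ.mono (F.mono (by omega)) le_rfl
  obtain ⟨C, hC⟩ : ∃ C, ∀ ω, ‖p ω‖ ≤ C := exists_norm_linIter_le hA n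
  have hχabs : ∃ D, ∀ ω, |χ ω| ≤ D := ⟨1, fun ω => by rw [abs_of_nonneg (hχ0 ω)]; exact hχ1 ω⟩
  have hinb : ∀ B : E →L[ℝ] E, ∃ D, ∀ ω, |inner ℝ (p ω) (B (p ω + w))| ≤ D := fun B => by
    refine ⟨C * (‖B‖ * (C + ‖w‖)), fun ω => (abs_real_inner_le_norm _ _).trans ?_⟩
    have h1 := hC ω
    refine mul_le_mul h1 ((B.le_opNorm _).trans ?_) (norm_nonneg _) ((norm_nonneg _).trans h1)
    gcongr
    exact (norm_add_le _ _).trans (by linarith)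
  have hinm : ∀ B : E →L[ℝ] E, Measurable[F (a + n)] fun ω => inner ℝ (p ω) (B (p ω + w)) :=
    fun B => by
      have h5 : Measurable fun q : E => inner ℝ q (B (q + w)) := by fun_prop
      exact h5.comp hpm
  have h1 := hs.integral_pair (a + n) τ
    (G := fun u v ω => χ ω * inner ℝ (p ω) ((A u v - Ab) (p ω + w)))
    (fun u v => hχm.mul (hinm _)) (fun u v => bounded_mul hχabs (hinb _))
  refine h1.trans_le ?_
  have e1 : ∀ ω, ∑ u, ∑ v, (P ^ τ) (s (a + n) ω) u * P u v *
        (χ ω * inner ℝ (p ω) ((A u v - Ab) (p ω + w)))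
      = χ ω * inner ℝ (p ω) (((∑ u, ∑ v, ((P ^ τ) (s (a + n) ω) u * P u v) • A u v) - Ab)
          (p ω + w)) := by
    intro ω
    have h2 : ∑ u, ∑ v, (P ^ τ) (s (a + n) ω) u * P u v = 1 := by
      simp_rw [← Finset.mul_sum, hP1, mul_one, sum_pow_apply hP1]
    have h3 : ((∑ u, ∑ v, ((P ^ τ) (s (a + n) ω) u * P u v) • A u v) - Ab)
        = ∑ u, ∑ v, ((P ^ τ) (s (a + n) ω) u * P u v) • (A u v - Ab) := by
      simp_rw [smul_sub, Finset.sum_sub_distrib, ← Finset.sum_smul, h2, one_smul]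
    rw [h3]
    simp only [_root_.sum_apply, inner_sum, Finset.mul_sum,
      _root_.smul_apply, inner_smul_right]
    exact Finset.sum_congr rfl fun u _ => Finset.sum_congr rfl fun v _ => by ring
  have hnorm : ∃ D, ∀ ω, |α * (‖p ω‖ * (‖p ω‖ + ‖w‖))| ≤ D := by
    refine ⟨|α| * (C * (C + ‖w‖)), fun ω => ?_⟩
    have h4 := hC ω
    have h5 := norm_nonneg (p ω)
    rw [abs_mul, abs_of_nonneg (show 0 ≤ ‖p ω‖ * (‖p ω‖ + ‖w‖) by positivity)]
    gcongr
    linarith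
  have hle := F.le (a + n)
  have hpm' : Measurable p := hpm.mono hle le_rfl
  have hχm' : Measurable χ := hχm.mono hle le_rfl
  refine integral_mono (integrable_finsetSum _ fun u _ => integrable_finsetSum _ fun v _ =>
    integrable_of_measurable_of_bounded (((measurable_comp_finite (hs.measurable (a + n))
      fun x => (P ^ τ) x u * P u v).mul (hχm.mul (hinm _))).mono hle le_rfl)
      (bounded_mul (bounded_comp_finite _ fun x => (P ^ τ) x u * P u v)
        (bounded_mul hχabs (hinb _))))
    (integrable_of_measurable_of_bounded (by fun_prop) (bounded_mul hχabs hnorm)) fun ω => ?_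
  simp only [e1]
  refine mul_le_mul_of_nonneg_left ((real_inner_le_norm _ _).trans ?_) (hχ0 ω)
  have hα : 0 ≤ α := (norm_nonneg _).trans (hmix (s (a + n) ω))
  calc ‖p ω‖ * ‖((∑ u, ∑ v, ((P ^ τ) (s (a + n) ω) u * P u v) • A u v) - Ab) (p ω + w)‖
      ≤ ‖p ω‖ * (α * (‖p ω‖ + ‖w‖)) := by
        gcongr
        refine (ContinuousLinearMap.le_opNorm _ _).trans ?_
        exact mul_le_mul (hmix _) (norm_add_le _ _) (norm_nonneg _) hα
    _ = _ := by ring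

lemma integrable_mul_norm_linIter_sq (hs : IsMarkovChain F s P μ) (hA : ∀ u v, ‖A u v‖ ≤ 2)
    (hχ : Measurable[F a] χ) (hχ0 : ∀ ω, 0 ≤ χ ω) (hχ1 : ∀ ω, χ ω ≤ 1) (n : ℕ) :
    Integrable (fun ω => χ ω * ‖linIter α A Ab w s a y₀ n ω‖ ^ 2) μ := by
  have hpm : Measurable (linIter α A Ab w s a y₀ n) :=
    (measurable_linIter hs.measurable n).mono (F.le _) le_rfl
  have hχm : Measurable χ := hχ.mono (F.le _) le_rfl
  obtain ⟨C, hC⟩ := exists_norm_linIter_le (α := α) (Ab := Ab) (w := w) (s := s) (a := a)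
    (y₀ := y₀) hA n
  refine integrable_of_measurable_of_bounded (by fun_prop) (bounded_mul
    ⟨1, fun ω => by rw [abs_of_nonneg (hχ0 ω)]; exact hχ1 ω⟩ ⟨C ^ 2, fun ω => ?_⟩)
  rw [abs_of_nonneg (by positivity)]
  exact pow_le_pow_left₀ (norm_nonneg _) (hC ω) 2

variable (hs : IsMarkovChain F s P μ) (hP1 : ∀ x, ∑ y, P x y = 1)
  (hA : ∀ u v, ‖A u v‖ ≤ 2) (hAb : ‖Ab‖ ≤ 2)
  (hneg : ∀ v, inner ℝ v (Ab v) ≤ -lam * ‖v‖ ^ 2)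
  (hmix : ∀ x, ‖(∑ u, ∑ v, ((P ^ τ) x u * P u v) • A u v) - Ab‖ ≤ α)
  (hα : 0 ≤ α) (hτ : 1 ≤ τ) (hlam1 : lam ≤ 1) (hαlam : 832 * (α * τ) ≤ lam)
  (hχ : Measurable[F a] χ) (hχ0 : ∀ ω, 0 ≤ χ ω) (hχ1 : ∀ ω, χ ω ≤ 1)

include hs hP1 hA hAb hneg hmix hα hτ hlam1 hαlam hχ hχ0 hχ1

lemma meanSq_linIter_step_le (n : ℕ) :
    ∫ ω, χ ω * ‖linIter α A Ab w s a y₀ (n + τ + 1) ω‖ ^ 2 ∂μ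
      ≤ (1 - α * lam) * ∫ ω, χ ω * ‖linIter α A Ab w s a y₀ (n + τ) ω‖ ^ 2 ∂μ
        + 832 * (α ^ 2 * τ) * ‖w‖ ^ 2 * ∫ ω, χ ω ∂μ := by
  have hτ' : (1 : ℝ) ≤ τ := by exact_mod_cast hτ
  have hαt : 0 ≤ α * τ := by positivity
  set p := linIter α A Ab w s a y₀ n with hp
  set Y := linIter α A Ab w s a y₀ (n + τ) with hY
  set B : Ω → E →L[ℝ] E := fun ω => A (s (a + n + τ) ω) (s (a + n + τ + 1) ω) with hB
  have hstep : ∀ ω, linIter α A Ab w s a y₀ (n + τ + 1) ω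
      = Y ω + α • (B ω (Y ω) + (B ω - Ab) w) := fun ω => by
    simp only [hB, add_assoc a n τ]; rfl
  have hpt : ∀ ω, ‖linIter α A Ab w s a y₀ (n + τ + 1) ω‖ ^ 2 ≤ (1 - 2 * α * lam) * ‖Y ω‖ ^ 2
      + 2 * α * inner ℝ (p ω) ((B ω - Ab) (p ω + w))
      + 800 * (α ^ 2 * τ) * (‖Y ω‖ ^ 2 + ‖w‖ ^ 2) ∧ ‖p ω‖ ≤ 2 * ‖Y ω‖ + 2 * ‖w‖ := fun ω => by
    rw [hstep]
    exact norm_sq_step_le (hA _ _) hAb hneg hα hτ' (by linarith)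
      (norm_linIter_sub_le hA hAb hα n τ (by linarith) ω)
  have iY : Integrable (fun ω => χ ω * ‖Y ω‖ ^ 2) μ :=
    integrable_mul_norm_linIter_sq hs hA hχ hχ0 hχ1 (n + τ)
  have iY1 : Integrable (fun ω => χ ω * ‖linIter α A Ab w s a y₀ (n + τ + 1) ω‖ ^ 2) μ :=
    integrable_mul_norm_linIter_sq hs hA hχ hχ0 hχ1 (n + τ + 1)
  have ip : Integrable (fun ω => χ ω * ‖p ω‖ ^ 2) μ :=
    integrable_mul_norm_linIter_sq hs hA hχ hχ0 hχ1 n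
  have hχm : Measurable χ := hχ.mono (F.le _) le_rfl
  have hpm : Measurable p := (measurable_linIter hs.measurable n).mono (F.le _) le_rfl
  have hχabs : ∃ D, ∀ ω, |χ ω| ≤ D := ⟨1, fun ω => by rw [abs_of_nonneg (hχ0 ω)]; exact hχ1 ω⟩
  have iχ : Integrable χ μ := integrable_of_measurable_of_bounded hχm hχabs
  obtain ⟨C, hC⟩ : ∃ C, ∀ ω, ‖p ω‖ ≤ C := exists_norm_linIter_le hA n
  have hsm : ∀ k, Measurable (s k) := fun k => (hs.measurable k).mono (F.le k) le_rfl
  have iN : Integrable (fun ω => χ ω * inner ℝ (p ω) ((B ω - Ab) (p ω + w))) μ := by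
    have hpair : Measurable fun ω => (s (a + n + τ) ω, s (a + n + τ + 1) ω) :=
      (hsm _).prodMk (hsm _)
    have h5 : Measurable fun q : (Fin m × Fin m) × E =>
        (inner ℝ q.2 ((A q.1.1 q.1.2 - Ab) (q.2 + w)) : ℝ) :=
      measurable_from_prod_countable_right fun p => by fun_prop
    refine integrable_of_measurable_of_bounded (hχm.mul (h5.comp (hpair.prodMk hpm)))
      (bounded_mul hχabs ⟨C * (4 * (C + ‖w‖)), fun ω => (abs_real_inner_le_norm _ _).trans ?_⟩)
    have h1 := hC ω
    refine mul_le_mul h1 ((ContinuousLinearMap.le_opNorm _ _).trans ?_) (norm_nonneg _)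
      ((norm_nonneg _).trans h1)
    refine mul_le_mul ((norm_sub_le _ _).trans ?_) ((norm_add_le _ _).trans ?_)
      (norm_nonneg _) (by norm_num)
    · linarith [hA (s (a + n + τ) ω) (s (a + n + τ + 1) ω)]
    · simpa using h1
  have ibound : Integrable (fun ω => χ ω * (α * (‖p ω‖ * (‖p ω‖ + ‖w‖)))) μ := by
    refine integrable_of_measurable_of_bounded (by fun_prop)
      (bounded_mul hχabs ⟨α * (C * (C + ‖w‖)), fun ω => ?_⟩)
    have h1 := hC ω
    rw [abs_of_nonneg (by positivity)]
    have := norm_nonneg (p ω)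
    gcongr
    linarith
  have hnoise : ∫ ω, χ ω * inner ℝ (p ω) ((B ω - Ab) (p ω + w)) ∂μ
      ≤ 12 * (α * τ) * ∫ ω, χ ω * ‖Y ω‖ ^ 2 ∂μ + 12 * (α * τ) * ‖w‖ ^ 2 * ∫ ω, χ ω ∂μ := by
    refine (integral_inner_noise_le hs hP1 hA hmix hχ hχ0 hχ1 n).trans ?_
    rw [← integral_const_mul, ← integral_const_mul, ← integral_add (iY.const_mul _)
      (iχ.const_mul _)]
    refine integral_mono ibound ((iY.const_mul _).add (iχ.const_mul _)) fun ω => ?_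
    have h1 := (hpt ω).2
    have h0 := norm_nonneg (p ω)
    have h2 : ‖p ω‖ * (‖p ω‖ + ‖w‖) ≤ 12 * (‖Y ω‖ ^ 2 + ‖w‖ ^ 2) := by
      have h3 : ‖p ω‖ * (‖p ω‖ + ‖w‖)
          ≤ (2 * ‖Y ω‖ + 2 * ‖w‖) * (2 * ‖Y ω‖ + 2 * ‖w‖ + ‖w‖) := by gcongr
      nlinarith [sq_nonneg (‖Y ω‖ - ‖w‖), norm_nonneg (Y ω), norm_nonneg w]
    have h4 : α * (‖p ω‖ * (‖p ω‖ + ‖w‖)) ≤ (α * τ) * (12 * (‖Y ω‖ ^ 2 + ‖w‖ ^ 2)) := by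
      calc α * (‖p ω‖ * (‖p ω‖ + ‖w‖)) ≤ α * (12 * (‖Y ω‖ ^ 2 + ‖w‖ ^ 2)) := by gcongr
        _ = (α * 1) * (12 * (‖Y ω‖ ^ 2 + ‖w‖ ^ 2)) := by ring
        _ ≤ _ := by gcongr
    have h5 := mul_le_mul_of_nonneg_left h4 (hχ0 ω)
    simp only
    linarith
  calc ∫ ω, χ ω * ‖linIter α A Ab w s a y₀ (n + τ + 1) ω‖ ^ 2 ∂μ
      ≤ ∫ ω, (1 - 2 * α * lam + 800 * (α ^ 2 * τ)) * (χ ω * ‖Y ω‖ ^ 2)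
          + 2 * α * (χ ω * inner ℝ (p ω) ((B ω - Ab) (p ω + w)))
          + 800 * (α ^ 2 * τ) * ‖w‖ ^ 2 * χ ω ∂μ := by
        refine integral_mono iY1 (((iY.const_mul _).add (iN.const_mul _)).add
          (iχ.const_mul _)) fun ω => ?_
        have := mul_le_mul_of_nonneg_left (hpt ω).1 (hχ0 ω)
        simp only
        linarith
    _ = (1 - 2 * α * lam + 800 * (α ^ 2 * τ)) * ∫ ω, χ ω * ‖Y ω‖ ^ 2 ∂μ
          + 2 * α * ∫ ω, χ ω * inner ℝ (p ω) ((B ω - Ab) (p ω + w)) ∂μ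
          + 800 * (α ^ 2 * τ) * ‖w‖ ^ 2 * ∫ ω, χ ω ∂μ := by
        have i12 : Integrable (fun ω => (1 - 2 * α * lam + 800 * (α ^ 2 * τ)) * (χ ω * ‖Y ω‖ ^ 2)
            + 2 * α * (χ ω * inner ℝ (p ω) ((B ω - Ab) (p ω + w)))) μ :=
          (iY.const_mul _).add (iN.const_mul _)
        rw [integral_add i12 (iχ.const_mul _),
          integral_add (iY.const_mul _) (iN.const_mul _), integral_const_mul, integral_const_mul,
          integral_const_mul]
    _ ≤ _ := by
        set I := ∫ ω, χ ω * ‖Y ω‖ ^ 2 ∂μ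
        set J := ∫ ω, χ ω ∂μ
        have hI : 0 ≤ I := integral_nonneg fun ω => mul_nonneg (hχ0 ω) (by positivity)
        have hJ : 0 ≤ J := integral_nonneg fun ω => hχ0 ω
        have h1 := mul_le_mul_of_nonneg_left hnoise (show 0 ≤ 2 * α by linarith)
        have h2 : α * (824 * (α * τ)) * I ≤ α * lam * I := by
          gcongr; linarith
        have h3 : 0 ≤ α ^ 2 * τ * ‖w‖ ^ 2 * J := by positivity
        nlinarith

variable (hlam0 : 0 < lam)

include hlam0

lemma meanSq_linIter_le (n : ℕ) :
    ∫ ω, χ ω * ‖linIter α A Ab w s a y₀ (n + τ) ω‖ ^ 2 ∂μ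
      ≤ ((1 - α * lam) ^ n * (8 * ‖y₀‖ ^ 2 + 2 * ‖w‖ ^ 2)
        + 832 * (α * τ) * ‖w‖ ^ 2 / lam) * ∫ ω, χ ω ∂μ := by
  have hτ' : (1 : ℝ) ≤ τ := by exact_mod_cast hτ
  have hαt : 0 ≤ α * τ := by positivity
  have hJ : 0 ≤ ∫ ω, χ ω ∂μ := integral_nonneg fun ω => hχ0 ω
  have hα1 : α * lam ≤ 1 := by
    have : α * 1 ≤ α * τ := by gcongr
    nlinarith
  induction n with
  | zero =>
    have iχ : Integrable χ μ := integrable_of_measurable_of_bounded (hχ.mono (F.le _) le_rfl)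
      ⟨1, fun ω => by rw [abs_of_nonneg (hχ0 ω)]; exact hχ1 ω⟩
    calc ∫ ω, χ ω * ‖linIter α A Ab w s a y₀ (0 + τ) ω‖ ^ 2 ∂μ
        ≤ ∫ ω, (8 * ‖y₀‖ ^ 2 + 2 * ‖w‖ ^ 2) * χ ω ∂μ := by
          refine integral_mono (integrable_mul_norm_linIter_sq hs hA hχ hχ0 hχ1 _)
            (iχ.const_mul _) fun ω => ?_
          have h1 := norm_linIter_sub_le (α := α) (w := w) (s := s) (a := a) (y₀ := y₀)
            hA hAb hα 0 τ (by linarith) ω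
          have h2 : ‖linIter α A Ab w s a y₀ (0 + τ) ω‖ ≤ 2 * ‖y₀‖ + ‖w‖ := by
            have h3 : linIter α A Ab w s a y₀ 0 ω = y₀ := rfl
            rw [h3] at h1
            have h4 := norm_le_norm_add_norm_sub' (linIter α A Ab w s a y₀ (0 + τ) ω) y₀
            have h5 : 2 * (α * τ) * (2 * ‖y₀‖ + 4 * ‖w‖) ≤ (1 / 416) * (2 * ‖y₀‖ + 4 * ‖w‖) := by
              gcongr; linarith
            linarith [norm_nonneg y₀, norm_nonneg w]
          have h6 : ‖linIter α A Ab w s a y₀ (0 + τ) ω‖ ^ 2 ≤ 8 * ‖y₀‖ ^ 2 + 2 * ‖w‖ ^ 2 := by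
            nlinarith [pow_le_pow_left₀ (norm_nonneg _) h2 2, sq_nonneg (2 * ‖y₀‖ - ‖w‖)]
          simp only
          rw [mul_comm]
          exact mul_le_mul_of_nonneg_right h6 (hχ0 ω)
      _ ≤ _ := by
          rw [integral_const_mul, pow_zero, one_mul]
          refine mul_le_mul_of_nonneg_right ?_ hJ
          have : 0 ≤ 832 * (α * τ) * ‖w‖ ^ 2 / lam := by positivity
          linarith
  | succ n ih =>
    have h1 := meanSq_linIter_step_le (w := w) (y₀ := y₀) hs hP1 hA hAb hneg hmix hα hτ hlam1
      hαlam hχ hχ0 hχ1 n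
    rw [show n + 1 + τ = n + τ + 1 by omega]
    refine h1.trans ((add_le_add_left (mul_le_mul_of_nonneg_left ih (by linarith)) _).trans_eq ?_)
    field_simp
    ring

/-- Mean-square contraction of the homogeneous recursion. -/
lemma meanSq_linIter_homogeneous_le (n : ℕ) :
    ∫ ω, χ ω * ‖linIter α A Ab 0 s a y₀ n ω‖ ^ 2 ∂μ
      ≤ 16 * (1 - α * lam) ^ n * ‖y₀‖ ^ 2 * ∫ ω, χ ω ∂μ := by
  have hτ' : (1 : ℝ) ≤ τ := by exact_mod_cast hτ
  have hαt : 0 ≤ α * τ := by positivity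
  have hJ : 0 ≤ ∫ ω, χ ω ∂μ := integral_nonneg fun ω => hχ0 ω
  have hα1 : α * lam ≤ α * τ := by
    gcongr; linarith
  have hbern : ∀ k : ℕ, k ≤ τ → 1 / 2 ≤ (1 - α * lam) ^ k := fun k hk => by
    have h1 := one_add_mul_le_pow (a := -(α * lam)) (by linarith) k
    have h2 : (k : ℝ) * (α * lam) ≤ τ * (α * 1) := by gcongr
    rw [← sub_eq_add_neg] at h1
    linarith
  rcases le_total n τ with hn | hn
  · have iχ : Integrable χ μ := integrable_of_measurable_of_bounded (hχ.mono (F.le _) le_rfl)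
      ⟨1, fun ω => by rw [abs_of_nonneg (hχ0 ω)]; exact hχ1 ω⟩
    have hn' : (n : ℝ) ≤ τ := by exact_mod_cast hn
    have hαn : α * n ≤ α * τ := by gcongr
    calc ∫ ω, χ ω * ‖linIter α A Ab 0 s a y₀ n ω‖ ^ 2 ∂μ
        ≤ ∫ ω, (8 * ‖y₀‖ ^ 2) * χ ω ∂μ := by
          refine integral_mono (integrable_mul_norm_linIter_sq hs hA hχ hχ0 hχ1 _)
            (iχ.const_mul _) fun ω => ?_
          have h1 := norm_linIter_sub_le (α := α) (w := 0) (s := s) (a := a) (y₀ := y₀)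
            hA hAb hα 0 n (by linarith) ω
          have h2 : ‖linIter α A Ab 0 s a y₀ n ω‖ ≤ 2 * ‖y₀‖ := by
            have h3 : linIter α A Ab 0 s a y₀ 0 ω = y₀ := rfl
            rw [h3, zero_add, norm_zero] at h1
            have h4 := norm_le_norm_add_norm_sub' (linIter α A Ab 0 s a y₀ n ω) y₀
            have h5 : 2 * (α * n) * (2 * ‖y₀‖ + 4 * 0) ≤ (1 / 416) * (2 * ‖y₀‖ + 4 * 0) := by
              gcongr; linarith
            linarith [norm_nonneg y₀]
          have h6 : ‖linIter α A Ab 0 s a y₀ n ω‖ ^ 2 ≤ 8 * ‖y₀‖ ^ 2 := by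
            nlinarith [pow_le_pow_left₀ (norm_nonneg _) h2 2, sq_nonneg (‖y₀‖)]
          simp only
          rw [mul_comm]
          exact mul_le_mul_of_nonneg_right h6 (hχ0 ω)
      _ ≤ _ := by
          rw [integral_const_mul]
          gcongr
          linarith [hbern n hn]
  · obtain ⟨k, rfl⟩ := Nat.exists_eq_add_of_le hn
    rw [add_comm τ k]
    refine (meanSq_linIter_le (w := 0) hs hP1 hA hAb hneg hmix hα hτ hlam1
      hαlam hχ hχ0 hχ1 hlam0 k).trans ?_
    have h1 := hbern τ le_rfl
    have h2 : 0 ≤ (1 - α * lam) ^ k := pow_nonneg (by linarith) k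
    gcongr
    rw [norm_zero, pow_add]
    have h3 := mul_le_mul_of_nonneg_left h1 h2
    have h4 := mul_le_mul_of_nonneg_right h3 (sq_nonneg ‖y₀‖)
    simp only [ne_eq, OfNat.ofNat_ne_zero, not_false_eq_true, zero_pow, mul_zero, zero_div,
      add_zero]
    linarith

end MeanSquare

section CylinderLaw

/-- Finite measures on finite products of `Fin m × ℝ` agree if they agree on boxes with
singleton labels. -/
lemma measure_ext_labelled_box {ι : Type*} [Fintype ι] {m : ℕ} (hm : 0 < m)
    {μ ν : Measure (ι → Fin m × ℝ)}
    [IsFiniteMeasure μ]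
    (h : ∀ (f : ι → Fin m) (B : ι → Set ℝ), (∀ k, MeasurableSet (B k)) →
      μ (Set.univ.pi fun k => {f k} ×ˢ B k) = ν (Set.univ.pi fun k => {f k} ×ˢ B k)) :
    μ = ν := by
  set C : Set (Set (Fin m × ℝ)) := {D | ∃ x B, MeasurableSet B ∧ D = {x} ×ˢ B} with hC
  have hgen : MeasurableSpace.generateFrom C = (inferInstance : MeasurableSpace (Fin m × ℝ)) := by
    refine le_antisymm (MeasurableSpace.generateFrom_le ?_) fun S hS => ?_
    · rintro _ ⟨x, B, hB, rfl⟩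
      exact (measurableSet_singleton x).prod hB
    · have h1 : S = ⋃ x : Fin m, {x} ×ˢ (Prod.mk x ⁻¹' S) := by
        ext ⟨x, r⟩
        simp
      rw [h1]
      exact MeasurableSet.iUnion fun x => MeasurableSpace.measurableSet_generateFrom
        ⟨x, _, measurable_prodMk_left hS, rfl⟩
  have hspan : IsCountablySpanning C := by
    refine ⟨fun i => {(⟨i % m, Nat.mod_lt _ hm⟩ : Fin m)} ×ˢ Set.univ,
      fun i => ⟨_, _, MeasurableSet.univ, rfl⟩, ?_⟩
    ext ⟨x, r⟩
    simp only [Set.mem_iUnion, Set.mem_prod, Set.mem_singleton_iff, Set.mem_univ, and_true,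
      iff_true]
    exact ⟨x, Fin.ext (Nat.mod_eq_of_lt x.2).symm⟩
  have hpi : IsPiSystem C := by
    rintro _ ⟨x, B, hB, rfl⟩ _ ⟨x', B', hB', rfl⟩ ⟨⟨y, r⟩, hy, hy'⟩
    obtain rfl : y = x := hy.1
    obtain rfl : y = x' := hy'.1
    exact ⟨y, B ∩ B', hB.inter hB', by rw [Set.prod_inter_prod, Set.inter_self]⟩
  refine Measure.ext_of_generateFrom_of_cover_subset
    (S := Set.univ.pi '' Set.univ.pi fun _ : ι => C)
    (T := Set.range fun f : ι → Fin m => Set.univ.pi fun k => {f k} ×ˢ (Set.univ : Set ℝ))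
    ?_ (IsPiSystem.pi fun _ => hpi) ?_ (Set.countable_range _) ?_ (fun _ _ => measure_ne_top _ _) ?_
  · rw [← generateFrom_pi_eq fun _ => hspan, hgen]
  · rintro _ ⟨f, rfl⟩
    exact ⟨_, fun k _ => ⟨f k, _, MeasurableSet.univ, rfl⟩, rfl⟩
  · refine Set.eq_univ_of_forall fun h => ⟨_, ⟨fun k => (h k).1, rfl⟩, fun k _ => ⟨rfl, trivial⟩⟩
  · rintro _ ⟨D, hD, rfl⟩
    choose f B hB hDB using fun k => hD k (Set.mem_univ k)
    obtain rfl : D = fun k => {f k} ×ˢ B k := funext hDB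
    exact h f B hB

variable {Ω : Type*} {mΩ : MeasurableSpace Ω} {m : ℕ}

/-- The σ-algebra generated by the states and rewards up to time `n`. -/
def historyFiltration {s : ℕ → Ω → Fin m} {r : ℕ → Ω → ℝ} (hs : ∀ k, Measurable (s k))
    (hr : ∀ k, Measurable (r k)) : Filtration ℕ mΩ where
  seq n := MeasurableSpace.comap (fun ω (k : Fin (n + 1)) => (s k ω, r k ω)) inferInstance
  mono' n n' h := by
    refine Measurable.comap_le ?_
    exact @measurable_pi_lambda _ _ _ (_) _ _ fun k =>
      (measurable_pi_apply (⟨k, by omega⟩ : Fin (n' + 1))).comp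
        (comap_measurable fun ω (k : Fin (n' + 1)) => (s k ω, r k ω))
  le' n := Measurable.comap_le (measurable_pi_lambda _ fun k => (hs k).prodMk (hr k))

/-- A Markov chain `s` with rewards `r` that are conditionally independent given the states,
the reward at time `n` in state `y` having law `ν n y`. -/
structure IsRewardChain (F : Filtration ℕ mΩ) (s : ℕ → Ω → Fin m) (r : ℕ → Ω → ℝ)
    (P : Matrix (Fin m) (Fin m) ℝ) (ν : ℕ → Fin m → Measure ℝ) (μ : Measure Ω) : Prop
    extends IsMarkovChain F s P μ where
  measurable_reward : ∀ n, Measurable[F n] (r n)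
  reward : ∀ n (y : Fin m) (A : Set Ω) (B : Set ℝ), MeasurableSet[F n] A → MeasurableSet B →
    μ (A ∩ s (n + 1) ⁻¹' {y} ∩ r (n + 1) ⁻¹' B) = μ (A ∩ s (n + 1) ⁻¹' {y}) * ν (n + 1) y B

variable {Pr : Measure Ω} [IsProbabilityMeasure Pr] {s : ℕ → Ω → Fin m} {r : ℕ → Ω → ℝ}
  {P : Matrix (Fin m) (Fin m) ℝ} {π : Fin m → ℝ} {ν : ℕ → Fin m → Measure ℝ}

/-- The one-step transition formula for events depending on the history. -/
lemma measure_history_step (hm : 0 < m) (hs : ∀ k, Measurable (s k)) (hr : ∀ k, Measurable (r k))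
    (hcyl : ∀ (n : ℕ) (f : Fin (n + 1) → Fin m) (B : Fin (n + 1) → Set ℝ),
      (∀ k, MeasurableSet (B k)) →
      Pr {ω | ∀ k : Fin (n + 1), s k ω = f k ∧ r k ω ∈ B k} =
        ENNReal.ofReal (π (f 0)) *
          (∏ k : Fin n, ENNReal.ofReal (P (f k.castSucc) (f k.succ))) *
          ∏ k : Fin (n + 1), ν k (f k) (B k))
    (n : ℕ) (y : Fin m) {B : Set ℝ} (hB : MeasurableSet B) {A : Set Ω}
    (hA : MeasurableSet[historyFiltration hs hr n] A) :
    Pr (A ∩ s (n + 1) ⁻¹' {y} ∩ r (n + 1) ⁻¹' B)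
      = ∑ x, ENNReal.ofReal (P x y) * ν (n + 1) y B * Pr (A ∩ s n ⁻¹' {x}) := by
  set X : Ω → Fin (n + 1) → Fin m × ℝ := fun ω k => (s k ω, r k ω) with hX
  have hXm : Measurable X := measurable_pi_lambda _ fun k => (hs k).prodMk (hr k)
  obtain ⟨D, hD, rfl⟩ := hA
  set E : Set Ω := s (n + 1) ⁻¹' {y} ∩ r (n + 1) ⁻¹' B with hE
  have hmeas : ∀ k (x : Fin m), MeasurableSet (s k ⁻¹' {x}) :=
    fun k x => hs k (measurableSet_singleton x)
  have key : (Pr.restrict E).map X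
      = ∑ x, (ENNReal.ofReal (P x y) * ν (n + 1) y B) • (Pr.restrict (s n ⁻¹' {x})).map X := by
    refine measure_ext_labelled_box hm fun f B' hB' => ?_
    have hbox : MeasurableSet (Set.univ.pi fun k => ({f k} : Set (Fin m)) ×ˢ B' k) :=
      MeasurableSet.univ_pi fun k => (measurableSet_singleton _).prod (hB' k)
    have hpre : X ⁻¹' (Set.univ.pi fun k => {f k} ×ˢ B' k)
        = {ω | ∀ k : Fin (n + 1), s k ω = f k ∧ r k ω ∈ B' k} := by
      ext ω; simp [hX, Set.mem_pi]
    rw [Measure.map_apply hXm hbox, Measure.restrict_apply (hXm hbox), Measure.finsetSum_apply,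
      Finset.sum_eq_single (f (Fin.last n)), Measure.smul_apply, Measure.map_apply hXm hbox,
      Measure.restrict_apply (hXm hbox), hpre]
    · have h1 : {ω | ∀ k : Fin (n + 1), s k ω = f k ∧ r k ω ∈ B' k} ∩ s n ⁻¹' {f (Fin.last n)}
          = {ω | ∀ k : Fin (n + 1), s k ω = f k ∧ r k ω ∈ B' k} :=
        Set.inter_eq_left.2 fun ω hω => (hω (Fin.last n)).1
      have h2 : {ω | ∀ k : Fin (n + 1), s k ω = f k ∧ r k ω ∈ B' k} ∩ E
          = {ω | ∀ k : Fin (n + 1 + 1), s k ω = (Fin.snoc f y : Fin (n + 1 + 1) → Fin m) k ∧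
              r k ω ∈ (Fin.snoc B' B : Fin (n + 1 + 1) → Set ℝ) k} := by
        ext ω
        simp [Fin.forall_fin_succ', hE]
      rw [h1, h2, hcyl n f B' hB', hcyl (n + 1) (Fin.snoc f y) (Fin.snoc B' B)]
      · rw [Fin.prod_univ_castSucc (n := n), Fin.prod_univ_castSucc (n := n + 1)]
        have h3 : (Fin.snoc f y : Fin (n + 1 + 1) → Fin m) 0 = f 0 := by
          rw [← Fin.castSucc_zero, Fin.snoc_castSucc]
        simp only [h3, Fin.snoc_castSucc, Fin.snoc_last, Fin.succ_last, ← Fin.castSucc_succ, 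
          smul_eq_mul, Fin.val_castSucc, Fin.val_last]
        ring
      · refine Fin.lastCases ?_ fun k => ?_
        · simpa using hB
        · simpa using hB' k
    · intro x _ hx
      rw [Measure.smul_apply, Measure.map_apply hXm hbox, Measure.restrict_apply (hXm hbox), hpre]
      have : {ω | ∀ k : Fin (n + 1), s k ω = f k ∧ r k ω ∈ B' k} ∩ s n ⁻¹' {x} = ∅ := by
        refine Set.eq_empty_of_forall_notMem fun ω hω => hx ?_
        exact (Set.mem_singleton_iff.1 hω.2).symm.trans (hω.1 (Fin.last n)).1
      rw [this, measure_empty, smul_zero]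
    · exact fun h => absurd (Finset.mem_univ _) h
  have h1 : (Pr.restrict E).map X D = (∑ x, (ENNReal.ofReal (P x y) * ν (n + 1) y B) •
      (Pr.restrict (s n ⁻¹' {x})).map X) D := by rw [key]
  rw [Measure.map_apply hXm hD, Measure.restrict_apply (hXm hD), Measure.finsetSum_apply] at h1
  rw [Set.inter_assoc]
  refine h1.trans (Finset.sum_congr rfl fun x _ => ?_)
  rw [Measure.smul_apply, Measure.map_apply hXm hD, Measure.restrict_apply (hXm hD), smul_eq_mul]

lemma isRewardChain_historyFiltration (hm : 0 < m) (hP : ∀ x y, 0 ≤ P x y)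
    (hν : ∀ k x, IsProbabilityMeasure (ν k x))
    (hs : ∀ k, Measurable (s k)) (hr : ∀ k, Measurable (r k))
    (hcyl : ∀ (n : ℕ) (f : Fin (n + 1) → Fin m) (B : Fin (n + 1) → Set ℝ),
      (∀ k, MeasurableSet (B k)) →
      Pr {ω | ∀ k : Fin (n + 1), s k ω = f k ∧ r k ω ∈ B k} =
        ENNReal.ofReal (π (f 0)) *
          (∏ k : Fin n, ENNReal.ofReal (P (f k.castSucc) (f k.succ))) *
          ∏ k : Fin (n + 1), ν k (f k) (B k)) :
    IsRewardChain (historyFiltration hs hr) s r P ν Pr := by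
  have hX : ∀ n, Measurable[historyFiltration hs hr n] fun ω => (s n ω, r n ω) := fun n =>
    (measurable_pi_apply (Fin.last n)).comp
      (comap_measurable fun ω (k : Fin (n + 1)) => (s k ω, r k ω))
  have hstep := @measure_history_step _ _ _ Pr _ s r P π ν hm hs hr hcyl
  have hmeas : ∀ k (x : Fin m), MeasurableSet (s k ⁻¹' {x}) :=
    fun k x => hs k (measurableSet_singleton x)
  refine ⟨⟨fun n => measurable_fst.comp (hX n), fun n y g hg hb => ?_⟩,
    fun n => measurable_snd.comp (hX n), fun n y A B hA hB => ?_⟩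
  · set F := historyFiltration hs hr
    have hsn : ∀ x, MeasurableSet[F n] (s n ⁻¹' {x}) := fun x =>
      (measurable_fst.comp (hX n)) (measurableSet_singleton x)
    have htrim : (Pr.restrict (s (n + 1) ⁻¹' {y})).trim (F.le n)
        = (∑ x, ENNReal.ofReal (P x y) • Pr.restrict (s n ⁻¹' {x})).trim (F.le n) := by
      refine @Measure.ext _ (F n) _ _ fun A hA => ?_
      have h1 := hstep n y MeasurableSet.univ hA
      rw [trim_measurableSet_eq _ hA, trim_measurableSet_eq _ hA,
        Measure.restrict_apply (F.le n _ hA), Measure.finsetSum_apply]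
      rw [Set.preimage_univ, Set.inter_univ, measure_univ] at h1
      refine h1.trans (Finset.sum_congr rfl fun x _ => ?_)
      rw [Measure.smul_apply, Measure.restrict_apply (F.le n _ hA), smul_eq_mul, mul_one]
    have hgm : Measurable g := hg.mono (F.le n) le_rfl
    have hgi : Integrable g Pr := integrable_of_measurable_of_bounded hgm hb
    have e1 : ∀ k x, ∫ ω, g ω * (if s k ω = x then 1 else 0) ∂Pr
        = ∫ ω in s k ⁻¹' {x}, g ω ∂Pr := fun k x => by
      rw [← integral_indicator (hmeas k x)]
      congr 1 with ω
      by_cases h : s k ω = x <;> simp [h]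
    have e2 : ∀ ω, g ω * P (s n ω) y = ∑ x, P x y * (g ω * (if s n ω = x then 1 else 0)) := by
      intro ω; simp [mul_comm]
    simp_rw [e2]
    have hi : ∀ x, Integrable (fun ω => P x y * (g ω * (if s n ω = x then 1 else 0))) Pr :=
      fun x => (integrable_of_measurable_of_bounded (hgm.mul (measurable_ite_eq (hs n) x))
        (bounded_mul hb (bounded_ite_eq _ _))).const_mul _
    rw [integral_finsetSum _ fun x _ => hi x]
    simp_rw [integral_const_mul, e1]
    rw [integral_trim (F.le n) hg.stronglyMeasurable, htrim,
      ← integral_trim (F.le n) hg.stronglyMeasurable, integral_finsetSum_measure]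
    · refine Finset.sum_congr rfl fun x _ => ?_
      rw [integral_smul_measure, ENNReal.toReal_ofReal (hP x y), smul_eq_mul]
    · exact fun x _ => hgi.restrict.smul_measure ENNReal.ofReal_ne_top
  · have h1 := hstep n y MeasurableSet.univ hA
    rw [Set.preimage_univ, Set.inter_univ, measure_univ] at h1
    rw [hstep n y hB hA, h1, Finset.sum_mul]
    exact Finset.sum_congr rfl fun x _ => by ring

/-- Freezing lemma: integrate out the reward given the history and the current state. -/
lemma IsRewardChain.integral_reward {F : Filtration ℕ mΩ} (h : IsRewardChain F s r P ν Pr)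
    (hν : ∀ k x, IsProbabilityMeasure (ν k x)) (n : ℕ) (y : Fin m) {H Z : Ω → ℝ}
    (hH : Measurable[F n] H) (hZ : Measurable[F n] Z) (hb : ∃ C, ∀ ω, |H ω| ≤ C)
    {f : ℝ × ℝ → ℝ} (hf : Measurable f) (hfb : ∃ C, ∀ p, |f p| ≤ C) :
    ∫ ω, H ω * (if s (n + 1) ω = y then 1 else 0) * f (Z ω, r (n + 1) ω) ∂Pr
      = ∫ ω, H ω * (if s (n + 1) ω = y then 1 else 0) * ∫ ρ, f (Z ω, ρ) ∂ν (n + 1) y ∂Pr := by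
  have hHm : Measurable H := hH.mono (F.le n) le_rfl
  have hZm : Measurable Z := hZ.mono (F.le n) le_rfl
  have hr : Measurable (r (n + 1)) := (h.measurable_reward _).mono (F.le _) le_rfl
  have hs : Measurable (s (n + 1)) := (h.measurable _).mono (F.le _) le_rfl
  have hS : MeasurableSet (s (n + 1) ⁻¹' {y}) := hs (measurableSet_singleton y)
  set μ' := Pr.restrict (s (n + 1) ⁻¹' {y}) with hμ'
  have hX : Measurable fun ω => (H ω, Z ω) := hHm.prodMk hZm
  have hlaw : (μ'.map fun ω => (H ω, Z ω)).prod (ν (n + 1) y)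
      = μ'.map fun ω => ((H ω, Z ω), r (n + 1) ω) := by
    refine Measure.prod_eq fun A B hA hB => ?_
    have hXF : MeasurableSet[F n] ((fun ω => (H ω, Z ω)) ⁻¹' A) :=
      (Measurable.prodMk hH hZ) hA
    rw [Measure.map_apply (hX.prodMk hr) (hA.prod hB), Measure.map_apply hX hA,
      Measure.restrict_apply (hX hA),
      Measure.restrict_apply ((hX.prodMk hr) (hA.prod hB)), ← h.reward n y _ B hXF hB]
    congr 1
    ext ω
    simp only [Set.mem_inter_iff, Set.mem_preimage, Set.mem_prod]
    tauto
  have e1 : ∀ g : Ω → ℝ, ∫ ω, H ω * (if s (n + 1) ω = y then 1 else 0) * g ω ∂Pr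
      = ∫ ω, H ω * g ω ∂μ' := fun g => by
    rw [hμ', ← integral_indicator hS]
    congr 1 with ω
    by_cases h : s (n + 1) ω = y <;> simp [h]
  rw [e1, e1]
  have hfm : Measurable fun p : (ℝ × ℝ) × ℝ => p.1.1 * f (p.1.2, p.2) := by fun_prop
  have h1 : ∫ ω, H ω * f (Z ω, r (n + 1) ω) ∂μ'
      = ∫ p, p.1.1 * f (p.1.2, p.2) ∂(μ'.map fun ω => ((H ω, Z ω), r (n + 1) ω)) :=
    (integral_map (hX.prodMk hr).aemeasurable hfm.aestronglyMeasurable).symm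
  have hint : Integrable (fun p : (ℝ × ℝ) × ℝ => p.1.1 * f (p.1.2, p.2))
      (μ'.map fun ω => ((H ω, Z ω), r (n + 1) ω)) := by
    rw [integrable_map_measure hfm.aestronglyMeasurable (hX.prodMk hr).aemeasurable]
    obtain ⟨C, hC⟩ := hfb
    exact integrable_of_measurable_of_bounded (hfm.comp (hX.prodMk hr))
      (bounded_mul hb ⟨C, fun ω => hC _⟩)
  rw [h1, ← hlaw, integral_prod _ (hlaw ▸ hint)]
  have hfm2 : Measurable fun p : ℝ × ℝ => ∫ ρ, p.1 * f (p.2, ρ) ∂ν (n + 1) y :=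
    (hfm.stronglyMeasurable.integral_prod_right' (ν := ν (n + 1) y)).measurable
  rw [integral_map hX.aemeasurable hfm2.aestronglyMeasurable]
  simp_rw [integral_const_mul]

end CylinderLaw

section GapMoments

variable {m : ℕ}

/-- Conditional mean of the sum of `j` samples of `g` along a chain with transition matrix `B`. -/
noncomputable def gapMean (B : Matrix (Fin m) (Fin m) ℝ) (g : Fin m → ℝ) : ℕ → Fin m → ℝ
  | 0 => 0
  | j + 1 => B *ᵥ (g + gapMean B g j)

/-- Conditional second moment of the sum of `j` samples with conditional mean `g` and conditional
second moment `q`, along a chain with transition matrix `B`. -/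
noncomputable def gapSq (B : Matrix (Fin m) (Fin m) ℝ) (g q : Fin m → ℝ) : ℕ → Fin m → ℝ
  | 0 => 0
  | j + 1 => B *ᵥ fun y => q y + 2 * g y * gapMean B g j y + gapSq B g q j y

lemma gapMean_eq_sum (B : Matrix (Fin m) (Fin m) ℝ) (g : Fin m → ℝ) (j : ℕ) :
    gapMean B g j = ∑ k ∈ Finset.range j, (B ^ (k + 1)) *ᵥ g := by
  induction j with
  | zero => rfl
  | succ j ih =>
    rw [gapMean, ih, Finset.sum_range_succ', mulVec_add, mulVec_sum]
    simp only [zero_add, pow_one, mulVec_mulVec, ← pow_succ']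
    rw [add_comm]

/-- Decay of stationary correlations from decay of the distance to stationarity. -/
lemma abs_sum_mul_mulVec_le {B : Matrix (Fin m) (Fin m) ℝ} {π g : Fin m → ℝ} {η c : ℝ}
    (hB : ∀ x y, 0 ≤ B x y) (hπ : ∀ x, 0 ≤ π x) (hπ1 : ∑ x, π x = 1)
    (hst : ∀ y, ∑ x, π x * B x y = π y) (hη : ∀ x, ∑ y, |B x y - π y| ≤ η)
    (hg : ∑ x, π x * g x = 0) (hc : 0 < c) :
    |∑ x, π x * g x * (B *ᵥ g) x| ≤ (c * η / 2 + 1 / c) * ∑ x, π x * g x ^ 2 := by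
  have e1 : ∑ x, π x * g x * (B *ᵥ g) x
      = ∑ x, ∑ y, π x * (B x y - π y) * (g x * g y) := by
    have h1 : ∀ x, ∑ y, π x * (B x y - π y) * (g x * g y)
        = π x * g x * (B *ᵥ g) x - π x * g x * ∑ y, π y * g y := fun x => by
      rw [mulVec, dotProduct, Finset.mul_sum, Finset.mul_sum, ← Finset.sum_sub_distrib]
      exact Finset.sum_congr rfl fun y _ => by ring
    simp_rw [h1, hg, mul_zero, sub_zero]
  rw [e1]
  have h2 : ∀ x y, |π x * (B x y - π y) * (g x * g y)|
      ≤ π x * g x ^ 2 * (c / 2) * |B x y - π y|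
        + (π x * B x y + π x * π y) * (g y ^ 2 / (2 * c)) := fun x y => by
    have h3 : |g x * g y| ≤ c / 2 * g x ^ 2 + g y ^ 2 / (2 * c) := by
      rw [abs_mul, div_mul_eq_mul_div, div_add_div _ _ two_ne_zero (by positivity),
        le_div_iff₀ (by positivity), ← sq_abs (g x), ← sq_abs (g y)]
      nlinarith [sq_nonneg (c * |g x| - |g y|)]
    have h4 : |B x y - π y| ≤ B x y + π y := by
      rw [abs_le]; constructor <;> linarith [hB x y, hπ y]
    have h5 : 0 ≤ g y ^ 2 / (2 * c) := by positivity
    rw [abs_mul, abs_mul, abs_of_nonneg (hπ x)]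
    have h6 : 0 ≤ π x * |B x y - π y| := mul_nonneg (hπ x) (abs_nonneg _)
    calc π x * |B x y - π y| * |g x * g y|
        ≤ π x * |B x y - π y| * (c / 2 * g x ^ 2 + g y ^ 2 / (2 * c)) := by gcongr
      _ = π x * g x ^ 2 * (c / 2) * |B x y - π y| 
          + π x * |B x y - π y| * (g y ^ 2 / (2 * c)) := by ring
      _ ≤ π x * g x ^ 2 * (c / 2) * |B x y - π y| 
          + π x * (B x y + π y) * (g y ^ 2 / (2 * c)) := by
            gcongr
            exact hπ x
      _ = _ := by ring
  refine (Finset.abs_sum_le_sum_abs _ _).trans ((Finset.sum_le_sum fun x _ =>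
    (Finset.abs_sum_le_sum_abs _ _).trans (Finset.sum_le_sum fun y _ => h2 x y)).trans ?_)
  simp_rw [Finset.sum_add_distrib]
  have h7 : ∑ x, ∑ y, π x * g x ^ 2 * (c / 2) * |B x y - π y|
      ≤ c * η / 2 * ∑ x, π x * g x ^ 2 := by
    rw [Finset.mul_sum]
    refine Finset.sum_le_sum fun x _ => ?_
    rw [← Finset.mul_sum]
    have h8 : 0 ≤ π x * g x ^ 2 * (c / 2) := by have := hπ x; positivity
    exact (mul_le_mul_of_nonneg_left (hη x) h8).trans_eq (by ring)
  have h9 : ∑ x, ∑ y, (π x * B x y + π x * π y) * (g y ^ 2 / (2 * c))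
      = 1 / c * ∑ x, π x * g x ^ 2 := by
    rw [Finset.sum_comm, Finset.mul_sum]
    refine Finset.sum_congr rfl fun y _ => ?_
    rw [← Finset.sum_mul, Finset.sum_add_distrib, hst, ← Finset.sum_mul, hπ1]
    field_simp
    ring
  rw [h9, add_mul]
  exact add_le_add_left h7 _

/-- Stationary second moment of a sum of `M` weakly dependent samples. -/
lemma sum_gapSq_le {B : Matrix (Fin m) (Fin m) ℝ} {π g q : Fin m → ℝ} {η : ℝ} {M : ℕ}
    (hB : ∀ x y, 0 ≤ B x y) (hπ : ∀ x, 0 ≤ π x) (hπ1 : ∑ x, π x = 1)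
    (hst : π ᵥ* B = π)
    (hη : ∀ k x, ∑ y, |(B ^ (k + 1)) x y - π y| ≤ η)
    (hg : ∑ x, π x * g x = 0) (hgq : ∀ x, g x ^ 2 ≤ q x) (hη0 : 0 ≤ η) (hM : 1 ≤ M)
    (hMη : M ^ 2 * η ≤ 1) :
    ∑ x, π x * gapSq B g q M x ≤ 4 * M * ∑ x, π x * q x := by
  have hM' : (1 : ℝ) ≤ M := by exact_mod_cast hM
  set v := ∑ x, π x * q x
  have hw : ∑ x, π x * g x ^ 2 ≤ v :=
    Finset.sum_le_sum fun x _ => mul_le_mul_of_nonneg_left (hgq x) (hπ x)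
  have hw0 : 0 ≤ ∑ x, π x * g x ^ 2 :=
    Finset.sum_nonneg fun x _ => mul_nonneg (hπ x) (sq_nonneg _)
  have hpow : ∀ k, π ᵥ* B ^ k = π := fun k => by
    induction k with
    | zero => simp
    | succ k ih => rw [pow_succ, ← vecMul_vecMul, ih, hst]
  have hcorr : ∀ k, ∑ x, π x * g x * ((B ^ (k + 1)) *ᵥ g) x ≤ (M * η / 2 + 1 / M) * v :=
    fun k => (le_abs_self _).trans ((abs_sum_mul_mulVec_le (c := M)
      (fun x y => Matrix.pow_apply_nonneg hB _ x y) hπ hπ1 (fun y => congrFun (hpow (k + 1)) y)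
      (hη k) hg (by linarith)).trans (by gcongr))
  have hstat : ∀ f : Fin m → ℝ, ∑ x, π x * (B *ᵥ f) x = ∑ x, π x * f x := fun f => by
    have : π ⬝ᵥ (B *ᵥ f) = π ⬝ᵥ f := by rw [dotProduct_mulVec, hst]
    exact this
  have hmean : ∀ j, j ≤ M → ∑ x, π x * g x * gapMean B g j x ≤ M * ((M * η / 2 + 1 / M) * v) := by
    intro j hj
    have hj' : (j : ℝ) ≤ M := by exact_mod_cast hj
    rw [gapMean_eq_sum]
    simp only [Finset.sum_apply, Finset.mul_sum]
    rw [Finset.sum_comm]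
    refine (Finset.sum_le_sum fun k _ => hcorr k).trans ?_
    rw [Finset.sum_const, Finset.card_range, nsmul_eq_mul]
    have : 0 ≤ v := hw0.trans hw
    gcongr
  have hv : 0 ≤ v := hw0.trans hw
  have hκ : v + 2 * (M * ((M * η / 2 + 1 / M) * v)) ≤ 4 * v := by
    have : v + 2 * (M * ((M * η / 2 + 1 / M) * v)) = (3 + M ^ 2 * η) * v := by
      field_simp; ring
    rw [this]
    gcongr
    linarith
  have hall : ∀ j, j ≤ M → ∑ x, π x * gapSq B g q j x ≤ j * (4 * v) := by
    intro j
    induction j with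
    | zero => intro _; simp [gapSq]
    | succ j ih =>
      intro hj
      rw [gapSq, hstat]
      have h1 : ∑ x, π x * (q x + 2 * g x * gapMean B g j x + gapSq B g q j x)
          = v + 2 * (∑ x, π x * g x * gapMean B g j x) + ∑ x, π x * gapSq B g q j x := by
        rw [Finset.mul_sum, ← Finset.sum_add_distrib, ← Finset.sum_add_distrib]
        exact Finset.sum_congr rfl fun x _ => by ring
      rw [h1]
      push_cast
      linarith [ih (by omega), hmean j (by omega)]
  exact (hall M le_rfl).trans_eq (by ring)

end GapMoments

section BucketTail

variable {m : ℕ}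

/-- Conditional second moment of `z` plus a sum of `j` centred samples. -/
noncomputable def gapQuad (B : Matrix (Fin m) (Fin m) ℝ) (g q : Fin m → ℝ) (j : ℕ) (x : Fin m)
    (z : ℝ) : ℝ :=
  z ^ 2 + 2 * z * gapMean B g j x + gapSq B g q j x

/-- Conditional second moment of `z` plus a sum of `j + 1` centred samples, given the state of the
first sample. -/
noncomputable def gapQuadFrom (B : Matrix (Fin m) (Fin m) ℝ) (g q : Fin m → ℝ) (j : ℕ) (y : Fin m)
    (z : ℝ) : ℝ :=
  z ^ 2 + 2 * z * (g y + gapMean B g j y) + (q y + 2 * g y * gapMean B g j y + gapSq B g q j y)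

lemma gapQuad_succ {B : Matrix (Fin m) (Fin m) ℝ} (hB1 : ∀ x, ∑ y, B x y = 1) (g q : Fin m → ℝ)
    (j : ℕ) (x : Fin m) (z : ℝ) :
    gapQuad B g q (j + 1) x z = ∑ y, B x y * gapQuadFrom B g q j y z := by
  have h1 : ∀ y, B x y * gapQuadFrom B g q j y z = B x y * z ^ 2
      + 2 * z * (B x y * (g + gapMean B g j) y)
      + B x y * (q y + 2 * g y * gapMean B g j y + gapSq B g q j y) := fun y => by
    rw [gapQuadFrom, Pi.add_apply]; ring
  simp_rw [h1, Finset.sum_add_distrib, ← Finset.mul_sum, ← Finset.sum_mul, hB1, one_mul]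
  rfl

variable {𝒟 : Fin m → Measure ℝ} {R c : Fin m → ℝ} {mu : ℝ}

lemma integral_gapQuad (h𝒟 : ∀ x, IsProbabilityMeasure (𝒟 x))
    (h1 : ∀ x, Integrable (fun y => y) (𝒟 x)) (h2 : ∀ x, Integrable (fun y => y ^ 2) (𝒟 x))
    (hR : ∀ x, ∫ y, y ∂𝒟 x = R x) (B : Matrix (Fin m) (Fin m) ℝ) (j : ℕ) (y : Fin m) (z : ℝ) :
    Integrable (fun ρ => gapQuad B (fun y => c y * R y - mu)
      (fun y => ∫ ρ, (c y * ρ - mu) ^ 2 ∂𝒟 y) j y (z + (c y * ρ - mu))) (𝒟 y) ∧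
    ∫ ρ, gapQuad B (fun y => c y * R y - mu)
      (fun y => ∫ ρ, (c y * ρ - mu) ^ 2 ∂𝒟 y) j y (z + (c y * ρ - mu)) ∂𝒟 y
      = gapQuadFrom B (fun y => c y * R y - mu)
      (fun y => ∫ ρ, (c y * ρ - mu) ^ 2 ∂𝒟 y) j y z := by
  set g : Fin m → ℝ := fun y => c y * R y - mu with hg
  set q : Fin m → ℝ := fun y => ∫ ρ, (c y * ρ - mu) ^ 2 ∂𝒟 y with hq
  have i1 : Integrable (fun ρ => c y * ρ - mu) (𝒟 y) :=
    ((h1 y).const_mul _).sub (integrable_const _)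
  have v1 : ∫ ρ, (c y * ρ - mu) ∂𝒟 y = g y := by
    rw [integral_sub ((h1 y).const_mul _) (integrable_const _), integral_const_mul, hR]
    simp [hg]
  have i2 : Integrable (fun ρ => (c y * ρ - mu) ^ 2) (𝒟 y) := by
    have e : (fun ρ => (c y * ρ - mu) ^ 2)
        = fun ρ => c y ^ 2 * ρ ^ 2 - 2 * c y * mu * ρ + mu ^ 2 := by
      ext ρ; ring
    rw [e]
    exact (((h2 y).const_mul _).sub ((h1 y).const_mul _)).add (integrable_const _)
  have e : (fun ρ => gapQuad B g q j y (z + (c y * ρ - mu)))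
      = fun ρ => (c y * ρ - mu) ^ 2 + ((2 * z + 2 * gapMean B g j y) * (c y * ρ - mu)
        + (z ^ 2 + 2 * z * gapMean B g j y + gapSq B g q j y)) := by
    ext ρ; rw [gapQuad]; ring
  have i3 : Integrable (fun ρ => (2 * z + 2 * gapMean B g j y) * (c y * ρ - mu)
        + (z ^ 2 + 2 * z * gapMean B g j y + gapSq B g q j y)) (𝒟 y) :=
    (i1.const_mul _).add (integrable_const _)
  rw [e]
  refine ⟨i2.add i3, ?_⟩
  rw [integral_add i2 i3, integral_add (i1.const_mul _) (integrable_const _), integral_const_mul,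
    v1, gapQuadFrom, integral_const]
  simp only [probReal_univ, smul_eq_mul, one_mul, hq]
  ring

lemma gapQuad_nonneg (h𝒟 : ∀ x, IsProbabilityMeasure (𝒟 x))
    (h1 : ∀ x, Integrable (fun y => y) (𝒟 x)) (h2 : ∀ x, Integrable (fun y => y ^ 2) (𝒟 x))
    (hR : ∀ x, ∫ y, y ∂𝒟 x = R x) {B : Matrix (Fin m) (Fin m) ℝ} (hB : ∀ x y, 0 ≤ B x y)
    (hB1 : ∀ x, ∑ y, B x y = 1) (j : ℕ) (x : Fin m) (z : ℝ) :
    0 ≤ gapQuad B (fun y => c y * R y - mu)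
      (fun y => ∫ ρ, (c y * ρ - mu) ^ 2 ∂𝒟 y) j x z := by
  induction j generalizing x z with
  | zero => simp [gapQuad, gapMean, gapSq, sq_nonneg]
  | succ j ih =>
    rw [gapQuad_succ hB1]
    refine Finset.sum_nonneg fun y _ => mul_nonneg (hB x y) ?_
    rw [← (integral_gapQuad h𝒟 h1 h2 hR B j y z).2]
    exact integral_nonneg fun ρ => ih y _

lemma gapQuadFrom_nonneg (h𝒟 : ∀ x, IsProbabilityMeasure (𝒟 x))
    (h1 : ∀ x, Integrable (fun y => y) (𝒟 x)) (h2 : ∀ x, Integrable (fun y => y ^ 2) (𝒟 x))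
    (hR : ∀ x, ∫ y, y ∂𝒟 x = R x) {B : Matrix (Fin m) (Fin m) ℝ} (hB : ∀ x y, 0 ≤ B x y)
    (hB1 : ∀ x, ∑ y, B x y = 1) (j : ℕ) (x : Fin m) (z : ℝ) :
    0 ≤ gapQuadFrom B (fun y => c y * R y - mu)
      (fun y => ∫ ρ, (c y * ρ - mu) ^ 2 ∂𝒟 y) j x z := by
  rw [← (integral_gapQuad h𝒟 h1 h2 hR B j x z).2]
  exact integral_nonneg fun ρ => gapQuad_nonneg h𝒟 h1 h2 hR hB hB1 j x _

variable {Ω : Type*} {mΩ : MeasurableSpace Ω} {Pr : Measure Ω} [IsProbabilityMeasure Pr]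
  {s : ℕ → Ω → Fin m} {r : ℕ → Ω → ℝ} {P : Matrix (Fin m) (Fin m) ℝ}
  {ν : ℕ → Fin m → Measure ℝ} {F : Filtration ℕ mΩ} {ε κ thr : ℝ} {τ : ℕ}
  (h : IsRewardChain F s r P ν Pr) (hν : ∀ k x, IsProbabilityMeasure (ν k x))
  (h𝒟 : ∀ x, IsProbabilityMeasure (𝒟 x))
  (h1 : ∀ x, Integrable (fun y => y) (𝒟 x)) (h2 : ∀ x, Integrable (fun y => y ^ 2) (𝒟 x))
  (hR : ∀ x, ∫ y, y ∂𝒟 x = R x)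
  (hcont : ∀ k x (f : ℝ → ℝ), Measurable f → (∀ ρ, 0 ≤ f ρ) → (∀ ρ, f ρ ≤ 1) →
    ∫ ρ, f ρ ∂ν k x ≤ ε + ∫ ρ, f ρ ∂𝒟 x)
  (hP : ∀ x y, 0 ≤ P x y) (hP1 : ∀ x, ∑ y, P x y = 1)
  (hε : 0 ≤ ε) (hκ : 0 ≤ κ) (hthr : ∀ z, thr < |z| → 1 ≤ κ * z ^ 2) (hτ : 1 ≤ τ)

include h hν h𝒟 h1 h2 hR hcont hP hP1 hε hκ hτ

/-- Integrating out the first sample. -/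
lemma integral_min_gapQuad_le (j n : ℕ) {H Z : Ω → ℝ} (hH : Measurable[F n] H)
    (hZ : Measurable[F n] Z) (hH0 : ∀ ω, 0 ≤ H ω) (hb : ∃ C, ∀ ω, |H ω| ≤ C) :
    ∫ ω, H ω * min 1 (j * ε + κ * gapQuad (P ^ τ) (fun y => c y * R y - mu)
      (fun y => ∫ ρ, (c y * ρ - mu) ^ 2 ∂𝒟 y) j (s (n + τ) ω)
        (Z ω + (c (s (n + τ) ω) * r (n + τ) ω - mu))) ∂Pr
    ≤ ∫ ω, H ω * ∑ y, (P ^ τ) (s n ω) y * min 1 ((j + 1 : ℕ) * ε + κ *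
        gapQuadFrom (P ^ τ) (fun y => c y * R y - mu)
      (fun y => ∫ ρ, (c y * ρ - mu) ^ 2 ∂𝒟 y) j y (Z ω)) ∂Pr := by
  set B := P ^ τ with hBdef
  have hB : ∀ x y, 0 ≤ B x y := Matrix.pow_apply_nonneg hP τ
  have hB1 : ∀ x, ∑ y, B x y = 1 := sum_pow_apply hP1 τ
  set g : Fin m → ℝ := fun y => c y * R y - mu with hg
  set q : Fin m → ℝ := fun y => ∫ ρ, (c y * ρ - mu) ^ 2 ∂𝒟 y with hq
  have hV0 : ∀ y z, 0 ≤ gapQuad B g q j y z := fun y z =>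
    gapQuad_nonneg h𝒟 h1 h2 hR hB hB1 j y z
  set f : Fin m → ℝ × ℝ → ℝ := fun y p =>
    min 1 (j * ε + κ * gapQuad B g q j y (p.1 + (c y * p.2 - mu))) with hf
  have hf0 : ∀ y p, 0 ≤ f y p := fun y p => by
    have := hV0 y (p.1 + (c y * p.2 - mu))
    exact le_min zero_le_one (by positivity)
  have hf1 : ∀ y p, f y p ≤ 1 := fun y p => min_le_left _ _
  have hfm : ∀ y, Measurable (f y) := fun y => by
    simp only [hf, gapQuad]; fun_prop
  have hfb : ∀ y, ∃ C, ∀ p, |f y p| ≤ C := fun y =>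
    ⟨1, fun p => by rw [abs_of_nonneg (hf0 y p)]; exact hf1 y p⟩
  set u : Fin m → ℝ → ℝ := fun y z =>
    min 1 ((j + 1 : ℕ) * ε + κ * gapQuadFrom B g q j y z) with hu
  have hU0 : ∀ y z, 0 ≤ gapQuadFrom B g q j y z := fun y z => by
    rw [← (integral_gapQuad h𝒟 h1 h2 hR B j y z).2]
    exact integral_nonneg fun ρ => hV0 y _
  have hu0 : ∀ y z, 0 ≤ u y z := fun y z => by
    have := hU0 y z
    exact le_min zero_le_one (by positivity)
  have hum : ∀ y, Measurable (u y) := fun y => by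
    simp only [hu, gapQuadFrom]; fun_prop
  have hub : ∀ y, ∃ C, ∀ ω, |u y (Z ω)| ≤ C := fun y =>
    ⟨1, fun ω => by rw [abs_of_nonneg (hu0 y _)]; exact min_le_left _ _⟩
  have hfu : ∀ k y z, ∫ ρ, f y (z, ρ) ∂ν k y ≤ u y z := fun k y z => by
    have hm : Measurable fun ρ => f y (z, ρ) := (hfm y).comp measurable_prodMk_left
    refine le_min ?_ ((hcont k y _ hm (fun ρ => hf0 y _) fun ρ => hf1 y _).trans ?_)
    · calc ∫ ρ, f y (z, ρ) ∂ν k y ≤ ∫ _, 1 ∂ν k y :=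
            integral_mono (integrable_of_measurable_of_bounded hm
              (by obtain ⟨C, hC⟩ := hfb y; exact ⟨C, fun ρ => hC _⟩)) (integrable_const _)
              fun ρ => hf1 y _
        _ = 1 := by simp
    · obtain ⟨i1, e1⟩ := integral_gapQuad (c := c) (mu := mu) h𝒟 h1 h2 hR B j y z
      have i0 : Integrable (fun _ : ℝ => (j : ℝ) * ε) (𝒟 y) := integrable_const _
      calc ε + ∫ ρ, f y (z, ρ) ∂𝒟 y
          ≤ ε + ∫ ρ, (j * ε + κ * gapQuad B g q j y (z + (c y * ρ - mu))) ∂𝒟 y := by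
            refine add_le_add_right (integral_mono (integrable_of_measurable_of_bounded hm
              (by obtain ⟨C, hC⟩ := hfb y; exact ⟨C, fun ρ => hC _⟩))
              (i0.add (i1.const_mul κ)) fun ρ => min_le_right _ _) _
        _ = _ := by
            rw [integral_add i0 (i1.const_mul κ), integral_const_mul κ, e1]
            simp only [integral_const, probReal_univ, smul_eq_mul]
            push_cast
            ring
  have hHm : Measurable H := hH.mono (F.le n) le_rfl
  have hZm : Measurable Z := hZ.mono (F.le n) le_rfl
  have hsm : ∀ k, Measurable (s k) := fun k => (h.measurable k).mono (F.le k) le_rfl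
  have hrm : ∀ k, Measurable (r k) := fun k => (h.measurable_reward k).mono (F.le k) le_rfl
  obtain ⟨t, rfl⟩ : ∃ t, τ = t + 1 := ⟨τ - 1, by omega⟩
  have hle : F n ≤ F (n + t) := F.mono (by omega)
  have e1 : ∀ ω, H ω * f (s (n + (t + 1)) ω) (Z ω, r (n + (t + 1)) ω)
      = ∑ y, H ω * (if s (n + t + 1) ω = y then 1 else 0) * f y (Z ω, r (n + t + 1) ω) := by
    intro ω; simp [add_assoc]
  have e2 : ∀ ω, H ω * ∑ y, B (s n ω) y * u y (Z ω) = ∑ y, H ω * u y (Z ω) * B (s n ω) y := by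
    intro ω
    rw [Finset.mul_sum]
    exact Finset.sum_congr rfl fun y _ => by ring
  have hite : ∀ y, Measurable fun ω => (if s (n + t + 1) ω = y then (1 : ℝ) else 0) :=
    fun y => measurable_ite_eq (hsm _) y
  calc ∫ ω, H ω * f (s (n + (t + 1)) ω) (Z ω, r (n + (t + 1)) ω) ∂Pr
      = ∑ y, ∫ ω, H ω * (if s (n + t + 1) ω = y then 1 else 0) * f y (Z ω, r (n + t + 1) ω) ∂Pr := by
        simp_rw [e1]
        refine integral_finsetSum _ fun y _ => integrable_of_measurable_of_bounded
          ((hHm.mul (hite y)).mul ((hfm y).comp (hZm.prodMk (hrm _))))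
          (bounded_mul (bounded_mul hb (bounded_ite_eq _ _)) ?_)
        obtain ⟨C, hC⟩ := hfb y
        exact ⟨C, fun ω => hC _⟩
    _ = ∑ y, ∫ ω, H ω * (if s (n + t + 1) ω = y then 1 else 0) *
          ∫ ρ, f y (Z ω, ρ) ∂ν (n + t + 1) y ∂Pr :=
        Finset.sum_congr rfl fun y _ => h.integral_reward hν (n + t) y (hH.mono hle le_rfl)
          (hZ.mono hle le_rfl) hb (hfm y) (hfb y)
    _ ≤ ∑ y, ∫ ω, H ω * (if s (n + t + 1) ω = y then 1 else 0) * u y (Z ω) ∂Pr := by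
        refine Finset.sum_le_sum fun y _ => integral_mono_of_nonneg
          (Filter.Eventually.of_forall fun ω => ?_)
          (integrable_of_measurable_of_bounded ((hHm.mul (hite y)).mul ((hum y).comp hZm))
            (bounded_mul (bounded_mul hb (bounded_ite_eq _ _)) (hub y)))
          (Filter.Eventually.of_forall fun ω => ?_)
        · refine mul_nonneg (mul_nonneg (hH0 ω) (by split_ifs <;> norm_num)) ?_
          exact integral_nonneg fun ρ => hf0 y _
        · exact mul_le_mul_of_nonneg_left (hfu _ _ _)
            (mul_nonneg (hH0 ω) (by split_ifs <;> norm_num))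
    _ = ∑ y, ∫ ω, H ω * u y (Z ω) * B (s n ω) y ∂Pr := by
        refine Finset.sum_congr rfl fun y _ => ?_
        have h3 := h.integral_mul_comp_pow n (t + 1) (g := fun ω => H ω * u y (Z ω))
          (hH.mul ((hum y).comp hZ)) (bounded_mul hb (hub y)) fun x => if x = y then 1 else 0
        simp only [mul_ite, mul_one, mul_zero, Finset.sum_ite_eq', Finset.mem_univ, if_true] at h3
        rw [← h3]
        congr 1 with ω
        rw [add_assoc n t 1]
        split_ifs <;> ring
    _ = _ := by
        rw [integral_congr_ae (Filter.Eventually.of_forall e2)]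
        refine (integral_finsetSum _ fun y _ => integrable_of_measurable_of_bounded
          ((hHm.mul ((hum y).comp hZm)).mul (measurable_comp_finite (hsm n) fun x => B x y))
          (bounded_mul (bounded_mul hb (hub y)) (bounded_comp_finite _ fun x => B x y))).symm

end BucketTail

section BucketTail

variable {m : ℕ} {𝒟 : Fin m → Measure ℝ} {R c : Fin m → ℝ} {mu : ℝ}
  {Ω : Type*} {mΩ : MeasurableSpace Ω} {Pr : Measure Ω} [IsProbabilityMeasure Pr]
  {s : ℕ → Ω → Fin m} {r : ℕ → Ω → ℝ} {P : Matrix (Fin m) (Fin m) ℝ}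
  {ν : ℕ → Fin m → Measure ℝ} {F : Filtration ℕ mΩ} {ε κ thr : ℝ} {τ : ℕ}

omit [IsProbabilityMeasure Pr] in
lemma IsRewardChain.measurable_sample (h : IsRewardChain F s r P ν Pr) (c : Fin m → ℝ) (mu : ℝ)
    (n : ℕ) : Measurable[F n] fun ω => c (s n ω) * r n ω - mu :=
  ((measurable_comp_finite (h.measurable n) c).mul (h.measurable_reward n)).sub_const mu

omit [IsProbabilityMeasure Pr] in
lemma IsRewardChain.measurable_sum_sample (h : IsRewardChain F s r P ν Pr) (c : Fin m → ℝ) (mu : ℝ)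
    (n τ j : ℕ) : Measurable[F (n + j * τ)] fun ω => ∑ i ∈ Finset.range j,
      (c (s (n + (i + 1) * τ) ω) * r (n + (i + 1) * τ) ω - mu) :=
  Finset.measurable_sum _ fun i hi => (h.measurable_sample c mu _).mono
    (F.mono (by have := Finset.mem_range.1 hi; gcongr; omega)) le_rfl

lemma bounded_ite {p : Ω → Prop} [DecidablePred p] :
    ∃ C : ℝ, ∀ ω, |(if p ω then (1 : ℝ) else 0)| ≤ C :=
  ⟨1, fun ω => by split_ifs <;> norm_num⟩

variable
  (h : IsRewardChain F s r P ν Pr) (hν : ∀ k x, IsProbabilityMeasure (ν k x))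
  (h𝒟 : ∀ x, IsProbabilityMeasure (𝒟 x))
  (h1 : ∀ x, Integrable (fun y => y) (𝒟 x)) (h2 : ∀ x, Integrable (fun y => y ^ 2) (𝒟 x))
  (hR : ∀ x, ∫ y, y ∂𝒟 x = R x)
  (hcont : ∀ k x (f : ℝ → ℝ), Measurable f → (∀ ρ, 0 ≤ f ρ) → (∀ ρ, f ρ ≤ 1) →
    ∫ ρ, f ρ ∂ν k x ≤ ε + ∫ ρ, f ρ ∂𝒟 x)
  (hP : ∀ x y, 0 ≤ P x y) (hP1 : ∀ x, ∑ y, P x y = 1)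
  (hε : 0 ≤ ε) (hκ : 0 ≤ κ) (hτ : 1 ≤ τ) (hthr : ∀ z, thr < |z| → 1 ≤ κ * z ^ 2)

include h hν h𝒟 h1 h2 hR hcont hP hP1 hε hκ hτ hthr

/-- Chebyshev bound for a sum of contaminated samples conditionally on the past. -/
lemma integral_tail_le_gapQuad (j n : ℕ) {H Z : Ω → ℝ} (hH : Measurable[F n] H)
    (hZ : Measurable[F n] Z) (hH0 : ∀ ω, 0 ≤ H ω) (hb : ∃ C, ∀ ω, |H ω| ≤ C) :
    ∫ ω, H ω * (if thr < |Z ω + ∑ i ∈ Finset.range j,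
      (c (s (n + (i + 1) * τ) ω) * r (n + (i + 1) * τ) ω - mu)| then 1 else 0) ∂Pr
    ≤ ∫ ω, H ω * min 1 (j * ε + κ * gapQuad (P ^ τ) (fun y => c y * R y - mu)
      (fun y => ∫ ρ, (c y * ρ - mu) ^ 2 ∂𝒟 y) j (s n ω) (Z ω)) ∂Pr := by
  have hB : ∀ x y, 0 ≤ (P ^ τ) x y := Matrix.pow_apply_nonneg hP τ
  have hB1 : ∀ x, ∑ y, (P ^ τ) x y = 1 := sum_pow_apply hP1 τ
  set g : Fin m → ℝ := fun y => c y * R y - mu with hg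
  set q : Fin m → ℝ := fun y => ∫ ρ, (c y * ρ - mu) ^ 2 ∂𝒟 y with hq
  have hV0 : ∀ j y z, 0 ≤ gapQuad (P ^ τ) g q j y z := fun j y z =>
    gapQuad_nonneg h𝒟 h1 h2 hR hB hB1 j y z
  have hm0 : ∀ j x z, 0 ≤ min 1 (j * ε + κ * gapQuad (P ^ τ) g q j x z) := fun j x z => by
    have := hV0 j x z
    exact le_min zero_le_one (by positivity)
  have hgq : ∀ j, Measurable fun p : Fin m × ℝ =>
      min 1 (j * ε + κ * gapQuad (P ^ τ) g q j p.1 p.2) := fun j =>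
    measurable_from_prod_countable_right fun x => by
      simp only [gapQuad]; fun_prop
  have hbm : ∀ (j n : ℕ) (Z : Ω → ℝ), ∃ C, ∀ ω,
      |min 1 (j * ε + κ * gapQuad (P ^ τ) g q j (s n ω) (Z ω))| ≤ C := fun j n Z =>
    ⟨1, fun ω => by rw [abs_of_nonneg (hm0 _ _ _)]; exact min_le_left _ _⟩
  have hint : ∀ (j n : ℕ) (Z : Ω → ℝ), Measurable H → Measurable Z → Integrable (fun ω => H ω *
      min 1 (j * ε + κ * gapQuad (P ^ τ) g q j (s n ω) (Z ω))) Pr := fun j n Z hHm hZm =>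
    integrable_of_measurable_of_bounded (hHm.mul ((hgq j).comp
      (((h.measurable n).mono (F.le n) le_rfl).prodMk hZm))) (bounded_mul hb (hbm j n Z))
  induction j generalizing n Z with
  | zero =>
    have hHm : Measurable H := hH.mono (F.le n) le_rfl
    have hZm : Measurable Z := hZ.mono (F.le n) le_rfl
    refine integral_mono_of_nonneg (Filter.Eventually.of_forall fun ω =>
      mul_nonneg (hH0 ω) (by split_ifs <;> norm_num))
      (hint 0 n Z hHm hZm) (Filter.Eventually.of_forall fun ω => ?_)
    refine mul_le_mul_of_nonneg_left ?_ (hH0 ω)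
    split_ifs with hc
    · rw [Finset.range_zero, Finset.sum_empty, add_zero] at hc
      refine le_min le_rfl ?_
      simpa [gapQuad, gapMean, gapSq] using hthr _ hc
    · exact hm0 0 _ _
  | succ j ih =>
    have hle : F n ≤ F (n + τ) := F.mono (by omega)
    have h3 := ih (n + τ) (Z := fun ω => Z ω + (c (s (n + τ) ω) * r (n + τ) ω - mu))
      (hH.mono hle le_rfl) ((hZ.mono hle le_rfl).add (h.measurable_sample c mu _))
    have h4 := integral_min_gapQuad_le (c := c) (mu := mu) h hν h𝒟 h1 h2 hR hcont hP hP1 hε hκ hτ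
      j n hH hZ hH0 hb
    refine (Eq.trans_le ?_ (h3.trans h4)).trans ?_
    · congr 1 with ω
      have h5 : ∀ i, n + τ + (i + 1) * τ = n + (i + 1 + 1) * τ := fun i => by ring
      simp only [Finset.sum_range_succ' _ j, h5, zero_add, one_mul]
      rw [add_assoc, add_comm (∑ i ∈ Finset.range j, _)]
    · have hZm : Measurable Z := hZ.mono (F.le n) le_rfl
      have hU0 : ∀ y z, 0 ≤ gapQuadFrom (P ^ τ) g q j y z := fun y z =>
        gapQuadFrom_nonneg h𝒟 h1 h2 hR hB hB1 j y z
      refine integral_mono_of_nonneg (Filter.Eventually.of_forall fun ω =>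
        mul_nonneg (hH0 ω) (Finset.sum_nonneg fun y _ => mul_nonneg (hB _ _) ?_))
        (hint (j + 1) n Z (hH.mono (F.le n) le_rfl) hZm) (Filter.Eventually.of_forall fun ω => ?_)
      · have := hU0 y (Z ω)
        exact le_min zero_le_one (by positivity)
      · refine mul_le_mul_of_nonneg_left (le_min ?_ ?_) (hH0 ω)
        · calc _ ≤ ∑ y, (P ^ τ) (s n ω) y * 1 := Finset.sum_le_sum fun y _ =>
                mul_le_mul_of_nonneg_left (min_le_left _ _) (hB _ _)
            _ = 1 := by simp_rw [mul_one]; exact hB1 _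
        · calc _ ≤ ∑ y, (P ^ τ) (s n ω) y * ((j + 1 : ℕ) * ε +
                  κ * gapQuadFrom (P ^ τ) g q j y (Z ω)) := Finset.sum_le_sum fun y _ =>
                mul_le_mul_of_nonneg_left (min_le_right _ _) (hB _ _)
            _ = _ := by
              rw [gapQuad_succ hB1, Finset.mul_sum]
              simp_rw [mul_add, Finset.sum_add_distrib]
              rw [← Finset.sum_mul, hB1, one_mul]
              congr 1
              exact Finset.sum_congr rfl fun y _ => by ring

omit h hν hcont hP hP1 hε hκ hτ hthr in
lemma sq_mean_le_sq (x : Fin m) :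
    (c x * R x - mu) ^ 2 ≤ ∫ ρ, (c x * ρ - mu) ^ 2 ∂𝒟 x := by
  obtain ⟨_, e1⟩ := integral_gapQuad (c := c) (mu := mu) h𝒟 h1 h2 hR 0 0 x (-(c x * R x - mu))
  have h3 : 0 ≤ ∫ ρ, gapQuad 0 (fun y => c y * R y - mu)
      (fun y => ∫ ρ, (c y * ρ - mu) ^ 2 ∂𝒟 y) 0 x (-(c x * R x - mu) + (c x * ρ - mu)) ∂𝒟 x :=
    integral_nonneg fun ρ => by simp [gapQuad, gapMean, gapSq, sq_nonneg]
  rw [e1] at h3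
  simp only [gapQuadFrom, gapMean, gapSq, Pi.zero_apply, add_zero, mul_zero] at h3
  nlinarith

/-- Deviation probability of one bucket of contaminated samples conditionally on the past. -/
lemma integral_bucket_tail_le {π : Fin m → ℝ} {η : ℝ} {M : ℕ} (hπ : ∀ x, 0 ≤ π x)
    (hπ1 : ∑ x, π x = 1) (hst : π ᵥ* P = π)
    (hη : ∀ k x, rowDist P π ((k + 1) * τ) x ≤ η) (hmu : ∑ x, π x * (c x * R x) = mu)
    (hη0 : 0 ≤ η) (hM : 1 ≤ M) (hMη : M ^ 2 * η ≤ 1) (n : ℕ) {H : Ω → ℝ} (hH : Measurable[F n] H)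
    (hH0 : ∀ ω, 0 ≤ H ω) (hb : ∃ C, ∀ ω, |H ω| ≤ C) :
    ∫ ω, H ω * (if thr < |∑ i ∈ Finset.range M,
      (c (s (n + (i + 1) * τ) ω) * r (n + (i + 1) * τ) ω - mu)| then 1 else 0) ∂Pr
    ≤ (η + M * ε + κ * (4 * M * ∑ x, π x * ∫ ρ, (c x * ρ - mu) ^ 2 ∂𝒟 x)) * ∫ ω, H ω ∂Pr := by
  have hB : ∀ x y, 0 ≤ (P ^ τ) x y := Matrix.pow_apply_nonneg hP τ
  have hB1 : ∀ x, ∑ y, (P ^ τ) x y = 1 := sum_pow_apply hP1 τ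
  have hstB : π ᵥ* P ^ τ = π := vecMul_pow_eq hst τ
  set g : Fin m → ℝ := fun y => c y * R y - mu with hg
  set q : Fin m → ℝ := fun y => ∫ ρ, (c y * ρ - mu) ^ 2 ∂𝒟 y with hq
  obtain ⟨j, rfl⟩ : ∃ j, M = j + 1 := ⟨M - 1, by omega⟩
  have hle : F n ≤ F (n + τ) := F.mono (by omega)
  have h3 := integral_tail_le_gapQuad (c := c) (mu := mu) h hν h𝒟 h1 h2 hR hcont hP hP1 hε hκ hτ
    hthr j (n + τ) (Z := fun ω => c (s (n + τ) ω) * r (n + τ) ω - mu)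
      (hH.mono hle le_rfl) (h.measurable_sample c mu _) hH0 hb
  have h4 := integral_min_gapQuad_le (c := c) (mu := mu) h hν h𝒟 h1 h2 hR hcont hP hP1 hε hκ hτ
      j n hH (Z := fun _ => 0) measurable_const hH0 hb
  simp only [zero_add] at h4
  have hvar : ∑ x, π x * gapSq (P ^ τ) g q (j + 1) x ≤ 4 * (j + 1 : ℕ) * ∑ x, π x * q x := by
    refine sum_gapSq_le hB hπ hπ1 hstB (fun k x => ?_) ?_ (fun x => sq_mean_le_sq h𝒟 h1 h2 hR x)
      hη0 hM hMη
    · have := hη k x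
      rwa [rowDist, mul_comm, pow_mul] at this
    · simp only [hg, mul_sub, Finset.sum_sub_distrib, ← Finset.sum_mul, hπ1, hmu]
      ring
  have hstat : ∑ y, π y * gapQuadFrom (P ^ τ) g q j y 0 = ∑ x, π x * gapSq (P ^ τ) g q (j + 1) x := by
    have : π ⬝ᵥ ((P ^ τ) *ᵥ fun y => q y + 2 * g y * gapMean (P ^ τ) g j y + gapSq (P ^ τ) g q j y)
        = π ⬝ᵥ fun y => q y + 2 * g y * gapMean (P ^ τ) g j y + gapSq (P ^ τ) g q j y := by
      rw [dotProduct_mulVec, hstB]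
    rw [gapSq]
    refine Eq.trans (Finset.sum_congr rfl fun y _ => ?_) this.symm
    simp [gapQuadFrom]
  have hU0 : ∀ y z, 0 ≤ gapQuadFrom (P ^ τ) g q j y z := fun y z =>
    gapQuadFrom_nonneg h𝒟 h1 h2 hR hB hB1 j y z
  have hpt : ∀ x, ∑ y, (P ^ τ) x y * min 1 ((j + 1 : ℕ) * ε + κ * gapQuadFrom (P ^ τ) g q j y 0)
      ≤ η + (j + 1 : ℕ) * ε + κ * (4 * (j + 1 : ℕ) * ∑ x, π x * q x) := fun x => by
    have h5 : ∀ y, (P ^ τ) x y * min 1 ((j + 1 : ℕ) * ε + κ * gapQuadFrom (P ^ τ) g q j y 0)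
        ≤ |(P ^ τ) x y - π y| + π y * ((j + 1 : ℕ) * ε + κ * gapQuadFrom (P ^ τ) g q j y 0) := by
      intro y
      have h6 := hU0 y 0
      have h7 : 0 ≤ min 1 ((j + 1 : ℕ) * ε + κ * gapQuadFrom (P ^ τ) g q j y 0) :=
        le_min zero_le_one (by positivity)
      calc _ = ((P ^ τ) x y - π y) * min 1 ((j + 1 : ℕ) * ε + κ * gapQuadFrom (P ^ τ) g q j y 0)
            + π y * min 1 ((j + 1 : ℕ) * ε + κ * gapQuadFrom (P ^ τ) g q j y 0) := by ring
        _ ≤ |(P ^ τ) x y - π y| * 1 + π y * ((j + 1 : ℕ) * ε + κ * gapQuadFrom (P ^ τ) g q j y 0) := by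
            refine add_le_add (mul_le_mul (le_abs_self _) (min_le_left _ _) h7 (abs_nonneg _))
              (mul_le_mul_of_nonneg_left (min_le_right _ _) (hπ y))
        _ = _ := by ring
    refine (Finset.sum_le_sum fun y _ => h5 y).trans ?_
    have h8 : ∑ y, |(P ^ τ) x y - π y| ≤ η := by simpa [rowDist] using hη 0 x
    have h9 : ∑ y, π y * ((j + 1 : ℕ) * ε + κ * gapQuadFrom (P ^ τ) g q j y 0)
        = (j + 1 : ℕ) * ε + κ * ∑ y, π y * gapQuadFrom (P ^ τ) g q j y 0 := by
      simp_rw [mul_add, Finset.sum_add_distrib]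
      rw [← Finset.sum_mul, hπ1, one_mul, Finset.mul_sum]
      congr 1
      exact Finset.sum_congr rfl fun y _ => by ring
    rw [Finset.sum_add_distrib, h9, hstat]
    have := mul_le_mul_of_nonneg_left hvar hκ
    linarith
  refine (Eq.trans_le ?_ (h3.trans h4)).trans ?_
  · congr 1 with ω
    have h5 : ∀ i, n + τ + (i + 1) * τ = n + (i + 1 + 1) * τ := fun i => by ring
    simp only [Finset.sum_range_succ' _ j, h5, zero_add, one_mul]
    rw [add_comm (∑ i ∈ Finset.range j, _)]
  · rw [← integral_const_mul]
    have hHm : Measurable H := hH.mono (F.le n) le_rfl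
    refine integral_mono_of_nonneg (Filter.Eventually.of_forall fun ω =>
      mul_nonneg (hH0 ω) (Finset.sum_nonneg fun y _ => mul_nonneg (hB _ _) ?_))
      ((integrable_of_measurable_of_bounded hHm hb).const_mul _)
      (Filter.Eventually.of_forall fun ω => ?_)
    · have := hU0 y 0
      exact le_min zero_le_one (by positivity)
    · exact (mul_le_mul_of_nonneg_left (hpt _) (hH0 ω)).trans_eq (mul_comm _ _)

end BucketTail

lemma abs_sub_le_of_isMedianOf {L : ℕ} {vals : ℕ → ℝ} {med b err : ℝ} (h : IsMedianOf L vals med)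
    (hbad : ¬ L ≤ 2 * ((Finset.range L).filter fun i => err < |vals i - b|).card) :
    |med - b| ≤ err := by
  obtain ⟨h1, h2⟩ := h
  by_contra! hlt
  rcases lt_abs.1 hlt with hc | hc
  · refine hbad (h2.trans (Nat.mul_le_mul_left 2 (Finset.card_le_card ?_)))
    refine Finset.monotone_filter_right _ fun i _ hi => hc.trans_le ?_
    exact (sub_le_sub_right hi b).trans (le_abs_self _)
  · refine hbad (h1.trans (Nat.mul_le_mul_left 2 (Finset.card_le_card ?_)))
    refine Finset.monotone_filter_right _ fun i _ hi => hc.trans_le ?_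
    exact (neg_le_neg (sub_le_sub_right hi b)).trans (neg_le_abs _)

section Majority

variable {Ω : Type*} {mΩ : MeasurableSpace Ω} {Pr : Measure Ω} [IsProbabilityMeasure Pr]

open Classical in
/-- A Chernoff bound for the number of conditionally unlikely events. -/
lemma measureReal_majority_le {𝒢 : ℕ → MeasurableSpace Ω} (hmono : Monotone 𝒢)
    (hle : ∀ i, 𝒢 i ≤ mΩ) {B : ℕ → Set Ω} (hB : ∀ i, MeasurableSet[𝒢 (i + 1)] (B i))
    (hq : ∀ i, 1 ≤ i → ∀ H : Ω → ℝ, Measurable[𝒢 i] H → (∀ ω, 0 ≤ H ω) →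
      (∃ C, ∀ ω, |H ω| ≤ C) →
      ∫ ω, H ω * (if ω ∈ B i then 1 else 0) ∂Pr ≤ 1 / 9 * ∫ ω, H ω ∂Pr) {L : ℕ} (hL : 1 ≤ L) :
    Pr.real {ω | L ≤ 2 * ((Finset.range L).filter fun i => ω ∈ B i).card} ≤ 3 * (2 / 3) ^ L := by
  set W : ℕ → Ω → ℝ := fun k ω => ∏ i ∈ Finset.range k, (1 + 3 * if ω ∈ B i then (1 : ℝ) else 0)
    with hW
  have hf1 : ∀ i ω, 1 ≤ (1 + 3 * if ω ∈ B i then (1 : ℝ) else 0) := fun i ω => by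
    split_ifs <;> norm_num
  have hf4 : ∀ i ω, (1 + 3 * if ω ∈ B i then (1 : ℝ) else 0) ≤ 4 := fun i ω => by
    split_ifs <;> norm_num
  have hW0 : ∀ k ω, 0 ≤ W k ω := fun k ω => Finset.prod_nonneg fun i _ => zero_le_one.trans (hf1 i ω)
  have hW4 : ∀ k ω, W k ω ≤ 4 ^ k := fun k ω => by
    refine (Finset.prod_le_prod (fun i _ => zero_le_one.trans (hf1 i ω)) fun i _ => hf4 i ω).trans ?_
    simp
  have hWm : ∀ k, Measurable[𝒢 k] (W k) := fun k => by
    refine Finset.measurable_prod _ fun i hi => ?_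
    have h1 : MeasurableSet[𝒢 k] (B i) :=
      hmono (Nat.succ_le_of_lt (Finset.mem_range.1 hi)) _ (hB i)
    exact measurable_const.add ((Measurable.ite h1 measurable_const measurable_const).const_mul 3)
  have hWb : ∀ k, ∃ C, ∀ ω, |W k ω| ≤ C := fun k =>
    ⟨4 ^ k, fun ω => by rw [abs_of_nonneg (hW0 k ω)]; exact hW4 k ω⟩
  have hWi : ∀ k, Integrable (W k) Pr := fun k =>
    integrable_of_measurable_of_bounded ((hWm k).mono (hle k) le_rfl) (hWb k)
  have hstep : ∀ k, ∫ ω, W (k + 1) ω ∂Pr ≤ 4 * (4 / 3 : ℝ) ^ k := by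
    intro k
    induction k with
    | zero =>
      calc ∫ ω, W (0 + 1) ω ∂Pr ≤ ∫ _, (4 : ℝ) ∂Pr :=
            integral_mono (hWi _) (integrable_const _) fun ω => by simpa using hW4 1 ω
        _ = _ := by simp
    | succ k ih =>
      have e : ∀ ω, W (k + 1 + 1) ω = W (k + 1) ω
          + 3 * (W (k + 1) ω * if ω ∈ B (k + 1) then (1 : ℝ) else 0) := fun ω => by
        simp only [hW]
        rw [Finset.prod_range_succ]
        ring
      have hBm : MeasurableSet (B (k + 1)) := hle _ _ (hB (k + 1))
      have i1 : Integrable (fun ω => W (k + 1) ω * if ω ∈ B (k + 1) then (1 : ℝ) else 0) Pr :=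
        integrable_of_measurable_of_bounded (((hWm _).mono (hle _) le_rfl).mul
          (Measurable.ite hBm measurable_const measurable_const)) (bounded_mul (hWb _) bounded_ite)
      rw [integral_congr_ae (Filter.Eventually.of_forall e), integral_add (hWi _) (i1.const_mul 3),
        integral_const_mul]
      have := hq (k + 1) (by omega) (W (k + 1)) (hWm _) (hW0 _) (hWb _)
      calc _ ≤ 4 / 3 * (4 * (4 / 3 : ℝ) ^ k) := by linarith
        _ = _ := by ring
  obtain ⟨k, rfl⟩ : ∃ k, L = k + 1 := ⟨L - 1, by omega⟩
  have hmark := mul_meas_ge_le_integral_of_nonneg (μ := Pr)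
    (Filter.Eventually.of_forall (hW0 (k + 1))) (hWi _) ((2 : ℝ) ^ (k + 1))
  have hsub : {ω | k + 1 ≤ 2 * ((Finset.range (k + 1)).filter fun i => ω ∈ B i).card}
      ⊆ {ω | (2 : ℝ) ^ (k + 1) ≤ W (k + 1) ω} := fun ω hω => by
    have e : W (k + 1) ω = 4 ^ ((Finset.range (k + 1)).filter fun i => ω ∈ B i).card := by
      simp only [hW]
      rw [← Finset.prod_const, Finset.prod_filter]
      refine Finset.prod_congr rfl fun i _ => ?_
      split_ifs <;> norm_num
    rw [Set.mem_ofPred_eq, e, show (4 : ℝ) = 2 ^ 2 by norm_num, ← pow_mul]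
    exact pow_le_pow_right₀ (by norm_num) hω
  have h1 : Pr.real {ω | k + 1 ≤ 2 * ((Finset.range (k + 1)).filter fun i => ω ∈ B i).card}
      ≤ Pr.real {ω | (2 : ℝ) ^ (k + 1) ≤ W (k + 1) ω} := measureReal_mono hsub
  have h2 : (2 : ℝ) ^ (k + 1) * Pr.real {ω | (2 : ℝ) ^ (k + 1) ≤ W (k + 1) ω}
      ≤ 4 * (4 / 3 : ℝ) ^ k := hmark.trans (hstep k)
  have h3 : (2 : ℝ) ^ (k + 1) * (3 * (2 / 3) ^ (k + 1)) = 4 * (4 / 3 : ℝ) ^ k := by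
    rw [mul_left_comm, ← mul_pow, pow_succ]; norm_num; ring
  refine h1.trans (le_of_mul_le_mul_left (h2.trans_eq h3.symm) (by positivity))

end Majority

section Rumem

variable {m : ℕ} {𝒟 : Fin m → Measure ℝ} {R c : Fin m → ℝ} {mu : ℝ}
  {Ω : Type*} {mΩ : MeasurableSpace Ω} {Pr : Measure Ω} [IsProbabilityMeasure Pr]
  {s : ℕ → Ω → Fin m} {r : ℕ → Ω → ℝ} {P : Matrix (Fin m) (Fin m) ℝ}
  {ν : ℕ → Fin m → Measure ℝ} {F : Filtration ℕ mΩ} {ε : ℝ}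

/-- The event that at least half of the bucket means are further than `err` from `mu`. -/
def majorityFail (s : ℕ → Ω → Fin m) (r : ℕ → Ω → ℝ) (c : Fin m → ℝ) (mu err : ℝ) (τ M L : ℕ) :
    Set Ω :=
  {ω | L ≤ 2 * ((Finset.range L).filter fun i =>
    err < |subsampledBucketMean τ M (fun k => c (s k ω) * r k ω) i - mu|).card}

lemma lt_abs_subsampledBucketMean_sub_iff {τ M : ℕ} (hM : 1 ≤ M) (y : ℕ → ℝ) (i : ℕ) (mu err : ℝ) :
    err < |subsampledBucketMean τ M y i - mu| ↔
      M * err < |∑ j ∈ Finset.range M, (y ((i * M + j) * τ) - mu)| := by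
  have hM0 : (0 : ℝ) < M := by exact_mod_cast hM
  have e : ∑ j ∈ Finset.range M, (y ((i * M + j) * τ) - mu)
      = M * (subsampledBucketMean τ M y i - mu) := by
    rw [subsampledBucketMean, Finset.sum_sub_distrib]
    simp only [Finset.sum_const, Finset.card_range, nsmul_eq_mul]
    field_simp
  rw [e, abs_mul, abs_of_pos hM0, mul_lt_mul_iff_right₀ hM0]

omit [IsProbabilityMeasure Pr] in
lemma IsRewardChain.measurableSet_bucket (h : IsRewardChain F s r P ν Pr) (c : Fin m → ℝ)
    (mu err : ℝ) (τ M i N : ℕ) (hN : ((i + 1) * M - 1) * τ ≤ N) : MeasurableSet[F N]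
      {ω | err < |subsampledBucketMean τ M (fun k => c (s k ω) * r k ω) i - mu|} := by
  have h1 : Measurable[F N] fun ω =>
      subsampledBucketMean τ M (fun k => c (s k ω) * r k ω) i - mu := by
    refine Measurable.sub_const (Measurable.div_const (Finset.measurable_sum _ fun j hj => ?_) _) _
    have h2 : (i * M + j) * τ ≤ N := by
      refine le_trans (Nat.mul_le_mul_right τ ?_) hN
      have := Finset.mem_range.1 hj
      rw [add_mul, one_mul]
      omega
    exact ((measurable_comp_finite (h.measurable _) c).mul (h.measurable_reward _)).mono
      (F.mono h2) le_rfl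
  exact (measurable_abs.comp h1) measurableSet_Ioi

omit [IsProbabilityMeasure Pr] in
open Classical in
lemma IsRewardChain.measurableSet_majorityFail (h : IsRewardChain F s r P ν Pr) (c : Fin m → ℝ)
    (mu err : ℝ) (τ M L N : ℕ) (hN : (L * M - 1) * τ ≤ N) :
    MeasurableSet[F N] (majorityFail s r c mu err τ M L) := by
  have h1 : ∀ i < L, MeasurableSet[F N]
      {ω | err < |subsampledBucketMean τ M (fun k => c (s k ω) * r k ω) i - mu|} := fun i hi =>
    h.measurableSet_bucket c mu err τ M i N (le_trans (Nat.mul_le_mul_right τ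
      (Nat.sub_le_sub_right (Nat.mul_le_mul_right M hi) 1)) hN)
  have h2 : Measurable[F N] fun ω => ∑ i ∈ Finset.range L,
      if err < |subsampledBucketMean τ M (fun k => c (s k ω) * r k ω) i - mu| then 1 else 0 :=
    Finset.measurable_sum _ fun i hi =>
      Measurable.ite (h1 i (Finset.mem_range.1 hi)) measurable_const measurable_const
  have e : majorityFail s r c mu err τ M L = (fun ω => ∑ i ∈ Finset.range L,
      if err < |subsampledBucketMean τ M (fun k => c (s k ω) * r k ω) i - mu| then 1 else 0)
        ⁻¹' {k | L ≤ 2 * k} := by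
    ext ω
    simp only [majorityFail, Finset.card_filter, Set.mem_preimage, Set.mem_ofPred_eq]
  rw [e]
  exact h2 (MeasurableSet.of_discrete)

/-- Failure probability of the median of bucket means. -/
lemma measureReal_majorityFail_le (h : IsRewardChain F s r P ν Pr)
    (hν : ∀ k x, IsProbabilityMeasure (ν k x))
    (h𝒟 : ∀ x, IsProbabilityMeasure (𝒟 x))
    (h1 : ∀ x, Integrable (fun y => y) (𝒟 x)) (h2 : ∀ x, Integrable (fun y => y ^ 2) (𝒟 x))
    (hR : ∀ x, ∫ y, y ∂𝒟 x = R x)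
    (hcont : ∀ k x (f : ℝ → ℝ), Measurable f → (∀ ρ, 0 ≤ f ρ) → (∀ ρ, f ρ ≤ 1) →
      ∫ ρ, f ρ ∂ν k x ≤ ε + ∫ ρ, f ρ ∂𝒟 x)
    (hP : ∀ x y, 0 ≤ P x y) (hP1 : ∀ x, ∑ y, P x y = 1) (hε : 0 ≤ ε) {π : Fin m → ℝ}
    (hπ : ∀ x, 0 ≤ π x) (hπ1 : ∑ x, π x = 1) (hst : π ᵥ* P = π) {η : ℝ} {τ n L M : ℕ} (hτ : 1 ≤ τ)
    (hη : ∀ k x, rowDist P π ((k + 1) * τ) x ≤ η) (hmu : ∑ x, π x * (c x * R x) = mu)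
    (hη0 : 0 ≤ η) (hη1 : η ≤ 1 / 100) (hL : 1 ≤ L) (hLn : L ≤ n) (hLε : 12 * ε * n ≤ L)
    (hMdef : M = n / L) (hMη : M ^ 2 * η ≤ 1) {V err : ℝ} (hV : 0 < V)
    (hvar : ∑ x, π x * ∫ ρ, (c x * ρ - mu) ^ 2 ∂𝒟 x ≤ V) (herr0 : 0 ≤ err)
    (herr : err ^ 2 = 800 * V * (L / n)) :
    Pr.real (majorityFail s r c mu err τ M L) ≤ 3 * (2 / 3) ^ L := by
  classical
  have hM : 1 ≤ M := by rw [hMdef]; exact (Nat.one_le_div_iff (by omega)).2 hLn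
  have hML : M * L ≤ n := by rw [hMdef]; exact Nat.div_mul_le_self n L
  have hML2 : n ≤ 2 * (M * L) := by
    have h3 := Nat.lt_mul_div_succ n (show 0 < L by omega)
    rw [← hMdef] at h3
    nlinarith
  have hn0 : (0 : ℝ) < n := by exact_mod_cast (by omega : 0 < n)
  have hL0 : (0 : ℝ) < L := by exact_mod_cast (by omega : 0 < L)
  have hM0 : (0 : ℝ) < M := by exact_mod_cast (by omega : 0 < M)
  have hMLr : (M : ℝ) * L ≤ n := by exact_mod_cast hML
  have hML2r : (n : ℝ) ≤ 2 * (M * L) := by exact_mod_cast hML2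
  have herrp : 0 < err ^ 2 := by rw [herr]; positivity
  have hMε : M * ε ≤ 1 / 12 := by
    have h3 : M * (12 * ε * n) ≤ n := (mul_le_mul_of_nonneg_left hLε hM0.le).trans hMLr
    have h4 : (12 * (M * ε)) * n ≤ 1 * n := by linarith
    have := le_of_mul_le_mul_right h4 hn0
    linarith
  set κ : ℝ := 1 / (M * err) ^ 2 with hκdef
  have hκ0 : 0 < κ := by rw [hκdef, mul_pow]; positivity
  have hκV : κ * (4 * M * V) ≤ 1 / 100 := by
    have e : κ * (4 * M * V) = n / (200 * (M * L)) := by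
      rw [hκdef, mul_pow, herr]; field_simp; norm_num
    rw [e, div_le_div_iff₀ (by positivity) (by norm_num)]
    linarith
  set B : ℕ → Set Ω := fun i =>
    {ω | err < |subsampledBucketMean τ M (fun k => c (s k ω) * r k ω) i - mu|} with hBdef
  have hmaj := measureReal_majority_le (Pr := Pr) (𝒢 := fun i => F ((i * M - 1) * τ)) (B := B)
    (fun i j hij => F.mono (by gcongr)) (fun i => F.le _)
    (fun i => h.measurableSet_bucket c mu err τ M i _ le_rfl) ?_ hL
  · refine (le_of_eq ?_).trans hmaj
    congr 1
  · intro i hi H hH hH0 hHb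
    have h3 := integral_bucket_tail_le (c := c) (mu := mu) (thr := M * err) (κ := κ) h hν h𝒟 h1 h2
      hR hcont hP hP1 hε hκ0.le hτ (fun z hz => ?_) hπ hπ1 hst hη hmu hη0 hM hMη
      ((i * M - 1) * τ) hH hH0 hHb
    · have hidx : ∀ j, (i * M - 1) * τ + (j + 1) * τ = (i * M + j) * τ := fun j => by
        rw [← add_mul]
        congr 1
        have : 1 ≤ i * M := Nat.mul_pos hi hM
        omega
      simp only [hidx] at h3
      have e : ∀ ω, (if ω ∈ B i then (1 : ℝ) else 0) = if M * err < |∑ j ∈ Finset.range M,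
          (c (s ((i * M + j) * τ) ω) * r ((i * M + j) * τ) ω - mu)| then 1 else 0 := fun ω => by
        have := lt_abs_subsampledBucketMean_sub_iff (τ := τ) hM (fun k => c (s k ω) * r k ω) i mu err
        simp only [hBdef, Set.mem_ofPred_eq, this]
      simp only [e]
      refine h3.trans (mul_le_mul_of_nonneg_right ?_ (integral_nonneg hH0))
      have h4 : κ * (4 * M * ∑ x, π x * ∫ ρ, (c x * ρ - mu) ^ 2 ∂𝒟 x) ≤ κ * (4 * M * V) := by
        gcongr
      linarith
    · have h5 : (M * err) ^ 2 ≤ z ^ 2 := by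
        rw [← sq_abs z]
        exact pow_le_pow_left₀ (by positivity) hz.le 2
      rw [hκdef, one_div, inv_mul_eq_div, one_le_div (by rw [mul_pow]; positivity)]
      exact h5

end Rumem

section RumemParameters

variable {tmix K T t : ℕ} {ε : ℝ}

lemma log_twelve_mul_le (hK : 1 ≤ K) (hT : 2 ≤ T) :
    Real.log (12 * K * T ^ 3 : ℝ) ≤ 7 * Real.log (K * T : ℝ) := by
  have hK1 : (1 : ℝ) ≤ K := by exact_mod_cast hK
  have hT2 : (2 : ℝ) ≤ T := by exact_mod_cast hT
  rw [show (7 : ℝ) * Real.log (K * T : ℝ) = Real.log ((K * T : ℝ) ^ 7) by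
    rw [Real.log_pow]; norm_num]
  refine Real.log_le_log (by positivity) ?_
  have h1 : (2 : ℝ) ^ 4 ≤ (T : ℝ) ^ 4 := pow_le_pow_left₀ (by norm_num) hT2 4
  have h2 : (K : ℝ) ^ 1 ≤ (K : ℝ) ^ 7 := pow_le_pow_right₀ hK1 (by norm_num)
  rw [pow_one] at h2
  calc (12 * K * T ^ 3 : ℝ) ≤ T ^ 4 * K ^ 7 * T ^ 3 := by gcongr; linarith
    _ = (K * T : ℝ) ^ 7 := by ring

lemma four_le_log_twelve_mul (hK : 1 ≤ K) (hT : 2 ≤ T) :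
    4 ≤ Real.log (12 * K * T ^ 3 : ℝ) := by
  have hK1 : (1 : ℝ) ≤ K := by exact_mod_cast hK
  have hT2 : (2 : ℝ) ≤ T := by exact_mod_cast hT
  have h1 : (2 : ℝ) ^ 3 ≤ (T : ℝ) ^ 3 := pow_le_pow_left₀ (by norm_num) hT2 3
  have h2 : Real.log ((2 : ℝ) ^ 6) ≤ Real.log (12 * K * T ^ 3 : ℝ) := by
    refine Real.log_le_log (by norm_num) ?_
    nlinarith
  rw [Real.log_pow] at h2
  have := Real.log_two_gt_d9
  push_cast at h2
  linarith

lemma log_two_le_log_mul (hK : 1 ≤ K) (hT : 2 ≤ T) : 0.69 ≤ Real.log (K * T : ℝ) := by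
  have hK1 : (1 : ℝ) ≤ K := by exact_mod_cast hK
  have hT2 : (2 : ℝ) ≤ T := by exact_mod_cast hT
  have h2 : Real.log 2 ≤ Real.log (K * T : ℝ) := Real.log_le_log (by norm_num) (by nlinarith)
  have := Real.log_two_gt_d9
  norm_num at this ⊢
  linarith

lemma one_le_rumemTau {N : ℕ} {δ : ℝ} (htmix : 1 ≤ tmix) (hδ : 1 ≤ N / δ) :
    1 ≤ rumemTau tmix N δ := by
  rw [rumemTau, Nat.one_le_ceil_iff]
  refine mul_pos (Real.logb_pos (by norm_num) ?_) (by exact_mod_cast htmix)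
  rw [mul_div_assoc]
  linarith

lemma rumemTau_le (htmix : 1 ≤ tmix) (hK : 1 ≤ K) (hT : 2 ≤ T) (ht : t + 1 ≤ T) :
    (rumemTau tmix (t + 1) (1 / (K * T ^ 2 : ℝ)) : ℝ)
      ≤ 2 * Real.log (12 * K * T ^ 3 : ℝ) * tmix := by
  have hK1 : (1 : ℝ) ≤ K := by exact_mod_cast hK
  have hT2 : (2 : ℝ) ≤ T := by exact_mod_cast hT
  have htT : ((t + 1 : ℕ) : ℝ) ≤ T := by exact_mod_cast ht
  have ht0 : (1 : ℝ) ≤ ((t + 1 : ℕ) : ℝ) := by exact_mod_cast (by omega : 1 ≤ t + 1)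
  have htm : (1 : ℝ) ≤ tmix := by exact_mod_cast htmix
  have hl2 := Real.log_two_gt_d9
  have hl2' : (0 : ℝ) < Real.log 2 := by linarith
  have h4 := four_le_log_twelve_mul hK hT
  have hlog : Real.log (6 * (t + 1 : ℕ) / (1 / (K * T ^ 2 : ℝ))) + Real.log 2
      ≤ Real.log (12 * K * T ^ 3 : ℝ) := by
    rw [← Real.log_mul (by positivity) (by norm_num)]
    refine Real.log_le_log (by positivity) ?_
    rw [div_div_eq_mul_div, div_one]
    calc _ ≤ 6 * (T : ℝ) * (K * T ^ 2) * 2 := by gcongr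
      _ = _ := by ring
  have hlogb : Real.logb 2 (6 * (t + 1 : ℕ) / (1 / (K * T ^ 2 : ℝ))) + 1
      ≤ 2 * Real.log (12 * K * T ^ 3 : ℝ) := by
    rw [Real.logb, div_add_one hl2'.ne', div_le_iff₀ hl2']
    nlinarith
  have hpos : 0 ≤ Real.logb 2 (6 * (t + 1 : ℕ) / (1 / (K * T ^ 2 : ℝ))) := by
    refine Real.logb_nonneg (by norm_num) ?_
    rw [div_div_eq_mul_div, div_one]
    have : (1 : ℝ) ≤ K * T ^ 2 := by nlinarith
    nlinarith
  have := (Nat.ceil_lt_add_one (mul_nonneg hpos (by linarith : (0 : ℝ) ≤ tmix))).le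
  rw [rumemTau]
  nlinarith

lemma hundred_le_div_confidence (hK : 1 ≤ K) (hT : 2 ≤ T) (ht100 : 100 ≤ t) :
    100 ≤ ((t + 1 : ℕ) : ℝ) / (1 / (K * T ^ 2 : ℝ)) := by
  have hK1 : (1 : ℝ) ≤ K := by exact_mod_cast hK
  have hT2 : (2 : ℝ) ≤ T := by exact_mod_cast hT
  have ht0 : (100 : ℝ) ≤ ((t + 1 : ℕ) : ℝ) := by exact_mod_cast (by omega : 100 ≤ t + 1)
  rw [div_div_eq_mul_div, div_one]
  have : (1 : ℝ) ≤ K * T ^ 2 := by nlinarith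
  nlinarith

lemma sq_le_div_confidence (hK : 1 ≤ K) :
    (T : ℝ) ^ 2 ≤ ((t + 1 : ℕ) : ℝ) / (1 / (K * T ^ 2 : ℝ)) := by
  have hK1 : (1 : ℝ) ≤ K := by exact_mod_cast hK
  have h1 : (1 : ℝ) ≤ (t + 1 : ℕ) := by exact_mod_cast (by omega : 1 ≤ t + 1)
  rw [div_div_eq_mul_div, div_one, ← mul_assoc]
  exact le_mul_of_one_le_left (by positivity) (one_le_mul_of_one_le_of_one_le h1 hK1)

lemma sq_mul_le_div_confidence_sq (hT : (1 : ℝ) ≤ T) :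
    (K ^ 2 * t : ℝ) ≤ (((t + 1 : ℕ) : ℝ) / (1 / (K * T ^ 2 : ℝ))) ^ 2 := by
  rw [div_div_eq_mul_div, div_one]
  have h4 : (t : ℝ) ≤ ((t + 1 : ℕ) : ℝ) := by push_cast; linarith
  have h5 : (1 : ℝ) ≤ (T : ℝ) ^ 4 := one_le_pow₀ hT
  have h6 : (1 : ℝ) ≤ ((t + 1 : ℕ) : ℝ) := by exact_mod_cast (by omega : 1 ≤ t + 1)
  have h7 : (t : ℝ) ≤ ((t + 1 : ℕ) : ℝ) * ((t + 1 : ℕ) : ℝ) := by nlinarith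
  calc (K ^ 2 * t : ℝ) ≤ K ^ 2 * (((t + 1 : ℕ) : ℝ) * ((t + 1 : ℕ) : ℝ)) * 1 := by
        rw [mul_one]; exact mul_le_mul_of_nonneg_left h7 (by positivity)
    _ ≤ K ^ 2 * (((t + 1 : ℕ) : ℝ) * ((t + 1 : ℕ) : ℝ)) * (T : ℝ) ^ 4 :=
        mul_le_mul_of_nonneg_left h5 (by positivity)
    _ = _ := by ring

lemma rumemL_real_nonneg {tmix N : ℕ} {δ ε : ℝ} (hε : 0 ≤ ε) (hδ : 0 ≤ Real.log (24 / δ))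
    (hN : 0 ≤ Real.log (N / δ)) :
    12 * rumemEps' tmix N δ ε * (rumemn tmix N δ : ℝ) + (256 / 7) * Real.log (N / δ)
      = 12 * ε * rumemn tmix N δ + 128 * Real.log (24 / δ) + (256 / 7) * Real.log (N / δ) ∧
    0 ≤ 12 * ε * rumemn tmix N δ + 128 * Real.log (24 / δ) + (256 / 7) * Real.log (N / δ) := by
  have hn : (0 : ℝ) < rumemn tmix N δ := by
    rw [rumemn]; positivity
  refine ⟨?_, by positivity⟩
  rw [rumemEps']
  field_simp
  ring

lemma three_mul_pow_le {x : ℝ} {L : ℕ} (hx : 0 < x) (h : 6 * Real.log x ≤ L) :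
    3 * (2 / 3 : ℝ) ^ L ≤ 3 / x ^ 2 := by
  rw [div_eq_mul_inv]
  refine mul_le_mul_of_nonneg_left ?_ (by norm_num)
  have h1 : (2 / 3 : ℝ) ^ L ≤ Real.exp (-(1 / 3)) ^ L := by
    refine pow_le_pow_left₀ (by norm_num) ?_ L
    have := Real.add_one_le_exp (-(1 / 3) : ℝ)
    linarith
  have h2 : Real.exp (-(1 / 3)) ^ L ≤ Real.exp (-(2 * Real.log x)) := by
    rw [← Real.exp_nat_mul]
    exact Real.exp_le_exp.2 (by linarith)
  have h3 : Real.exp (-(2 * Real.log x)) = (x ^ 2)⁻¹ := by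
    rw [Real.exp_neg, mul_comm, Real.exp_mul, Real.exp_log hx]
    norm_num
  exact h1.trans (h2.trans h3.le)

/-- Consequences of the choice of the RUMEM parameters after the burn-in time. -/
lemma rumem_parameters (htmix : 1 ≤ tmix) (hK : 1 ≤ K) (hT : 2 ≤ T) (ht : t + 1 ≤ T) (hε : 0 ≤ ε)
    (hε1 : ε ≤ 1 / 192) (hburn : 70000 * tmix * Real.log (K * T : ℝ) ^ 2 ≤ t) {δ : ℝ}
    (hδ : δ = 1 / (K * T ^ 2 : ℝ)) {τ n L : ℕ} (hτ : τ = rumemTau tmix (t + 1) δ)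
    (hn : n = rumemn tmix (t + 1) δ) (hL : L = rumemL tmix (t + 1) δ ε) :
    100 ≤ t ∧ 1 ≤ τ ∧ 1 ≤ L ∧ L ≤ n ∧ 12 * ε * n ≤ L ∧
    (L : ℝ) / n ≤ 12 * ε + 330 * (Real.log (12 * K * T ^ 3 : ℝ) ^ 2 * tmix / t) ∧
    ((n / L : ℕ) : ℝ) ^ 2 * (((t + 1 : ℕ) : ℝ) / δ)⁻¹ ≤ 1 ∧
    3 * (2 / 3 : ℝ) ^ L ≤ 3 / (K ^ 2 * t) ∧ (L * (n / L) - 1) * τ ≤ t := by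
  have hK1 : (1 : ℝ) ≤ K := by exact_mod_cast hK
  have hT2 : (2 : ℝ) ≤ T := by exact_mod_cast hT
  have htm : (1 : ℝ) ≤ tmix := by exact_mod_cast htmix
  have hℓ := log_two_le_log_mul hK hT
  have hΛℓ := log_twelve_mul_le hK hT
  have hΛ4 := four_le_log_twelve_mul hK hT
  set ℓ := Real.log (K * T : ℝ) with hℓdef
  set Λ := Real.log (12 * K * T ^ 3 : ℝ) with hΛdef
  have hℓ2 : (0.69 : ℝ) ^ 2 ≤ ℓ ^ 2 := pow_le_pow_left₀ (by norm_num) hℓ 2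
  have ht100 : 100 ≤ t := by
    have : (100 : ℝ) ≤ t := by
      refine le_trans ?_ hburn
      norm_num at hℓ2
      nlinarith
    exact_mod_cast this
  have ht0 : (0 : ℝ) < t := by exact_mod_cast (by omega : 0 < t)
  have htT : ((t + 1 : ℕ) : ℝ) ≤ T := by exact_mod_cast ht
  have hNδ := hundred_le_div_confidence hK hT ht100
  have hτle := rumemTau_le htmix hK hT ht
  rw [← hδ] at hNδ hτle
  rw [← hτ] at hτle
  have hτ1 : 1 ≤ τ := hτ ▸ one_le_rumemTau htmix (by linarith)
  have hτ0 : (0 : ℝ) < τ := by exact_mod_cast hτ1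
  have hndef : n = t / τ + 1 := by rw [hn, rumemn, ← hτ]; simp
  have hnt : n ≤ t + 1 := by
    have := Nat.div_le_self t τ
    omega
  have hn0 : (0 : ℝ) < n := by rw [hndef]; positivity
  have hnge : (t : ℝ) ≤ n * (2 * Λ * tmix) := by
    have h1 : (t : ℝ) ≤ n * τ := by
      have := (Nat.lt_mul_div_succ t hτ1).le
      rw [← hndef, mul_comm] at this
      exact_mod_cast this
    exact h1.trans (by gcongr)
  have hlog24 : 0 ≤ Real.log (24 / δ) ∧ Real.log (24 / δ) ≤ Λ := by
    have e : 24 / δ = 24 * (K * T ^ 2 : ℝ) := by rw [hδ]; field_simp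
    have h1 : (1 : ℝ) ≤ K * T ^ 2 := by nlinarith
    rw [e]
    refine ⟨Real.log_nonneg (by linarith), Real.log_le_log (by positivity) ?_⟩
    calc _ ≤ (12 * T) * (K * T ^ 2 : ℝ) := by gcongr; linarith
      _ = _ := by ring
  have hlogN : 0 ≤ Real.log ((t + 1 : ℕ) / δ) ∧ Real.log ((t + 1 : ℕ) / δ) ≤ Λ := by
    refine ⟨Real.log_nonneg (by linarith), Real.log_le_log (by linarith) ?_⟩
    rw [hδ, div_div_eq_mul_div, div_one]
    calc _ ≤ T * (K * T ^ 2 : ℝ) := by gcongr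
      _ ≤ 12 * (T * (K * T ^ 2 : ℝ)) := by
        have : (0 : ℝ) ≤ T * (K * T ^ 2 : ℝ) := by positivity
        linarith
      _ = _ := by ring
  obtain ⟨hLe, hL0⟩ := rumemL_real_nonneg (tmix := tmix) hε hlog24.1 hlogN.1
  rw [← hn] at hLe hL0
  have hLge : 12 * ε * n + 128 * Real.log (24 / δ) + (256 / 7) * Real.log ((t + 1 : ℕ) / δ) ≤ L := by
    rw [hL, rumemL, ← hn, hLe]; exact Nat.le_ceil _
  have hLle : (L : ℝ) ≤ 12 * ε * n + 165 * Λ := by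
    have := (Nat.ceil_lt_add_one hL0).le
    rw [hL, rumemL, ← hn, hLe]
    linarith [hlog24.2, hlogN.2]
  have hLn : (L : ℝ) / n ≤ 12 * ε + 330 * (Λ ^ 2 * tmix / t) := by
    rw [div_le_iff₀ hn0, add_mul]
    refine hLle.trans (add_le_add le_rfl ?_)
    have h1 : 330 * (Λ ^ 2 * tmix / t) * n = 165 * Λ * (n * (2 * Λ * tmix) / t) := by
      field_simp; ring
    rw [h1]
    refine le_mul_of_one_le_right (by linarith) ?_
    rwa [one_le_div ht0]
  have hfrac : Λ ^ 2 * tmix / t ≤ 49 / 70000 := by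
    have h1 : Λ ^ 2 ≤ (7 * ℓ) ^ 2 := pow_le_pow_left₀ (by linarith) hΛℓ 2
    rw [div_le_div_iff₀ ht0 (by norm_num)]
    nlinarith
  have hLlen : L ≤ n := by
    have h1 : (L : ℝ) / n ≤ 1 := by linarith
    rw [div_le_one hn0] at h1
    exact_mod_cast h1
  have hlogNpos : 0 < Real.log ((t + 1 : ℕ) / δ) := Real.log_pos (by linarith)
  have hL1 : 1 ≤ L := by
    have : (0 : ℝ) < L := by
      have : 0 ≤ 12 * ε * n := by positivity
      linarith [hlog24.1]
    exact_mod_cast this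
  refine ⟨ht100, hτ1, hL1, hLlen, ?_, hLn, ?_, ?_, ?_⟩
  · linarith [hlog24.1, hlogN.1]
  · have h1 : ((n / L : ℕ) : ℝ) ≤ T := by
      have := Nat.div_le_self n L
      exact_mod_cast (by omega : n / L ≤ T)
    have h2 : (T : ℝ) ^ 2 ≤ ((t + 1 : ℕ) : ℝ) / δ := hδ ▸ sq_le_div_confidence hK
    rw [← div_eq_mul_inv, div_le_one (by linarith)]
    exact (pow_le_pow_left₀ (by positivity) h1 2).trans h2
  · refine (three_mul_pow_le (x := ((t + 1 : ℕ) : ℝ) / δ) (by linarith) ?_).trans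
      (div_le_div_of_nonneg_left (by norm_num) (by positivity) ?_)
    · have : 0 ≤ 12 * ε * n := by positivity
      linarith [hlog24.1, hlogN.1]
    exact hδ ▸ sq_mul_le_div_confidence_sq (by linarith)
  · have h1 : L * (n / L) ≤ n := Nat.mul_div_le n L
    calc (L * (n / L) - 1) * τ ≤ (t / τ) * τ := Nat.mul_le_mul_right τ (by omega)
      _ ≤ t := Nat.div_mul_le_self t τ

end RumemParameters

section Huber

variable {m : ℕ} {𝒟 : Fin m → Measure ℝ} {Q : ℕ → Fin m → Measure ℝ} {ε : ℝ}

/-- The reward law under Huber contamination. -/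
noncomputable def huberLaw (ε : ℝ) (𝒟 : Fin m → Measure ℝ) (Q : ℕ → Fin m → Measure ℝ) (k : ℕ)
    (x : Fin m) : Measure ℝ :=
  ENNReal.ofReal (1 - ε) • 𝒟 x + ENNReal.ofReal ε • Q k x

lemma isProbabilityMeasure_huberLaw (h𝒟 : ∀ x, IsProbabilityMeasure (𝒟 x))
    (hQ : ∀ k x, IsProbabilityMeasure (Q k x)) (hε : 0 ≤ ε) (hε1 : ε ≤ 1) (k : ℕ) (x : Fin m) :
    IsProbabilityMeasure (huberLaw ε 𝒟 Q k x) := by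
  refine ⟨?_⟩
  rw [huberLaw, Measure.add_apply, Measure.smul_apply, Measure.smul_apply, measure_univ,
    measure_univ, smul_eq_mul, smul_eq_mul, mul_one, mul_one,
    ← ENNReal.ofReal_add (by linarith) hε]
  simp

lemma integral_huberLaw_le (h𝒟 : ∀ x, IsProbabilityMeasure (𝒟 x))
    (hQ : ∀ k x, IsProbabilityMeasure (Q k x)) (hε : 0 ≤ ε) (hε1 : ε ≤ 1) (k : ℕ) (x : Fin m)
    (f : ℝ → ℝ) (hf : Measurable f) (hf0 : ∀ ρ, 0 ≤ f ρ) (hf1 : ∀ ρ, f ρ ≤ 1) :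
    ∫ ρ, f ρ ∂huberLaw ε 𝒟 Q k x ≤ ε + ∫ ρ, f ρ ∂𝒟 x := by
  have hb : ∃ C, ∀ ρ, |f ρ| ≤ C := ⟨1, fun ρ => by rw [abs_of_nonneg (hf0 ρ)]; exact hf1 ρ⟩
  have i1 : Integrable f (𝒟 x) := integrable_of_measurable_of_bounded hf hb
  have i2 : Integrable f (Q k x) := integrable_of_measurable_of_bounded hf hb
  rw [huberLaw, integral_add_measure (i1.smul_measure ENNReal.ofReal_ne_top)
    (i2.smul_measure ENNReal.ofReal_ne_top), integral_smul_measure, integral_smul_measure,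
    ENNReal.toReal_ofReal (by linarith), ENNReal.toReal_ofReal hε, smul_eq_mul, smul_eq_mul]
  have h1 : 0 ≤ ∫ ρ, f ρ ∂𝒟 x := integral_nonneg hf0
  have h2 : ∫ ρ, f ρ ∂Q k x ≤ 1 := by
    calc ∫ ρ, f ρ ∂Q k x ≤ ∫ _, (1 : ℝ) ∂Q k x := integral_mono i2 (integrable_const _) hf1
      _ = 1 := by simp
  nlinarith

end Huber

section RumemVector

variable {m K : ℕ} {π : Fin m → ℝ} {Φ : Matrix (Fin m) (Fin K) ℝ} {R' : Fin m → ℝ} {rbar ρ : ℝ}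
  {𝒟 : Fin m → Measure ℝ}

lemma sqNorm_eq_sum (v : Fin K → ℝ) : sqNorm v = ∑ i, v i ^ 2 := by
  simp [sqNorm, dotProduct, sq]

lemma sqNorm_nonneg (v : Fin K → ℝ) : 0 ≤ sqNorm v := by
  rw [sqNorm_eq_sum]
  exact Finset.sum_nonneg fun i _ => sq_nonneg _

lemma sq_sum_weight_mul_le {ι : Type*} [Fintype ι] {w : ι → ℝ} (hw : ∀ x, 0 ≤ w x)
    (hw1 : ∑ x, w x = 1) (f : ι → ℝ) : (∑ x, w x * f x) ^ 2 ≤ ∑ x, w x * f x ^ 2 := by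
  have h1 : 0 ≤ ∑ x, w x * (f x - ∑ y, w y * f y) ^ 2 :=
    Finset.sum_nonneg fun x _ => mul_nonneg (hw x) (sq_nonneg _)
  have h2 : ∑ x, w x * (f x - ∑ y, w y * f y) ^ 2
      = ∑ x, w x * f x ^ 2 - 2 * (∑ y, w y * f y) * (∑ x, w x * f x)
        + (∑ x, w x) * (∑ y, w y * f y) ^ 2 := by
    rw [Finset.mul_sum, Finset.sum_mul, ← Finset.sum_sub_distrib, ← Finset.sum_add_distrib]
    exact Finset.sum_congr rfl fun x _ => by ring
  rw [h2, hw1] at h1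
  nlinarith

lemma sum_weight_sq_le_one (hπ : ∀ x, 0 < π x) (hπ1 : ∑ x, π x = 1)
    (hΦ : ∀ x, Φ x ⬝ᵥ Φ x ≤ 1) : ∑ i, ∑ x, π x * Φ x i ^ 2 ≤ 1 := by
  rw [Finset.sum_comm]
  calc ∑ x, ∑ i, π x * Φ x i ^ 2 ≤ ∑ x, π x * 1 := Finset.sum_le_sum fun x _ => by
        rw [← Finset.mul_sum]
        refine mul_le_mul_of_nonneg_left ?_ (hπ x).le
        have := hΦ x
        simpa [dotProduct, sq] using this
    _ = 1 := by simpa using hπ1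

lemma sum_weight_sq_pos (hπ : ∀ x, 0 < π x) (hinj : Function.Injective Φ.mulVec) (i : Fin K) :
    0 < ∑ x, π x * Φ x i ^ 2 := by
  refine (Finset.sum_nonneg fun x _ => mul_nonneg (hπ x).le (sq_nonneg _)).lt_of_ne' fun h0 => ?_
  have h1 : ∀ x, Φ x i = 0 := fun x => by
    have := (Finset.sum_eq_zero_iff_of_nonneg fun x _ =>
      mul_nonneg (hπ x).le (sq_nonneg (Φ x i))).1 h0 x (Finset.mem_univ x)
    simpa [(hπ x).ne'] using this
  have h2 : Pi.single i (1 : ℝ) = 0 := hinj (by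
    ext x
    simp [h1])
  simpa using congrFun h2 i

lemma sqNorm_mean_le (hπ : ∀ x, 0 < π x) (hπ1 : ∑ x, π x = 1) (hΦ : ∀ x, Φ x ⬝ᵥ Φ x ≤ 1)
    (hrbar : ∀ x, |R' x| ≤ rbar) :
    sqNorm (fun i => ∑ x, π x * Φ x i * R' x) ≤ rbar ^ 2 := by
  rw [sqNorm_eq_sum]
  calc ∑ i, (∑ x, π x * Φ x i * R' x) ^ 2 ≤ ∑ i, (∑ x, π x * Φ x i ^ 2) * rbar ^ 2 := by
        refine Finset.sum_le_sum fun i _ => ?_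
        simp_rw [mul_assoc]
        refine (sq_sum_weight_mul_le (fun x => (hπ x).le) hπ1 fun x => Φ x i * R' x).trans ?_
        rw [Finset.sum_mul]
        refine Finset.sum_le_sum fun x _ => ?_
        rw [mul_assoc, mul_pow]
        exact mul_le_mul_of_nonneg_left (mul_le_mul_of_nonneg_left
          (sq_le_sq' (abs_le.1 (hrbar x)).1 (abs_le.1 (hrbar x)).2) (sq_nonneg _)) (hπ x).le
    _ = (∑ i, ∑ x, π x * Φ x i ^ 2) * rbar ^ 2 := by rw [Finset.sum_mul]
    _ ≤ rbar ^ 2 := mul_le_of_le_one_left (sq_nonneg _) (sum_weight_sq_le_one hπ hπ1 hΦ)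

/-- The stationary second moment of the centred samples of one coordinate. -/
lemma sum_weight_variance_le (hπ : ∀ x, 0 < π x) (hπ1 : ∑ x, π x = 1)
    (h𝒟 : ∀ x, IsProbabilityMeasure (𝒟 x))
    (h1 : ∀ x, Integrable (fun y => y) (𝒟 x)) (h2 : ∀ x, Integrable (fun y => y ^ 2) (𝒟 x))
    (hR : ∀ x, ∫ y, y ∂𝒟 x = R' x) (hvar : ∀ x, ∫ y, (y - R' x) ^ 2 ∂𝒟 x ≤ ρ ^ 2)
    (hrbar : ∀ x, |R' x| ≤ rbar) {σ₁ : ℝ} (hσr : rbar ≤ σ₁) (hσρ : ρ ≤ σ₁) (hρ : 0 < ρ)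
    (c : Fin m → ℝ) {mu : ℝ} (hmu : ∑ x, π x * (c x * R' x) = mu) :
    ∑ x, π x * ∫ y, (c x * y - mu) ^ 2 ∂𝒟 x ≤ 2 * σ₁ ^ 2 * ∑ x, π x * c x ^ 2 := by
  have hquad : ∀ x (a b : ℝ), ∫ y, (a * y - b) ^ 2 ∂𝒟 x
      = a ^ 2 * (∫ y, y ^ 2 ∂𝒟 x) - 2 * a * b * R' x + b ^ 2 := fun x a b => by
    have e : (fun y : ℝ => (a * y - b) ^ 2) = fun y => (a ^ 2 * y ^ 2 - 2 * a * b * y) + b ^ 2 := by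
      ext y; ring
    have i1 : Integrable (fun y : ℝ => a ^ 2 * y ^ 2 - 2 * a * b * y) (𝒟 x) :=
      ((h2 x).const_mul _).sub ((h1 x).const_mul _)
    rw [e, integral_add i1 (integrable_const _), integral_sub ((h2 x).const_mul _)
      ((h1 x).const_mul _), integral_const_mul, integral_const_mul, hR]
    simp
  have hE2 : ∀ x, ∫ y, y ^ 2 ∂𝒟 x ≤ 2 * σ₁ ^ 2 := fun x => by
    have h3 := hvar x
    have h4 := hquad x 1 (R' x)
    simp only [one_mul] at h4
    have h5 : R' x ^ 2 ≤ rbar ^ 2 := sq_le_sq' (abs_le.1 (hrbar x)).1 (abs_le.1 (hrbar x)).2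
    have h6 : rbar ^ 2 ≤ σ₁ ^ 2 := pow_le_pow_left₀ ((abs_nonneg _).trans (hrbar x)) hσr 2
    have h7 : ρ ^ 2 ≤ σ₁ ^ 2 := pow_le_pow_left₀ hρ.le hσρ 2
    nlinarith
  have e : ∀ x, π x * ∫ y, (c x * y - mu) ^ 2 ∂𝒟 x = π x * c x ^ 2 * (∫ y, y ^ 2 ∂𝒟 x)
      - 2 * mu * (π x * (c x * R' x)) + mu ^ 2 * π x := fun x => by
    rw [hquad]; ring
  rw [Finset.sum_congr rfl fun x _ => e x, Finset.sum_add_distrib, Finset.sum_sub_distrib,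
    ← Finset.mul_sum, ← Finset.mul_sum, hmu, hπ1, Finset.mul_sum]
  have h3 : ∑ x, π x * c x ^ 2 * (∫ y, y ^ 2 ∂𝒟 x) ≤ ∑ x, 2 * σ₁ ^ 2 * (π x * c x ^ 2) :=
    Finset.sum_le_sum fun x _ => (mul_le_mul_of_nonneg_left (hE2 x)
      (mul_nonneg (hπ x).le (sq_nonneg _))).trans_eq (mul_comm _ _)
  nlinarith [sq_nonneg mu]

variable {Ω : Type*} {mΩ : MeasurableSpace Ω} {Pr : Measure Ω} [IsProbabilityMeasure Pr]
  {s : ℕ → Ω → Fin m} {r : ℕ → Ω → ℝ} {P : Matrix (Fin m) (Fin m) ℝ}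
  {Q : ℕ → Fin m → Measure ℝ} {F : Filtration ℕ mΩ} {ε : ℝ}

/-- High-probability error bound for the vector of coordinatewise RUMEM estimates. -/
lemma exists_rumem_fail {T t : ℕ} (h : IsRewardChain F s r P (huberLaw ε 𝒟 Q) Pr)
    (hK : 1 ≤ K) (hT : 2 ≤ T) (hP : ∀ x y, 0 ≤ P x y) (hP1 : ∀ x, ∑ y, P x y = 1)
    (herg : ∃ k : ℕ, ∀ x y, 0 < (P ^ k) x y) (hπ : ∀ x, 0 < π x) (hπ1 : ∑ x, π x = 1)
    (hst : π ᵥ* P = π) (hinj : Function.Injective Φ.mulVec) (hΦ : ∀ x, Φ x ⬝ᵥ Φ x ≤ 1)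
    (hρ : 0 < ρ) (hrbar : ∀ x, |R' x| ≤ rbar) (h𝒟 : ∀ x, IsProbabilityMeasure (𝒟 x))
    (h1 : ∀ x, Integrable (fun y => y) (𝒟 x)) (h2 : ∀ x, Integrable (fun y => y ^ 2) (𝒟 x))
    (hR : ∀ x, ∫ y, y ∂𝒟 x = R' x) (hvar : ∀ x, ∫ y, (y - R' x) ^ 2 ∂𝒟 x ≤ ρ ^ 2)
    (hε : 0 ≤ ε) (hε1 : ε ≤ 1 / 192) (hQ : ∀ k x, IsProbabilityMeasure (Q k x)) {σ₁ : ℝ}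
    (hσ1 : 1 ≤ σ₁) (hσr : rbar ≤ σ₁) (hσρ : ρ ≤ σ₁) (htT : t + 1 ≤ T)
    (hburn : 70000 * tmixMat P π * Real.log (K * T : ℝ) ^ 2 ≤ t) {b : Ω → Fin K → ℝ}
    (hb : ∀ ω i, IsRumemOutput (tmixMat P π) (t + 1) (1 / (K * T ^ 2 : ℝ)) ε
        (fun k => Φ (s k ω) i * r k ω) (b ω i)) :
    ∃ S : Set Ω, MeasurableSet[F t] S ∧ Pr.real S ≤ 3 / (K * t) ∧
      ∀ ω ∉ S, sqNorm (b ω - fun i => ∑ x, π x * Φ x i * R' x) ≤ 1600 * σ₁ ^ 2 *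
        (12 * ε + 330 * (Real.log (12 * K * T ^ 3 : ℝ) ^ 2 * tmixMat P π / t)) := by
  have htmix := (tmixMat_spec hP hP1 herg hπ hπ1 hst).1
  generalize hδdef : (1 / (K * T ^ 2 : ℝ)) = δ at hb
  generalize hτdef : rumemTau (tmixMat P π) (t + 1) δ = τ
  generalize hndef : rumemn (tmixMat P π) (t + 1) δ = n
  generalize hLdef : rumemL (tmixMat P π) (t + 1) δ ε = L
  obtain ⟨ht100, hτ, hL, hLn, hLε, hLn2, hMη, hpow, hidx⟩ := rumem_parameters htmix hK hT htT hε
    hε1 hburn hδdef.symm hτdef.symm hndef.symm hLdef.symm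
  have hNδ : 100 ≤ ((t + 1 : ℕ) : ℝ) / δ := hδdef ▸ hundred_le_div_confidence hK hT ht100
  have hσ0 : 0 < σ₁ := by linarith
  have hK0 : (0 : ℝ) < K := by exact_mod_cast (by omega : 0 < K)
  have ht0 : (0 : ℝ) < t := by exact_mod_cast (by omega : 0 < t)
  have hL0 : (0 : ℝ) < L := by exact_mod_cast (by omega : 0 < L)
  have hn0 : (0 : ℝ) < n := by exact_mod_cast (by omega : 0 < n)
  set p : Fin K → ℝ := fun i => ∑ x, π x * Φ x i ^ 2 with hp
  have hp0 : ∀ i, 0 < p i := fun i => sum_weight_sq_pos hπ hinj i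
  set err : Fin K → ℝ := fun i => Real.sqrt (800 * (2 * σ₁ ^ 2 * p i) * (L / n)) with herr
  have herr2 : ∀ i, err i ^ 2 = 800 * (2 * σ₁ ^ 2 * p i) * (L / n) := fun i =>
    Real.sq_sqrt (by have := hp0 i; positivity)
  set mu : Fin K → ℝ := fun i => ∑ x, π x * Φ x i * R' x with hmudef
  set S : Fin K → Set Ω := fun i =>
    majorityFail s r (fun x => Φ x i) (mu i) (err i) τ (n / L) L with hS
  have hSm : ∀ i, MeasurableSet[F t] (S i) := fun i =>
    h.measurableSet_majorityFail _ _ _ _ _ _ _ hidx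
  have hSp : ∀ i, Pr.real (S i) ≤ 3 / (K ^ 2 * t) := fun i => by
    have hmu : ∑ x, π x * (Φ x i * R' x) = mu i :=
      Finset.sum_congr rfl fun x _ => by ring
    refine (measureReal_majorityFail_le (V := 2 * σ₁ ^ 2 * p i) (η := (((t + 1 : ℕ) : ℝ) / δ)⁻¹)
      h (isProbabilityMeasure_huberLaw h𝒟 hQ hε (by linarith)) h𝒟 h1 h2 hR
      (integral_huberLaw_le h𝒟 hQ hε (by linarith)) hP hP1 hε (fun x => (hπ x).le) hπ1 hst hτ
      (fun k x => ?_) hmu ?_ ?_ hL hLn hLε rfl hMη ?_ ?_ (Real.sqrt_nonneg _) (herr2 i)).trans hpow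
    · refine rowDist_rumemTau_le hP hP1 herg hπ hπ1 hst (by linarith) ?_ x
      rw [hτdef]
      exact Nat.le_mul_of_pos_left τ (Nat.succ_pos k)
    · exact inv_nonneg.2 (by linarith)
    · rw [one_div]
      exact inv_anti₀ (by norm_num) hNδ
    · have := hp0 i; positivity
    · exact sum_weight_variance_le hπ hπ1 h𝒟 h1 h2 hR hvar hrbar hσr hσρ hρ _ hmu
  refine ⟨⋃ i, S i, MeasurableSet.iUnion hSm, ?_, fun ω hω => ?_⟩
  · calc Pr.real (⋃ i, S i) ≤ ∑ i, Pr.real (S i) := measureReal_iUnion_fintype_le S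
      _ ≤ ∑ _i : Fin K, 3 / (K ^ 2 * t : ℝ) := Finset.sum_le_sum fun i _ => hSp i
      _ = 3 / (K * t) := by
        rw [Finset.sum_const, Finset.card_univ, Fintype.card_fin, nsmul_eq_mul]
        field_simp
  · have hcoord : ∀ i, |b ω i - mu i| ≤ err i := fun i => by
      have hbi := hb ω i
      rw [IsRumemOutput, hLdef, hτdef, hndef] at hbi
      exact abs_sub_le_of_isMedianOf hbi fun hc => hω (Set.mem_iUnion.2 ⟨i, hc⟩)
    rw [sqNorm_eq_sum]
    calc ∑ i, (b ω - mu) i ^ 2 ≤ ∑ i, err i ^ 2 := Finset.sum_le_sum fun i _ =>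
          sq_le_sq' (abs_le.1 (hcoord i)).1 (abs_le.1 (hcoord i)).2
      _ = 1600 * σ₁ ^ 2 * (L / n) * ∑ i, p i := by
        rw [Finset.mul_sum]
        exact Finset.sum_congr rfl fun i _ => by rw [herr2]; ring
      _ ≤ 1600 * σ₁ ^ 2 * (L / n) :=
        mul_le_of_le_one_right (by positivity) (sum_weight_sq_le_one hπ hπ1 hΦ)
      _ ≤ _ := mul_le_mul_of_nonneg_left hLn2 (by positivity)

end RumemVector

lemma sqNorm_eq_norm_sq {K : ℕ} (v : Fin K → ℝ) :
    sqNorm v = ‖(WithLp.toLp 2 v : EuclideanSpace ℝ (Fin K))‖ ^ 2 := by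
  rw [sqNorm_eq_sum, EuclideanSpace.norm_sq_eq]
  simp

lemma sqrt_sqNorm {K : ℕ} (v : Fin K → ℝ) :
    Real.sqrt (sqNorm v) = ‖(WithLp.toLp 2 v : EuclideanSpace ℝ (Fin K))‖ := by
  rw [sqNorm_eq_norm_sq, Real.sqrt_sq (norm_nonneg _)]

/-- The error of the thresholded estimate, with the threshold `G + σ₁`, in terms of the error of
the raw estimate. -/
lemma sqNorm_threshold_sub_le {K : ℕ} {b b' bbar : Fin K → ℝ} {G σ₁ : ℝ} (hσ : 0 ≤ σ₁)
    (hG : 0 ≤ G) (hb' : b' = if G + σ₁ < Real.sqrt (sqNorm b) then 0 else b)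
    (hbbar : sqNorm bbar ≤ σ₁ ^ 2) :
    sqNorm (b' - bbar) ≤ (G + 2 * σ₁) ^ 2 ∧
      (sqNorm (b - bbar) ≤ G ^ 2 → b' = b) := by
  rw [sqNorm_eq_norm_sq, sqNorm_eq_norm_sq, WithLp.toLp_sub, WithLp.toLp_sub]
  rw [sqNorm_eq_norm_sq] at hbbar
  rw [sqrt_sqNorm] at hb'
  have h1 := abs_le_of_sq_le_sq' hbbar hσ
  refine ⟨pow_le_pow_left₀ (norm_nonneg _) ((norm_sub_le _ _).trans ?_) 2, fun h2 => ?_⟩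
  · have h3 : ‖(WithLp.toLp 2 b' : EuclideanSpace ℝ (Fin K))‖ ≤ G + σ₁ := by
      rw [hb']
      split_ifs with hc
      · simp; linarith
      · exact not_lt.1 hc
    linarith [h1.2]
  · rw [hb', if_neg]
    have h3 := abs_le_of_sq_le_sq' h2 hG
    have h4 := norm_sub_norm_le (WithLp.toLp 2 b : EuclideanSpace ℝ (Fin K)) (WithLp.toLp 2 bbar)
    rw [not_lt]
    linarith [h1.2, h3.2]

section Threshold

variable {K : ℕ} {ε Λ tm t σ₁ p : ℝ}

lemma threshold_sq_bounds (hK : 1 ≤ K) (hε : 0 ≤ ε) (hΛ : 0 ≤ Λ) (htm : 0 ≤ tm) (ht : 0 < t) :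
    1600 * σ₁ ^ 2 * (12 * ε + 330 * (Λ ^ 2 * tm / t))
      ≤ (400 * Real.sqrt K * σ₁ * (Real.sqrt ε + 2 * Λ * Real.sqrt (tm / t))) ^ 2 ∧
    (400 * Real.sqrt K * σ₁ * (Real.sqrt ε + 2 * Λ * Real.sqrt (tm / t))) ^ 2
      ≤ 320000 * K * σ₁ ^ 2 * (ε + 4 * (Λ ^ 2 * tm / t)) := by
  have hK1 : (1 : ℝ) ≤ K := by exact_mod_cast hK
  have h1 : Real.sqrt K ^ 2 = K := Real.sq_sqrt (by linarith)
  have h2 : Real.sqrt ε ^ 2 = ε := Real.sq_sqrt hε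
  have h3 : (2 * Λ * Real.sqrt (tm / t)) ^ 2 = 4 * (Λ ^ 2 * tm / t) := by
    rw [mul_pow, Real.sq_sqrt (by positivity)]; ring
  have h4 : 0 ≤ Λ ^ 2 * tm / t := by positivity
  have e : (400 * Real.sqrt K * σ₁ * (Real.sqrt ε + 2 * Λ * Real.sqrt (tm / t))) ^ 2
      = 160000 * K * σ₁ ^ 2 * (Real.sqrt ε + 2 * Λ * Real.sqrt (tm / t)) ^ 2 := by
    rw [mul_pow, mul_pow, mul_pow, h1]; norm_num
  rw [e]
  constructor
  · calc 1600 * σ₁ ^ 2 * (12 * ε + 330 * (Λ ^ 2 * tm / t))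
        ≤ 1600 * σ₁ ^ 2 * (100 * (ε + 4 * (Λ ^ 2 * tm / t))) := by gcongr; linarith
      _ ≤ (K : ℝ) * (1600 * σ₁ ^ 2 * (100 * (ε + 4 * (Λ ^ 2 * tm / t)))) :=
        le_mul_of_one_le_left (by positivity) hK1
      _ = 160000 * K * σ₁ ^ 2 * (Real.sqrt ε ^ 2 + (2 * Λ * Real.sqrt (tm / t)) ^ 2) := by
        rw [h2, h3]; ring
      _ ≤ 160000 * K * σ₁ ^ 2 * (Real.sqrt ε + 2 * Λ * Real.sqrt (tm / t)) ^ 2 := by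
        refine mul_le_mul_of_nonneg_left ?_ (by positivity)
        have : 0 ≤ Real.sqrt ε * (2 * Λ * Real.sqrt (tm / t)) := by positivity
        nlinarith
  · calc 160000 * K * σ₁ ^ 2 * (Real.sqrt ε + 2 * Λ * Real.sqrt (tm / t)) ^ 2
        ≤ 160000 * K * σ₁ ^ 2 * (2 * (Real.sqrt ε ^ 2 + (2 * Λ * Real.sqrt (tm / t)) ^ 2)) :=
          mul_le_mul_of_nonneg_left (add_sq_le) (by positivity)
      _ = _ := by rw [h2, h3]; ring

lemma threshold_failure_le (hK : 1 ≤ K) (hε : 0 ≤ ε) (hε1 : ε ≤ 1 / 192) (hΛ : 4 ≤ Λ)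
    (htm : 1 ≤ tm) (ht : 0 < t) (hx : Λ ^ 2 * tm / t ≤ 1 / 1000)
    (hp : p ≤ 3 / (K * t)) :
    1600 * σ₁ ^ 2 * (12 * ε + 330 * (Λ ^ 2 * tm / t)) +
      (400 * Real.sqrt K * σ₁ * (Real.sqrt ε + 2 * Λ * Real.sqrt (tm / t)) + 2 * σ₁) ^ 2 * p
    ≤ 530000 * σ₁ ^ 2 * (ε + Λ ^ 2 * tm / t) := by
  have hK1 : (1 : ℝ) ≤ K := by exact_mod_cast hK
  obtain ⟨-, h1⟩ := threshold_sq_bounds (K := K) (σ₁ := σ₁) hK hε (by linarith : 0 ≤ Λ)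
    (by linarith : 0 ≤ tm) ht
  set G := 400 * Real.sqrt K * σ₁ * (Real.sqrt ε + 2 * Λ * Real.sqrt (tm / t)) with hG
  have hx' : 16 / t ≤ Λ ^ 2 * tm / t := by
    gcongr
    nlinarith
  set x := Λ ^ 2 * tm / t with hxdef
  have h2 : (G + 2 * σ₁) ^ 2 ≤ 6400 * K * σ₁ ^ 2 := by
    have h3 : 320000 * K * σ₁ ^ 2 * (ε + 4 * x) ≤ 320000 * K * σ₁ ^ 2 * (1 / 100) := by
      gcongr; linarith
    have h4 : σ₁ ^ 2 ≤ K * σ₁ ^ 2 := le_mul_of_one_le_left (sq_nonneg _) hK1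
    nlinarith [sq_nonneg (G - 2 * σ₁), sq_nonneg σ₁]
  have h5 : (G + 2 * σ₁) ^ 2 * p ≤ 1200 * σ₁ ^ 2 * x := by
    calc (G + 2 * σ₁) ^ 2 * p ≤ (G + 2 * σ₁) ^ 2 * (3 / (K * t)) :=
          mul_le_mul_of_nonneg_left hp (sq_nonneg _)
      _ ≤ 6400 * K * σ₁ ^ 2 * (3 / (K * t)) := by gcongr
      _ = 1200 * σ₁ ^ 2 * (16 / t) := by field_simp; ring
      _ ≤ _ := by gcongr
  nlinarith [mul_nonneg (sq_nonneg σ₁) hε, mul_nonneg (sq_nonneg σ₁) ((by positivity : (0:ℝ) ≤ 16 / t).trans hx')]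

end Threshold

section TemporalDifference

variable {m K : ℕ} {P : Matrix (Fin m) (Fin m) ℝ} {π : Fin m → ℝ}
  {Φ : Matrix (Fin m) (Fin K) ℝ} {γ α : ℝ} {Abar : Matrix (Fin K) (Fin K) ℝ}

/-- The TD random matrix as an operator on Euclidean space. -/
noncomputable def tdOp (Φ : Matrix (Fin m) (Fin K) ℝ) (γ : ℝ) (u v : Fin m) :
    EuclideanSpace ℝ (Fin K) →L[ℝ] EuclideanSpace ℝ (Fin K) :=
  Matrix.toEuclideanCLM (𝕜 := ℝ) (tdMat Φ γ u v)

/-- The feature vector of a state. -/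
noncomputable def feature (Φ : Matrix (Fin m) (Fin K) ℝ) (u : Fin m) : EuclideanSpace ℝ (Fin K) :=
  WithLp.toLp 2 (Φ u)

lemma norm_feature_le (hΦ : ∀ x, Φ x ⬝ᵥ Φ x ≤ 1) (u : Fin m) : ‖feature Φ u‖ ≤ 1 := by
  have h : ‖feature Φ u‖ ^ 2 ≤ 1 := by
    rw [feature, ← sqNorm_eq_norm_sq]; exact hΦ u
  exact (sq_le_one_iff₀ (norm_nonneg _)).1 h

lemma inner_feature (u : Fin m) (v : EuclideanSpace ℝ (Fin K)) :
    inner ℝ (feature Φ u) v = Φ u ⬝ᵥ v.ofLp := by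
  simp [feature, PiLp.inner_apply, dotProduct, mul_comm]

lemma tdOp_apply (u v : Fin m) (x : EuclideanSpace ℝ (Fin K)) :
    tdOp Φ γ u v x
      = (γ * inner ℝ (feature Φ v) x - inner ℝ (feature Φ u) x) • feature Φ u := by
  ext i
  simp only [inner_feature]
  simp only [tdOp, Matrix.ofLp_toEuclideanCLM, feature, tdMat, mulVec, dotProduct,
    Matrix.of_apply, PiLp.smul_apply, smul_eq_mul, sub_mul, Finset.mul_sum, Finset.sum_mul,
    Finset.sum_sub_distrib]
  congr 1 <;> exact Finset.sum_congr rfl fun j _ => by ring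

lemma norm_tdOp_le (hΦ : ∀ x, Φ x ⬝ᵥ Φ x ≤ 1) (hγ0 : 0 < γ) (hγ1 : γ < 1) (u v : Fin m) :
    ‖tdOp Φ γ u v‖ ≤ 2 := by
  refine ContinuousLinearMap.opNorm_le_bound _ zero_le_two fun x => ?_
  have hin : ∀ u, |inner ℝ (feature Φ u) x| ≤ ‖x‖ := fun u =>
    (abs_real_inner_le_norm _ _).trans
      (mul_le_of_le_one_left (norm_nonneg _) (norm_feature_le hΦ u))
  rw [tdOp_apply, norm_smul, Real.norm_eq_abs]
  have h1 : |γ * inner ℝ (feature Φ v) x - inner ℝ (feature Φ u) x| ≤ 2 * ‖x‖ := by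
    refine (abs_sub _ _).trans ?_
    rw [abs_mul, abs_of_pos hγ0]
    have h2 := hin u
    have h3 := hin v
    have h4 := abs_nonneg (inner ℝ (feature Φ v) x)
    nlinarith
  exact (mul_le_of_le_one_right (abs_nonneg _) (norm_feature_le hΦ u)).trans h1

lemma condTdMat_eq (hP1 : ∀ x, ∑ y, P x y = 1) (k : ℕ) (x : Fin m) :
    condTdMat P Φ γ k x = ∑ u, ∑ v, ((P ^ k) x u * P u v) • tdMat Φ γ u v := by
  ext i j
  simp only [condTdMat, tdMat, Matrix.of_apply, Matrix.sum_apply, Matrix.smul_apply, smul_eq_mul]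
  refine Finset.sum_congr rfl fun u _ => ?_
  have h : ∑ v, (P ^ k) x u * P u v * (γ * Φ u i * Φ v j - Φ u i * Φ u j)
      = (P ^ k) x u * (γ * Φ u i * (∑ v, P u v * Φ v j) - Φ u i * Φ u j * ∑ v, P u v) := by
    rw [Finset.mul_sum, Finset.mul_sum, ← Finset.sum_sub_distrib, Finset.mul_sum]
    exact Finset.sum_congr rfl fun v _ => by ring
  rw [h, hP1, mul_one]

lemma meanTdMat_eq (hP1 : ∀ x, ∑ y, P x y = 1)
    (hAbar : Abar = Φᵀ * Matrix.diagonal π * (γ • P - 1) * Φ) :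
    Abar = ∑ u, ∑ v, (π u * P u v) • tdMat Φ γ u v := by
  have h1 : Abar = Φᵀ * (Matrix.diagonal π * (γ • (P * Φ) - Φ)) := by
    rw [hAbar]
    simp only [Matrix.mul_assoc, Matrix.sub_mul, Matrix.smul_mul, Matrix.one_mul]
  rw [h1]
  ext i j
  rw [Matrix.mul_apply]
  simp only [Matrix.diagonal_mul]
  simp only [tdMat, Matrix.of_apply, Matrix.sum_apply, Matrix.smul_apply, smul_eq_mul,
    Matrix.sub_apply, Matrix.transpose_apply, Matrix.mul_apply]
  refine Finset.sum_congr rfl fun u _ => ?_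
  have h : ∑ v, π u * P u v * (γ * Φ u i * Φ v j - Φ u i * Φ u j)
      = π u * (γ * Φ u i * (∑ v, P u v * Φ v j) - Φ u i * Φ u j * ∑ v, P u v) := by
    rw [Finset.mul_sum, Finset.mul_sum, ← Finset.sum_sub_distrib, Finset.mul_sum]
    exact Finset.sum_congr rfl fun v _ => by ring
  rw [h, hP1, mul_one]
  ring

lemma toEuclideanCLM_condTdMat (hP1 : ∀ x, ∑ y, P x y = 1) (k : ℕ) (x : Fin m) :
    Matrix.toEuclideanCLM (𝕜 := ℝ) (condTdMat P Φ γ k x)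
      = ∑ u, ∑ v, ((P ^ k) x u * P u v) • tdOp Φ γ u v := by
  simp only [condTdMat_eq hP1, map_sum, map_smul, tdOp]

lemma toEuclideanCLM_meanTdMat (hP1 : ∀ x, ∑ y, P x y = 1)
    (hAbar : Abar = Φᵀ * Matrix.diagonal π * (γ • P - 1) * Φ) :
    Matrix.toEuclideanCLM (𝕜 := ℝ) Abar = ∑ u, ∑ v, (π u * P u v) • tdOp Φ γ u v := by
  rw [meanTdMat_eq hP1 hAbar]
  simp only [map_sum, map_smul, tdOp]

lemma norm_sum_sum_smul_tdOp_le (hP : ∀ x y, 0 ≤ P x y) (hP1 : ∀ x, ∑ y, P x y = 1)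
    (hΦ : ∀ x, Φ x ⬝ᵥ Φ x ≤ 1) (hγ0 : 0 < γ) (hγ1 : γ < 1) (c : Fin m → ℝ) :
    ‖∑ u, ∑ v, (c u * P u v) • tdOp Φ γ u v‖ ≤ 2 * ∑ u, |c u| := by
  rw [Finset.mul_sum]
  refine (norm_sum_le _ _).trans (Finset.sum_le_sum fun u _ => (norm_sum_le _ _).trans ?_)
  have h : ∀ v ∈ Finset.univ, ‖(c u * P u v) • tdOp Φ γ u v‖ ≤ 2 * |c u| * P u v := fun v _ => by
    rw [norm_smul, Real.norm_eq_abs, abs_mul, abs_of_nonneg (hP u v)]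
    have := mul_le_mul_of_nonneg_left (norm_tdOp_le hΦ hγ0 hγ1 u v)
      (mul_nonneg (abs_nonneg (c u)) (hP u v))
    linarith
  refine (Finset.sum_le_sum h).trans_eq ?_
  rw [← Finset.mul_sum, hP1, mul_one]

lemma norm_toEuclideanCLM_meanTdMat_le (hP : ∀ x y, 0 ≤ P x y) (hP1 : ∀ x, ∑ y, P x y = 1)
    (hπ : ∀ x, 0 < π x) (hπ1 : ∑ x, π x = 1)
    (hΦ : ∀ x, Φ x ⬝ᵥ Φ x ≤ 1) (hγ0 : 0 < γ) (hγ1 : γ < 1)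
    (hAbar : Abar = Φᵀ * Matrix.diagonal π * (γ • P - 1) * Φ) :
    ‖Matrix.toEuclideanCLM (𝕜 := ℝ) Abar‖ ≤ 2 := by
  rw [toEuclideanCLM_meanTdMat hP1 hAbar]
  refine (norm_sum_sum_smul_tdOp_le hP hP1 hΦ hγ0 hγ1 π).trans_eq ?_
  simp_rw [abs_of_pos (hπ _)]
  rw [hπ1, mul_one]

lemma tdMixTime_spec (hP : ∀ x y, 0 ≤ P x y) (hP1 : ∀ x, ∑ y, P x y = 1)
    (herg : ∃ k : ℕ, ∀ x y, 0 < (P ^ k) x y)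
    (hπ : ∀ x, 0 < π x) (hπ1 : ∑ x, π x = 1) (hst : Matrix.vecMul π P = π)
    (hΦ : ∀ x, Φ x ⬝ᵥ Φ x ≤ 1) (hγ0 : 0 < γ) (hγ1 : γ < 1)
    (hAbar : Abar = Φᵀ * Matrix.diagonal π * (γ • P - 1) * Φ) (hα : 0 < α) :
    1 ≤ tdMixTime P Φ γ Abar α ∧
      ∀ x, ‖(∑ u, ∑ v, ((P ^ tdMixTime P Φ γ Abar α) x u * P u v) • tdOp Φ γ u v)
        - Matrix.toEuclideanCLM (𝕜 := ℝ) Abar‖ ≤ α := by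
  have hne : {t | 1 ≤ t ∧ ∀ k, t ≤ k → ∀ x,
      ‖Matrix.toEuclideanCLM (𝕜 := ℝ) (condTdMat P Φ γ k x) -
        Matrix.toEuclideanCLM (𝕜 := ℝ) Abar‖ ≤ α}.Nonempty := by
    obtain ⟨t, ht, h⟩ := exists_rowDist_le hP hP1 herg hπ hπ1 hst (half_pos hα)
    refine ⟨t, ht, fun k hk x => ?_⟩
    rw [toEuclideanCLM_condTdMat hP1, toEuclideanCLM_meanTdMat hP1 hAbar]
    have e : (∑ u, ∑ v, ((P ^ k) x u * P u v) • tdOp Φ γ u v)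
        - ∑ u, ∑ v, (π u * P u v) • tdOp Φ γ u v
        = ∑ u, ∑ v, (((P ^ k) x u - π u) * P u v) • tdOp Φ γ u v := by
      rw [← Finset.sum_sub_distrib]
      refine Finset.sum_congr rfl fun u _ => ?_
      rw [← Finset.sum_sub_distrib]
      exact Finset.sum_congr rfl fun v _ => by
        rw [sub_mul]; exact (sub_smul _ _ _).symm
    rw [e]
    refine (norm_sum_sum_smul_tdOp_le hP hP1 hΦ hγ0 hγ1 fun u => (P ^ k) x u - π u).trans ?_
    have := h k hk x
    rw [rowDist] at this
    linarith
  obtain ⟨h1, h2⟩ := Nat.sInf_mem hne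
  refine ⟨h1, fun x => ?_⟩
  rw [← toEuclideanCLM_condTdMat hP1]
  exact h2 _ le_rfl x

lemma featureCov_form (v : EuclideanSpace ℝ (Fin K)) :
    inner ℝ v (Matrix.toEuclideanCLM (𝕜 := ℝ) (Φᵀ * Matrix.diagonal π * Φ) v)
      = ∑ u, π u * inner ℝ (feature Φ u) v ^ 2 := by
  rw [Matrix.inner_toEuclideanCLM]
  have h : ∀ u, inner ℝ (feature Φ u) v = (Φ *ᵥ v.ofLp) u := fun u => inner_feature u v
  simp_rw [h]
  rw [← Matrix.mulVec_mulVec, ← Matrix.mulVec_mulVec, Matrix.dotProduct_mulVec,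
    Matrix.vecMul_transpose]
  simp only [dotProduct, Matrix.mulVec_diagonal]
  exact Finset.sum_congr rfl fun u _ => by ring

lemma iInf_eigenvalues_mul_le {S : Matrix (Fin K) (Fin K) ℝ} (hS : S.IsHermitian)
    (v : EuclideanSpace ℝ (Fin K)) :
    (⨅ i, hS.eigenvalues i) * ‖v‖ ^ 2 ≤ inner ℝ v (Matrix.toEuclideanCLM (𝕜 := ℝ) S v) := by
  have hsym : ∀ i, inner ℝ (hS.eigenvectorBasis i) (Matrix.toEuclideanCLM (𝕜 := ℝ) S v)
      = hS.eigenvalues i * inner ℝ (hS.eigenvectorBasis i) v := fun i => by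
    have hST : Sᵀ = S := by
      rw [← Matrix.conjTranspose_eq_transpose_of_trivial]; exact hS
    rw [Matrix.inner_toEuclideanCLM, Matrix.dotProduct_mulVec, ← Matrix.mulVec_transpose]
    simp only [hST, hS.mulVec_eigenvectorBasis]
    simp [PiLp.inner_apply, dotProduct, Finset.mul_sum, mul_comm, mul_left_comm]
  rw [← hS.eigenvectorBasis.sum_inner_mul_inner v (Matrix.toEuclideanCLM (𝕜 := ℝ) S v),
    ← real_inner_self_eq_norm_sq, ← hS.eigenvectorBasis.sum_inner_mul_inner v v, Finset.mul_sum]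
  refine Finset.sum_le_sum fun i _ => ?_
  rw [hsym, real_inner_comm]
  have h1 : (⨅ i, hS.eigenvalues i) ≤ hS.eigenvalues i :=
    ciInf_le (Set.finite_range _).bddBelow i
  have := mul_le_mul_of_nonneg_right h1 (mul_self_nonneg (inner ℝ (hS.eigenvectorBasis i) v))
  linarith

lemma inner_meanTdMat_le (hP : ∀ x y, 0 ≤ P x y) (hP1 : ∀ x, ∑ y, P x y = 1)
    (hπ : ∀ x, 0 < π x) (hst : Matrix.vecMul π P = π) (hγ0 : 0 < γ) (hγ1 : γ < 1)
    (hAbar : Abar = Φᵀ * Matrix.diagonal π * (γ • P - 1) * Φ)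
    (hHerm : (Φᵀ * Matrix.diagonal π * Φ).IsHermitian) (v : EuclideanSpace ℝ (Fin K)) :
    inner ℝ v (Matrix.toEuclideanCLM (𝕜 := ℝ) Abar v)
      ≤ -((⨅ i, hHerm.eigenvalues i) * (1 - γ)) * ‖v‖ ^ 2 := by
  set g : Fin m → ℝ := fun u => inner ℝ (feature Φ u) v with hg
  have hcov : (⨅ i, hHerm.eigenvalues i) * ‖v‖ ^ 2 ≤ ∑ u, π u * g u ^ 2 :=
    (iInf_eigenvalues_mul_le hHerm v).trans_eq (featureCov_form v)
  have h1 : inner ℝ v (Matrix.toEuclideanCLM (𝕜 := ℝ) Abar v)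
      = ∑ u, ∑ w, π u * P u w * ((γ * g w - g u) * g u) := by
    rw [toEuclideanCLM_meanTdMat hP1 hAbar]
    simp only [_root_.sum_apply, _root_.smul_apply, inner_sum, inner_smul_right, tdOp_apply,
      real_inner_comm v, hg]
  have h2 : ∑ u, ∑ w, π u * P u w * ((γ * g w - g u) * g u)
      ≤ ∑ u, ∑ w, π u * P u w * (γ / 2 * g w ^ 2 + (γ / 2 - 1) * g u ^ 2) := by
    refine Finset.sum_le_sum fun u _ => Finset.sum_le_sum fun w _ =>
      mul_le_mul_of_nonneg_left ?_ (mul_nonneg (hπ u).le (hP u w))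
    nlinarith [mul_nonneg hγ0.le (sq_nonneg (g w - g u))]
  have h3 : ∑ u, ∑ w, π u * P u w * (γ / 2 * g w ^ 2) = γ / 2 * ∑ w, π w * g w ^ 2 := by
    rw [Finset.sum_comm, Finset.mul_sum]
    refine Finset.sum_congr rfl fun w _ => ?_
    have h4 : ∑ u, π u * P u w = π w := congrFun hst w
    rw [← Finset.sum_mul, h4]; ring
  have h5 : ∑ u, ∑ w, π u * P u w * ((γ / 2 - 1) * g u ^ 2)
      = (γ / 2 - 1) * ∑ w, π w * g w ^ 2 := by
    rw [Finset.mul_sum]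
    refine Finset.sum_congr rfl fun u _ => ?_
    rw [← Finset.sum_mul, ← Finset.mul_sum, hP1]; ring
  rw [h1]
  refine h2.trans ?_
  simp_rw [mul_add, Finset.sum_add_distrib]
  rw [h3, h5]
  nlinarith [mul_le_mul_of_nonneg_left hcov (sub_pos.2 hγ1).le]

lemma iInf_eigenvalues_le_one (hK : 1 ≤ K) (hπ : ∀ x, 0 < π x) (hπ1 : ∑ x, π x = 1)
    (hΦ : ∀ x, Φ x ⬝ᵥ Φ x ≤ 1) (hHerm : (Φᵀ * Matrix.diagonal π * Φ).IsHermitian) :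
    (⨅ i, hHerm.eigenvalues i) ≤ 1 := by
  set v : EuclideanSpace ℝ (Fin K) := EuclideanSpace.single ⟨0, hK⟩ 1 with hv
  have hv1 : ‖v‖ = 1 := by simp [hv]
  have h := (iInf_eigenvalues_mul_le hHerm v).trans_eq (featureCov_form v)
  rw [hv1, one_pow, mul_one] at h
  refine h.trans ((Finset.sum_le_sum fun u _ => ?_).trans_eq hπ1)
  refine mul_le_of_le_one_right (hπ u).le ?_
  have h1 := (abs_real_inner_le_norm (feature Φ u) v).trans
    (mul_le_one₀ (norm_feature_le hΦ u) (norm_nonneg _) hv1.le)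
  exact (sq_le_one_iff_abs_le_one _).2 h1

lemma mulVec_neg_inv_mulVec {lam : ℝ} (hlam : 0 < lam)
    (hneg : ∀ v, inner ℝ v (Matrix.toEuclideanCLM (𝕜 := ℝ) Abar v) ≤ -lam * ‖v‖ ^ 2)
    (b : Fin K → ℝ) : Abar *ᵥ (-(Abar⁻¹ *ᵥ b)) = -b := by
  have hinj : Function.Injective Abar.mulVec := by
    intro x y hxy
    have h0 : Abar *ᵥ (x - y) = 0 := by rw [Matrix.mulVec_sub, sub_eq_zero]; exact hxy
    have h1 := hneg (WithLp.toLp 2 (x - y))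
    rw [Matrix.toEuclideanCLM_toLp, h0, WithLp.toLp_zero, inner_zero_right,
      ← sqNorm_eq_norm_sq] at h1
    have h2 : sqNorm (x - y) = 0 := le_antisymm (by nlinarith) (sqNorm_nonneg _)
    exact sub_eq_zero.1 (dotProduct_self_eq_zero.1 h2)
  have hunit : IsUnit Abar.det :=
    (Matrix.isUnit_iff_isUnit_det _).1 (Matrix.mulVec_injective_iff_isUnit.1 hinj)
  rw [Matrix.mulVec_neg, Matrix.mulVec_mulVec, Matrix.mul_nonsing_inv _ hunit, Matrix.one_mulVec]

end TemporalDifference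

section NoiseResponse

variable {E : Type*} [NormedAddCommGroup E] [InnerProductSpace ℝ E]
variable {Ω : Type*} {m : ℕ} {α : ℝ} {A : Fin m → Fin m → E →L[ℝ] E} {Ab : E →L[ℝ] E} {w : E}
  {s : ℕ → Ω → Fin m} {a : ℕ}

lemma linIter_sum_smul {ι : Type*} (I : Finset ι) (c : ι → ℝ) (b : ι → E) (n : ℕ) (ω : Ω) :
    linIter α A Ab 0 s a (∑ i ∈ I, c i • b i) n ω
      = ∑ i ∈ I, c i • linIter α A Ab 0 s a (b i) n ω := by
  induction n with
  | zero => rfl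
  | succ n ih =>
    simp only [linIter, ih, map_zero, add_zero, map_sum, map_smul, smul_add,
      Finset.sum_add_distrib, Finset.smul_sum]
    congr 1
    exact Finset.sum_congr rfl fun i _ => smul_comm _ _ _

lemma norm_linIter_sq_le {ι : Type*} [Fintype ι] (b : OrthonormalBasis ι ℝ E) (e : E) (n : ℕ)
    (ω : Ω) : ‖linIter α A Ab 0 s a e n ω‖ ^ 2
      ≤ ‖e‖ ^ 2 * ∑ i, ‖linIter α A Ab 0 s a (b i) n ω‖ ^ 2 := by
  have h1 : linIter α A Ab 0 s a e n ω
      = ∑ i, inner ℝ (b i) e • linIter α A Ab 0 s a (b i) n ω := by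
    rw [← linIter_sum_smul, b.sum_repr' e]
  have h2 : ‖linIter α A Ab 0 s a e n ω‖
      ≤ ∑ i, |inner ℝ (b i) e| * ‖linIter α A Ab 0 s a (b i) n ω‖ := by
    rw [h1]
    refine (norm_sum_le _ _).trans_eq (Finset.sum_congr rfl fun i _ => ?_)
    rw [norm_smul, Real.norm_eq_abs]
  refine (pow_le_pow_left₀ (norm_nonneg _) h2 2).trans
    ((Finset.sum_mul_sq_le_sq_mul_sq _ _ _).trans_eq ?_)
  congr 1
  rw [← b.sum_sq_norm_inner_right e]
  exact Finset.sum_congr rfl fun i _ => by rw [Real.norm_eq_abs]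

/-- Duhamel's formula for the recursion with additional forcing `e`. -/
lemma eq_linIter_add_sum {x : ℕ → Ω → E} {e : ℕ → Ω → E} {y₀ : E} {ω : Ω} (h0 : x 0 ω = y₀)
    (hx : ∀ n, x (n + 1) ω = x n ω + α • (A (s (a + n) ω) (s (a + n + 1) ω) (x n ω) +
      (A (s (a + n) ω) (s (a + n + 1) ω) - Ab) w + e n ω)) (n : ℕ) :
    x n ω = linIter α A Ab w s a y₀ n ω
      + α • ∑ j ∈ Finset.range n, linIter α A Ab 0 s (a + j + 1) (e j ω) (n - 1 - j) ω := by
  induction n with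
  | zero => simp [linIter, h0]
  | succ n ih =>
    have hlast : linIter α A Ab 0 s (a + n + 1) (e n ω) (n + 1 - 1 - n) ω = e n ω := by
      rw [show n + 1 - 1 - n = 0 by omega]; rfl
    have hstep : ∀ j ∈ Finset.range n, linIter α A Ab 0 s (a + j + 1) (e j ω) (n + 1 - 1 - j) ω
        = linIter α A Ab 0 s (a + j + 1) (e j ω) (n - 1 - j) ω
          + α • A (s (a + n) ω) (s (a + n + 1) ω)
            (linIter α A Ab 0 s (a + j + 1) (e j ω) (n - 1 - j) ω) := fun j hj => by
      have hj := Finset.mem_range.1 hj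
      rw [show n + 1 - 1 - j = (n - 1 - j) + 1 by omega, linIter,
        show a + j + 1 + (n - 1 - j) = a + n by omega]
      simp only [map_zero, add_zero]
    rw [Finset.sum_range_succ, hlast, Finset.sum_congr rfl hstep, Finset.sum_add_distrib,
      ← Finset.smul_sum, ← map_sum, hx, ih, linIter]
    simp only [map_add, map_smul, smul_add]
    abel

/-- Weighted Cauchy–Schwarz with geometric weights. -/
lemma norm_smul_sum_sq_le {κ : ℝ} (hκ : 0 < κ) (n : ℕ) (u : ℕ → E) :
    ‖α • ∑ j ∈ Finset.range n, u j‖ ^ 2 ≤ (α * ∑ j ∈ Finset.range n, κ ^ (n - 1 - j)) *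
      (α * ∑ j ∈ Finset.range n, (κ ^ (n - 1 - j))⁻¹ * ‖u j‖ ^ 2) := by
  have h1 : ‖∑ j ∈ Finset.range n, u j‖ ^ 2 ≤ (∑ j ∈ Finset.range n, κ ^ (n - 1 - j)) *
      ∑ j ∈ Finset.range n, (κ ^ (n - 1 - j))⁻¹ * ‖u j‖ ^ 2 := by
    refine (pow_le_pow_left₀ (norm_nonneg _) (norm_sum_le _ _) 2).trans
      (Finset.sum_sq_le_sum_mul_sum_of_sq_le_mul _ (fun j _ => by positivity)
        (fun j _ => by positivity) fun j _ => le_of_eq ?_)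
    have : κ ^ (n - 1 - j) ≠ 0 := by positivity
    field_simp
  rw [norm_smul, mul_pow, Real.norm_eq_abs, sq_abs]
  have := mul_le_mul_of_nonneg_left h1 (sq_nonneg α)
  linarith

variable [MeasurableSpace E] [BorelSpace E] [SecondCountableTopology E]
variable {mΩ : MeasurableSpace Ω} {μ : Measure Ω} [IsProbabilityMeasure μ] {F : Filtration ℕ mΩ}
  {P : Matrix (Fin m) (Fin m) ℝ} {τ : ℕ} {lam : ℝ}

lemma sum_geometric_sub_le {κ : ℝ} (hκ0 : 0 ≤ κ) (hκ1 : κ < 1) (n : ℕ) :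
    ∑ j ∈ Finset.range n, κ ^ (n - 1 - j) ≤ (1 - κ)⁻¹ := by
  rw [Finset.sum_range_reflect (fun j => κ ^ j) n, ← tsum_geometric_of_lt_one hκ0 hκ1]
  exact (summable_geometric_of_lt_one hκ0 hκ1).sum_le_tsum _ fun j _ => by positivity

/-- Mean-square response of the recursion to possibly anticipating forcing `e`, each `e j` being
small outside an adapted event `S j`. -/
lemma exists_noise_response_le {ι : Type*} [Fintype ι] (b : OrthonormalBasis ι ℝ E)
    (hs : IsMarkovChain F s P μ) (hP1 : ∀ x, ∑ y, P x y = 1)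
    (hA : ∀ u v, ‖A u v‖ ≤ 2) (hAb : ‖Ab‖ ≤ 2)
    (hneg : ∀ v, inner ℝ v (Ab v) ≤ -lam * ‖v‖ ^ 2)
    (hmix : ∀ x, ‖(∑ u, ∑ v, ((P ^ τ) x u * P u v) • A u v) - Ab‖ ≤ α)
    (hα : 0 < α) (hτ : 1 ≤ τ) (hlam0 : 0 < lam) (hlam1 : lam ≤ 1)
    (hαlam : 832 * (α * τ) ≤ lam)
    {n : ℕ} {e : ℕ → Ω → E} {S : ℕ → Set Ω} {g B h : ℕ → ℝ}
    (hS : ∀ j < n, MeasurableSet[F (a + j)] (S j))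
    (hg : ∀ j < n, 0 ≤ g j) (hB : ∀ j < n, 0 ≤ B j)
    (heg : ∀ j < n, ∀ ω ∉ S j, ‖e j ω‖ ^ 2 ≤ g j) (heB : ∀ j < n, ∀ ω, ‖e j ω‖ ^ 2 ≤ B j)
    (hh : ∀ j < n, g j + B j * μ.real (S j) ≤ h j) :
    ∃ W : Ω → ℝ, Integrable W μ ∧
      (∀ ω, ‖α • ∑ j ∈ Finset.range n,
        linIter α A Ab 0 s (a + j + 1) (e j ω) (n - 1 - j) ω‖ ^ 2 ≤ W ω) ∧
      ∫ ω, W ω ∂μ ≤ 32 * Fintype.card ι / lam *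
        (α * ∑ j ∈ Finset.range n, (1 - α * lam / 2) ^ (n - 1 - j) * h j) := by
  have hτ' : (1 : ℝ) ≤ τ := by exact_mod_cast hτ
  have hαl : α * lam ≤ 1 := by nlinarith
  have hαl0 : 0 < α * lam := by positivity
  set κ := 1 - α * lam / 2 with hκ
  have hκ0 : 0 < κ := by rw [hκ]; linarith
  have hκ1 : κ < 1 := by rw [hκ]; linarith
  have hgeo : α * ∑ j ∈ Finset.range n, κ ^ (n - 1 - j) ≤ 2 / lam := by
    calc α * ∑ j ∈ Finset.range n, κ ^ (n - 1 - j) ≤ α * (1 - κ)⁻¹ :=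
          mul_le_mul_of_nonneg_left (sum_geometric_sub_le hκ0.le hκ1 n) hα.le
      _ = 2 / lam := by rw [hκ]; field_simp; ring
  have hq : ∀ k, (1 - α * lam) ^ k ≤ (κ ^ k) ^ 2 := fun k => by
    rw [← pow_mul, mul_comm k, pow_mul]
    exact pow_le_pow_left₀ (by linarith) (by rw [hκ]; nlinarith) k
  set V : ℕ → ι → Ω → ℝ := fun j i ω =>
    ‖linIter α A Ab 0 s (a + j + 1) (b i) (n - 1 - j) ω‖ ^ 2 with hV
  set χ : ℕ → Ω → ℝ := fun j => (S j).indicator 1 with hχ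
  have hχm : ∀ j < n, Measurable[F (a + j + 1)] (χ j) := fun j hj =>
    Measurable.mono (Measurable.indicator (m := F (a + j)) measurable_const (hS j hj))
      (F.mono (by omega)) le_rfl
  have hχ0 : ∀ j ω, 0 ≤ χ j ω := fun j ω => Set.indicator_nonneg (fun _ _ => zero_le_one) ω
  have hχ1 : ∀ j ω, χ j ω ≤ 1 := fun j ω =>
    Set.indicator_le_self' (f := (1 : Ω → ℝ)) (fun _ _ => zero_le_one) ω
  have i1 : ∀ j < n, ∀ i, Integrable (fun ω => χ j ω * V j i ω) μ := fun j hj i =>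
    integrable_mul_norm_linIter_sq hs hA (hχm j hj) (hχ0 j) (hχ1 j) _
  have i2 : ∀ j i, Integrable (fun ω => 1 * V j i ω) μ := fun j i =>
    integrable_mul_norm_linIter_sq (χ := fun _ => 1) hs hA measurable_const
      (fun _ => zero_le_one) (fun _ => le_rfl) _
  have m1 : ∀ j < n, ∀ i, ∫ ω, χ j ω * V j i ω ∂μ
      ≤ 16 * (κ ^ (n - 1 - j)) ^ 2 * μ.real (S j) := fun j hj i => by
    have h1 := meanSq_linIter_homogeneous_le (y₀ := b i) hs hP1 hA hAb hneg hmix hα.le hτ hlam1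
      hαlam (hχm j hj) (hχ0 j) (hχ1 j) hlam0 (n - 1 - j)
    have h2 : ∫ ω, χ j ω ∂μ = μ.real (S j) :=
      integral_indicator_one (F.le _ _ (hS j hj))
    rw [h2, b.norm_eq_one, one_pow, mul_one] at h1
    exact h1.trans (mul_le_mul_of_nonneg_right
      (mul_le_mul_of_nonneg_left (hq _) (by norm_num)) measureReal_nonneg)
  have m2 : ∀ j i, ∫ ω, 1 * V j i ω ∂μ ≤ 16 * (κ ^ (n - 1 - j)) ^ 2 := fun j i => by
    have h1 := meanSq_linIter_homogeneous_le (y₀ := b i) (χ := fun _ => 1) (a := a + j + 1) hs hP1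
      hA hAb hneg hmix hα.le hτ hlam1 hαlam measurable_const (fun _ => zero_le_one)
      (fun _ => le_rfl) hlam0 (n - 1 - j)
    rw [b.norm_eq_one, one_pow, mul_one, integral_const, probReal_univ, one_smul, mul_one] at h1
    exact h1.trans (mul_le_mul_of_nonneg_left (hq _) (by norm_num))
  have iD : ∀ j < n, ∀ i, Integrable
      (fun ω => g j * (1 * V j i ω) + B j * (χ j ω * V j i ω)) μ := fun j hj i =>
    ((i2 j i).const_mul _).add ((i1 j hj i).const_mul _)
  have iD' : ∀ j ∈ Finset.range n, Integrable (fun ω => (κ ^ (n - 1 - j))⁻¹ *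
      ∑ i, (g j * (1 * V j i ω) + B j * (χ j ω * V j i ω))) μ := fun j hj =>
    Integrable.const_mul (integrable_finsetSum _ fun i _ => iD j (Finset.mem_range.1 hj) i) _
  refine ⟨fun ω => 2 / lam * (α * ∑ j ∈ Finset.range n, (κ ^ (n - 1 - j))⁻¹ *
    ∑ i, (g j * (1 * V j i ω) + B j * (χ j ω * V j i ω))), ?_, fun ω => ?_, ?_⟩
  · exact ((integrable_finsetSum _ iD').const_mul _).const_mul _
  · refine (norm_smul_sum_sq_le hκ0 n _).trans (mul_le_mul hgeo ?_ (by positivity)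
      (by positivity))
    refine mul_le_mul_of_nonneg_left (Finset.sum_le_sum fun j hj =>
      mul_le_mul_of_nonneg_left ?_ (by positivity)) hα.le
    have hj := Finset.mem_range.1 hj
    refine (norm_linIter_sq_le b _ _ _).trans ?_
    rw [Finset.mul_sum]
    refine Finset.sum_le_sum fun i _ => ?_
    have hV0 : 0 ≤ V j i ω := sq_nonneg _
    have he : ‖e j ω‖ ^ 2 ≤ g j + B j * χ j ω := by
      by_cases hω : ω ∈ S j
      · simp only [hχ, Set.indicator_of_mem hω, Pi.one_apply, mul_one]
        linarith [heB j hj ω, hg j hj]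
      · simp only [hχ, Set.indicator_of_notMem hω, mul_zero, add_zero]
        exact heg j hj ω hω
    have := mul_le_mul_of_nonneg_right he hV0
    linarith
  · rw [integral_const_mul, integral_const_mul, integral_finsetSum _ iD']
    have hterm : ∀ j ∈ Finset.range n, ∫ ω, (κ ^ (n - 1 - j))⁻¹ *
        ∑ i, (g j * (1 * V j i ω) + B j * (χ j ω * V j i ω)) ∂μ
        ≤ 16 * Fintype.card ι * (κ ^ (n - 1 - j) * h j) := fun j hj => by
      have hj := Finset.mem_range.1 hj
      rw [integral_const_mul, integral_finsetSum _ fun i _ => iD j hj i]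
      have hi : ∀ i ∈ Finset.univ, ∫ ω, (g j * (1 * V j i ω) + B j * (χ j ω * V j i ω)) ∂μ
          ≤ 16 * (κ ^ (n - 1 - j)) ^ 2 * h j := fun i _ => by
        rw [integral_add ((i2 j i).const_mul _) ((i1 j hj i).const_mul _), integral_const_mul (g j),
          integral_const_mul (B j)]
        have h1 := mul_le_mul_of_nonneg_left (m2 j i) (hg j hj)
        have h2 := mul_le_mul_of_nonneg_left (m1 j hj i) (hB j hj)
        have h3 := mul_le_mul_of_nonneg_left (hh j hj)
          (show 0 ≤ 16 * (κ ^ (n - 1 - j)) ^ 2 by positivity)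
        linarith
      calc (κ ^ (n - 1 - j))⁻¹ *
            ∑ i, ∫ ω, (g j * (1 * V j i ω) + B j * (χ j ω * V j i ω)) ∂μ
          ≤ (κ ^ (n - 1 - j))⁻¹ * ∑ i : ι, 16 * (κ ^ (n - 1 - j)) ^ 2 * h j :=
            mul_le_mul_of_nonneg_left (Finset.sum_le_sum hi) (by positivity)
        _ = 16 * Fintype.card ι * (κ ^ (n - 1 - j) * h j) := by
            rw [Finset.sum_const, Finset.card_univ, nsmul_eq_mul]
            field_simp
    calc 2 / lam * (α * ∑ j ∈ Finset.range n, ∫ ω, (κ ^ (n - 1 - j))⁻¹ *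
          ∑ i, (g j * (1 * V j i ω) + B j * (χ j ω * V j i ω)) ∂μ)
        ≤ 2 / lam * (α * ∑ j ∈ Finset.range n,
            16 * Fintype.card ι * (κ ^ (n - 1 - j) * h j)) := by
          gcongr with j hj
          exact hterm j hj
      _ = _ := by rw [← Finset.mul_sum]; ring

end NoiseResponse

section MeanSquareError

variable {E : Type*} [NormedAddCommGroup E] [InnerProductSpace ℝ E]
variable {Ω : Type*} {m : ℕ} {α : ℝ} {A : Fin m → Fin m → E →L[ℝ] E} {Ab : E →L[ℝ] E} {w : E}
  {s : ℕ → Ω → Fin m} {a : ℕ}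
variable [MeasurableSpace E] [BorelSpace E] [SecondCountableTopology E]
variable {mΩ : MeasurableSpace Ω} {μ : Measure Ω} [IsProbabilityMeasure μ] {F : Filtration ℕ mΩ}
  {P : Matrix (Fin m) (Fin m) ℝ} {τ : ℕ} {lam : ℝ}

/-- Mean-square error of the linear recursion with multiplicative noise and forcing `e`. -/
lemma integral_norm_sq_forced_le {ι : Type*} [Fintype ι] (b : OrthonormalBasis ι ℝ E)
    (hs : IsMarkovChain F s P μ) (hP1 : ∀ x, ∑ y, P x y = 1)
    (hA : ∀ u v, ‖A u v‖ ≤ 2) (hAb : ‖Ab‖ ≤ 2)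
    (hneg : ∀ v, inner ℝ v (Ab v) ≤ -lam * ‖v‖ ^ 2)
    (hmix : ∀ x, ‖(∑ u, ∑ v, ((P ^ τ) x u * P u v) • A u v) - Ab‖ ≤ α)
    (hα : 0 < α) (hτ : 1 ≤ τ) (hlam0 : 0 < lam) (hlam1 : lam ≤ 1)
    (hαlam : 832 * (α * τ) ≤ lam) {x e : ℕ → Ω → E} {y₀ : E} (h0 : ∀ ω, x 0 ω = y₀)
    (hx : ∀ n ω, x (n + 1) ω = x n ω + α • (A (s (a + n) ω) (s (a + n + 1) ω) (x n ω) +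
      (A (s (a + n) ω) (s (a + n + 1) ω) - Ab) w + e n ω))
    {n N : ℕ} (hN : n + τ = N) {S : ℕ → Set Ω} {g B h : ℕ → ℝ}
    (hS : ∀ j < N, MeasurableSet[F (a + j)] (S j))
    (hg : ∀ j < N, 0 ≤ g j) (hB : ∀ j < N, 0 ≤ B j)
    (heg : ∀ j < N, ∀ ω ∉ S j, ‖e j ω‖ ^ 2 ≤ g j) (heB : ∀ j < N, ∀ ω, ‖e j ω‖ ^ 2 ≤ B j)
    (hh : ∀ j < N, g j + B j * μ.real (S j) ≤ h j) :
    ∫ ω, ‖x N ω‖ ^ 2 ∂μ ≤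
      2 * ((1 - α * lam) ^ n * (8 * ‖y₀‖ ^ 2 + 2 * ‖w‖ ^ 2) + 832 * (α * τ) * ‖w‖ ^ 2 / lam)
      + 2 * (32 * Fintype.card ι / lam *
        (α * ∑ j ∈ Finset.range N, (1 - α * lam / 2) ^ (N - 1 - j) * h j)) := by
  obtain ⟨W, iW, hW, hWint⟩ := exists_noise_response_le b hs hP1 hA hAb hneg hmix hα hτ hlam0
    hlam1 hαlam hS hg hB heg heB hh
  have hy := meanSq_linIter_le (y₀ := y₀) (w := w) (χ := fun _ => 1) (a := a) hs hP1 hA hAb hneg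
    hmix hα.le hτ hlam1 hαlam measurable_const (fun _ => zero_le_one) (fun _ => le_rfl) hlam0 n
  have iy := integrable_mul_norm_linIter_sq (α := α) (Ab := Ab) (y₀ := y₀) (w := w)
    (χ := fun _ => 1) (a := a) hs hA measurable_const (fun _ => zero_le_one) (fun _ => le_rfl) N
  rw [integral_const, probReal_univ, one_smul, mul_one, hN] at hy
  have hpt : ∀ ω, ‖x N ω‖ ^ 2
      ≤ 2 * (1 * ‖linIter α A Ab w s a y₀ N ω‖ ^ 2) + 2 * W ω := fun ω => by
    rw [eq_linIter_add_sum (h0 ω) (fun n => hx n ω) N]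
    set Y := linIter α A Ab w s a y₀ N ω
    set Z := α • ∑ j ∈ Finset.range N, linIter α A Ab 0 s (a + j + 1) (e j ω) (N - 1 - j) ω with hZ
    have h1 : ‖Z‖ ^ 2 ≤ W ω := hW ω
    have h2 := pow_le_pow_left₀ (norm_nonneg _) (norm_add_le Y Z) 2
    nlinarith [sq_nonneg (‖Y‖ - ‖Z‖)]
  have i1 : Integrable (fun ω => 2 * (1 * ‖linIter α A Ab w s a y₀ N ω‖ ^ 2)) μ := iy.const_mul 2
  have i2 : Integrable (fun ω => 2 * W ω) μ := iW.const_mul 2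
  have hsum : ∫ ω, (2 * (1 * ‖linIter α A Ab w s a y₀ N ω‖ ^ 2) + 2 * W ω) ∂μ
      = 2 * ∫ ω, 1 * ‖linIter α A Ab w s a y₀ N ω‖ ^ 2 ∂μ + 2 * ∫ ω, W ω ∂μ := by
    rw [integral_add i1 i2, integral_const_mul 2, integral_const_mul 2]
  have hmono : ∫ ω, ‖x N ω‖ ^ 2 ∂μ
      ≤ ∫ ω, (2 * (1 * ‖linIter α A Ab w s a y₀ N ω‖ ^ 2) + 2 * W ω) ∂μ :=
    integral_mono_of_nonneg (Filter.Eventually.of_forall fun ω => sq_nonneg _)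
      (i1.add i2) (Filter.Eventually.of_forall hpt)
  rw [hsum] at hmono
  linarith

end MeanSquareError

section StepSize

lemma one_sub_pow_le_one_div {T : ℝ} (hT : 0 < T) {y : ℝ} (hy1 : y ≤ 1) {k : ℕ}
    (hk : Real.log T ≤ y * k) : (1 - y) ^ k ≤ 1 / T := by
  calc (1 - y) ^ k ≤ Real.exp (-y) ^ k :=
        pow_le_pow_left₀ (by linarith) (Real.one_sub_le_exp_neg y) k
    _ = Real.exp (-(y * k)) := by rw [← Real.exp_nat_mul]; ring_nf
    _ ≤ Real.exp (-Real.log T) := Real.exp_le_exp.2 (by linarith)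
    _ = 1 / T := by rw [Real.exp_neg, Real.exp_log hT, one_div]

lemma sum_geometric_div_le {T a n : ℕ} {x : ℝ} (ha : 1 ≤ a) (han : a + n = T) (hT : 2 ≤ T)
    (hx : x = 4 * Real.log T / T) (hx1 : x ≤ 1) :
    ∑ j ∈ Finset.range n, (1 - x / 2) ^ (n - 1 - j) * (1 / ((a + j : ℕ) : ℝ))
      ≤ 4 / (T * x) + 2 := by
  have hT' : (2 : ℝ) ≤ T := by exact_mod_cast hT
  have hlog : 0 < Real.log T := Real.log_pos (by linarith)
  have hx0 : 0 < x := by rw [hx]; positivity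
  have hterm : ∀ j ∈ Finset.range n, (1 - x / 2) ^ (n - 1 - j) * (1 / ((a + j : ℕ) : ℝ))
      ≤ 2 / T * (1 - x / 2) ^ (n - 1 - j) + 2 / T := fun j hj => by
    have hj := Finset.mem_range.1 hj
    have hk1 : (1 : ℝ) ≤ ((a + j : ℕ) : ℝ) := by exact_mod_cast (by omega : 1 ≤ a + j)
    have hp0 : 0 ≤ (1 - x / 2) ^ (n - 1 - j) := pow_nonneg (by linarith) _
    rcases le_total T (2 * (a + j)) with h | h
    · have h' : (T : ℝ) ≤ 2 * ((a + j : ℕ) : ℝ) := by exact_mod_cast h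
      have h1 : 1 / ((a + j : ℕ) : ℝ) ≤ 2 / T := by
        rw [div_le_div_iff₀ (by linarith) (by linarith)]; linarith
      have h2 := mul_le_mul_of_nonneg_left h1 hp0
      have h3 : 0 ≤ 2 / (T : ℝ) := by positivity
      linarith
    · have hcard : n - 1 - j + 1 = T - (a + j) := by omega
      have h4 : (T : ℝ) ≤ 2 * ((n - 1 - j + 1 : ℕ) : ℝ) := by
        exact_mod_cast (by omega : T ≤ 2 * (n - 1 - j + 1))
      have h5 : (1 - x / 2) ^ (n - 1 - j + 1) ≤ 1 / T := by
        refine one_sub_pow_le_one_div (by linarith) (by linarith) ?_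
        have h6 := mul_le_mul_of_nonneg_left h4 (show 0 ≤ x / 4 by positivity)
        have h7 : x / 4 * T = Real.log T := by rw [hx]; field_simp
        rw [h7] at h6
        linarith
      have h8 : (1 - x / 2) ^ (n - 1 - j) ≤ 2 / T := by
        rw [pow_succ] at h5
        have h9 := mul_le_mul_of_nonneg_left (show 1 / 2 ≤ 1 - x / 2 by linarith) hp0
        have h10 : 2 / (T : ℝ) = 2 * (1 / T) := by ring
        linarith
      have h11 : 1 / ((a + j : ℕ) : ℝ) ≤ 1 := by
        rw [div_le_one (by linarith)]; exact hk1
      have h12 := mul_le_mul_of_nonneg_left h11 hp0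
      have h13 : 0 ≤ 2 / (T : ℝ) * (1 - x / 2) ^ (n - 1 - j) := by positivity
      linarith
  refine (Finset.sum_le_sum hterm).trans ?_
  rw [Finset.sum_add_distrib, ← Finset.mul_sum, Finset.sum_const, Finset.card_range,
    nsmul_eq_mul]
  have h1 := mul_le_mul_of_nonneg_left
    (sum_geometric_sub_le (κ := 1 - x / 2) (by linarith) (by linarith) n)
    (show 0 ≤ 2 / (T : ℝ) by positivity)
  have h2 : 2 / (T : ℝ) * (1 - (1 - x / 2))⁻¹ = 4 / (T * x) := by
    rw [sub_sub_cancel]; field_simp; norm_num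
  have h3 : (n : ℝ) * (2 / T) ≤ 2 := by
    have : (n : ℝ) ≤ T := by exact_mod_cast (by omega : n ≤ T)
    rw [mul_div_assoc', div_le_iff₀ (by linarith)]; linarith
  linarith

variable {K T τ n : ℕ} {lam tm ℓ M σ : ℝ}

lemma transient_le {Tbar : ℕ} (hT : 2 ≤ T) (hℓ : 0.69 ≤ ℓ) (hM : 1 ≤ M) (htm : tm ≤ M)
    (hτ : (τ : ℝ) ≤ M) (hTbar : (Tbar : ℝ) ≤ 70000 * tm * ℓ ^ 2 + 1) (hn : Tbar + τ + n = T)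
    {x : ℝ} (hx : x = 4 * Real.log T / T) (hx1 : x ≤ 1) :
    (1 - x) ^ n ≤ 300000 * M * ℓ ^ 3 / T := by
  have hT' : (2 : ℝ) ≤ T := by exact_mod_cast hT
  have hlog : 0 < Real.log T := Real.log_pos (by linarith)
  have hx0 : 0 < x := by rw [hx]; positivity
  have hℓ2 : 0.47 ≤ ℓ ^ 2 := by nlinarith
  have hℓ3 : 0.69 * ℓ ^ 2 ≤ ℓ ^ 3 := by nlinarith
  have hMℓ2 : M * ℓ ^ 2 * 0.69 ≤ M * ℓ ^ 3 := by nlinarith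
  have hMℓ : M * 0.32 ≤ M * ℓ ^ 3 := mul_le_mul_of_nonneg_left (by linarith) (by linarith)
  rcases le_total T (2 * n) with h | h
  · have h' : (T : ℝ) ≤ 2 * n := by exact_mod_cast h
    refine (one_sub_pow_le_one_div (by linarith) hx1 ?_).trans
      (div_le_div_of_nonneg_right (by linarith) (by linarith))
    have h6 := mul_le_mul_of_nonneg_left h' (show 0 ≤ x / 4 by positivity)
    have h7 : x / 4 * T = Real.log T := by rw [hx]; field_simp
    have h8 : 0 ≤ x * n := by positivity
    linarith
  · refine (pow_le_one₀ (by linarith) (by linarith)).trans ?_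
    rw [le_div_iff₀ (by linarith), one_mul]
    have h' : (T : ℝ) ≤ 2 * (Tbar + τ) := by exact_mod_cast (by omega : T ≤ 2 * (Tbar + τ))
    have h1 : tm * ℓ ^ 2 ≤ M * ℓ ^ 2 := mul_le_mul_of_nonneg_right htm (by positivity)
    linarith

lemma transient_bias_le {α D : ℝ} (hT : 2 ≤ T) (hlam0 : 0 < lam) (hlam1 : lam ≤ 1)
    (hℓ : 0.69 ≤ ℓ) (hℓT : Real.log T ≤ ℓ) (hτ : (τ : ℝ) ≤ M) (hM : 1 ≤ M) (hσ0 : 0 ≤ σ)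
    (hα : α = 4 / lam * (Real.log T / T)) (hD : D ≤ 300000 * M * ℓ ^ 3 / T) (hD0 : 0 ≤ D)
    {y₀ w : ℝ} (hy0 : 0 ≤ y₀) (hw0 : 0 ≤ w) (hy₀ : y₀ ≤ 2 * σ) (hw : w ≤ σ) :
    D * (8 * y₀ ^ 2 + 2 * w ^ 2) + 832 * (α * τ) * w ^ 2 / lam
      ≤ 10300000 * (M * ℓ ^ 3 / T * σ ^ 2 * (1 / lam ^ 2)) := by
  have hT' : (2 : ℝ) ≤ T := by exact_mod_cast hT
  have hlog0 : 0 < Real.log T := Real.log_pos (by linarith)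
  have hℓ3 : 0.47 * ℓ ≤ ℓ ^ 3 := by nlinarith [sq_nonneg ℓ]
  set V := M * ℓ ^ 3 / T with hV
  have hV0 : 0 ≤ V := by positivity
  set R := 1 / lam ^ 2 with hR
  have hR1 : 1 ≤ R := by
    rw [hR, le_div_iff₀ (by positivity)]; nlinarith
  have hy2 : 8 * y₀ ^ 2 + 2 * w ^ 2 ≤ 34 * σ ^ 2 := by nlinarith
  have hw2 : w ^ 2 ≤ σ ^ 2 := pow_le_pow_left₀ hw0 hw 2
  have t1 : D * (8 * y₀ ^ 2 + 2 * w ^ 2) ≤ 10200000 * (V * σ ^ 2) := by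
    calc D * (8 * y₀ ^ 2 + 2 * w ^ 2) ≤ (300000 * M * ℓ ^ 3 / T) * (34 * σ ^ 2) :=
          mul_le_mul hD hy2 (by positivity) (hD0.trans hD)
      _ = _ := by rw [hV]; ring
  have t2 : 832 * (α * τ) * w ^ 2 / lam ≤ 7488 * (V * σ ^ 2 * R) := by
    have h1 : α * τ ≤ 4 / lam * (9 / 4 * V) := by
      have h2 : Real.log T * τ ≤ ℓ * M := mul_le_mul hℓT hτ (by positivity) (by linarith)
      have h3 : Real.log T * τ ≤ 9 / 4 * (M * ℓ ^ 3) := by nlinarith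
      have e : α * τ = 4 / lam * (Real.log T * τ / T) := by rw [hα]; ring
      have e' : 9 / 4 * V = 9 / 4 * (M * ℓ ^ 3) / T := by rw [hV]; ring
      rw [e, e']
      exact mul_le_mul_of_nonneg_left (div_le_div_of_nonneg_right h3 (by positivity))
        (by positivity)
    calc 832 * (α * τ) * w ^ 2 / lam
        ≤ 832 * (4 / lam * (9 / 4 * V)) * σ ^ 2 / lam := by
          refine div_le_div_of_nonneg_right (mul_le_mul (mul_le_mul_of_nonneg_left h1
            (by norm_num)) hw2 (sq_nonneg _) (by positivity)) hlam0.le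
      _ = 7488 * (V * σ ^ 2 * R) := by rw [hR]; field_simp; ring
  have h1R : V * σ ^ 2 ≤ V * σ ^ 2 * R := le_mul_of_one_le_right (by positivity) hR1
  have h0R : 0 ≤ V * σ ^ 2 * R := by positivity
  linarith

lemma noise_le {α ε σ₁ x : ℝ} (hT : 2 ≤ T) (hlam0 : 0 < lam)
    (hℓ : 0.69 ≤ ℓ) (hℓT : Real.log T ≤ ℓ) (htm : tm ≤ M) (hM : 1 ≤ M)
    (hσ1 : 0 ≤ σ₁) (hσ : σ₁ ≤ σ) (hα : α = 4 / lam * (Real.log T / T)) (hx : x = α * lam) {z : ℝ}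
    (hz : z ≤ 530000 * σ₁ ^ 2 * (ε * (2 / lam) + 49 * ℓ ^ 2 * tm * (α * (4 / (T * x) + 2)))) :
    32 * K / lam * z ≤ 33920000 * (ε * σ₁ ^ 2 * (K * (1 / lam ^ 2)))
      + 11634560000 * (M * ℓ ^ 3 / T * σ ^ 2 * (K * (1 / lam ^ 2))) := by
  have hT' : (2 : ℝ) ≤ T := by exact_mod_cast hT
  have hlog0 : 0 < Real.log T := Real.log_pos (by linarith)
  have hα0 : 0 < α := by rw [hα]; positivity
  have hσ2 : σ₁ ^ 2 ≤ σ ^ 2 := pow_le_pow_left₀ hσ1 hσ 2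
  have h1 : α * (4 / (T * x) + 2) ≤ 14 * ℓ / (lam * T) := by
    have e : α * (4 / (T * x) + 2) = (4 + 8 * Real.log T) / (lam * T) := by
      rw [hx, hα]; field_simp; ring
    rw [e]
    exact div_le_div_of_nonneg_right (by linarith) (by positivity)
  have h2 : 49 * ℓ ^ 2 * tm * (α * (4 / (T * x) + 2)) ≤ 49 * ℓ ^ 2 * M * (14 * ℓ / (lam * T)) := by
    refine mul_le_mul (mul_le_mul_of_nonneg_left htm (by positivity)) h1 ?_ (by positivity)
    rw [hx]; positivity
  have hσ3 : M * ℓ ^ 3 / T * σ₁ ^ 2 * (K * (1 / lam ^ 2))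
      ≤ M * ℓ ^ 3 / T * σ ^ 2 * (K * (1 / lam ^ 2)) :=
    mul_le_mul_of_nonneg_right (mul_le_mul_of_nonneg_left hσ2 (by positivity)) (by positivity)
  have h3 : 32 * K / lam * z ≤ 32 * K / lam * (530000 * σ₁ ^ 2 * (ε * (2 / lam)
        + 49 * ℓ ^ 2 * M * (14 * ℓ / (lam * T)))) :=
    mul_le_mul_of_nonneg_left (hz.trans (mul_le_mul_of_nonneg_left (by linarith) (by positivity)))
      (by positivity)
  have h4 : 32 * K / lam * (530000 * σ₁ ^ 2 * (ε * (2 / lam)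
        + 49 * ℓ ^ 2 * M * (14 * ℓ / (lam * T))))
      = 33920000 * (ε * σ₁ ^ 2 * (K * (1 / lam ^ 2)))
        + 11634560000 * (M * ℓ ^ 3 / T * σ₁ ^ 2 * (K * (1 / lam ^ 2))) := by
    field_simp; ring
  rw [h4] at h3
  exact h3.trans (by gcongr)

/-- Collecting the transient, bias and noise contributions. -/
lemma collect_error_le {α ε σ₁ D x : ℝ} (hK : 1 ≤ K) (hT : 2 ≤ T) (hlam0 : 0 < lam)
    (hℓ : 0.69 ≤ ℓ) (hℓT : Real.log T ≤ ℓ)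
    (hτ : (τ : ℝ) ≤ M) (htm : tm ≤ M) (hM : 1 ≤ M) (hlam1 : lam ≤ 1)
    (hσ1 : 0 ≤ σ₁) (hσ : σ₁ ≤ σ) (hα : α = 4 / lam * (Real.log T / T))
    (hD : D ≤ 300000 * M * ℓ ^ 3 / T) (hx : x = α * lam) {y₀ w z : ℝ} (hε : 0 ≤ ε)
    (hy0 : 0 ≤ y₀) (hw0 : 0 ≤ w) (hD0 : 0 ≤ D) (hy₀ : y₀ ≤ 2 * σ) (hw : w ≤ σ)
    (hz : z ≤ 530000 * σ₁ ^ 2 * (ε * (2 / lam) + 49 * ℓ ^ 2 * tm * (α * (4 / (T * x) + 2)))) :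
    2 * (D * (8 * y₀ ^ 2 + 2 * w ^ 2) + 832 * (α * τ) * w ^ 2 / lam) + 2 * (32 * K / lam * z)
      ≤ 30000000000 * M * σ ^ 2 * (K / lam ^ 2) * ℓ ^ 3 / T
        + 70000000 * ε * σ₁ ^ 2 * (K / lam ^ 2) := by
  have hK' : (1 : ℝ) ≤ K := by exact_mod_cast hK
  have t12 := transient_bias_le hT hlam0 hlam1 hℓ hℓT hτ hM (hσ1.trans hσ) hα hD hD0 hy0 hw0 hy₀ hw
  have t3 := noise_le (K := K) hT hlam0 hℓ hℓT htm hM hσ1 hσ hα hx hz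
  have h0 : 0 ≤ M * ℓ ^ 3 / T * σ ^ 2 := by positivity
  have h1 : M * ℓ ^ 3 / T * σ ^ 2 * (1 / lam ^ 2) ≤ M * ℓ ^ 3 / T * σ ^ 2 * (K * (1 / lam ^ 2)) :=
    mul_le_mul_of_nonneg_left (le_mul_of_one_le_left (by positivity) hK') h0
  have e1 : 30000000000 * M * σ ^ 2 * (K / lam ^ 2) * ℓ ^ 3 / T
      = 30000000000 * (M * ℓ ^ 3 / T * σ ^ 2 * (K * (1 / lam ^ 2))) := by ring
  have e2 : 70000000 * ε * σ₁ ^ 2 * (K / lam ^ 2)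
      = 70000000 * (ε * σ₁ ^ 2 * (K * (1 / lam ^ 2))) := by ring
  have h2 : 0 ≤ M * ℓ ^ 3 / T * σ ^ 2 * (K * (1 / lam ^ 2)) := by positivity
  have h3 : 0 ≤ ε * σ₁ ^ 2 * (K * (1 / lam ^ 2)) := by positivity
  rw [e1, e2]
  generalize M * ℓ ^ 3 / T * σ ^ 2 * (K * (1 / lam ^ 2)) = X at *
  generalize ε * σ₁ ^ 2 * (K * (1 / lam ^ 2)) = Y at *
  generalize M * ℓ ^ 3 / T * σ ^ 2 * (1 / lam ^ 2) = Z at *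
  generalize 32 * K / lam * z = U at *
  generalize D * (8 * y₀ ^ 2 + 2 * w ^ 2) + 832 * (α * τ) * w ^ 2 / lam = U' at *
  clear * - t12 t3 h1 h2 h3
  linarith

lemma sum_noise_le {α ε σ₁ Λ : ℝ} {a N : ℕ} (hT : 2 ≤ T) (hlam0 : 0 < lam) (ha : 1 ≤ a)
    (hN : a + N = T) (hα : α = 4 / lam * (Real.log T / T)) (hx1 : α * lam ≤ 1)
    (hΛ0 : 0 ≤ Λ) (hΛ : Λ ≤ 7 * ℓ) (htm0 : 0 ≤ tm) (hε : 0 ≤ ε) :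
    α * ∑ j ∈ Finset.range N, (1 - α * lam / 2) ^ (N - 1 - j) *
        (530000 * σ₁ ^ 2 * (ε + Λ ^ 2 * tm / ((a + j : ℕ) : ℝ)))
      ≤ 530000 * σ₁ ^ 2 * (ε * (2 / lam)
        + 49 * ℓ ^ 2 * tm * (α * (4 / (T * (α * lam)) + 2))) := by
  have hT' : (2 : ℝ) ≤ T := by exact_mod_cast hT
  have hlog0 : 0 < Real.log T := Real.log_pos (by linarith)
  have hα0 : 0 < α := by rw [hα]; positivity
  have hαl : 0 < α * lam := by positivity
  have hx : α * lam = 4 * Real.log T / T := by rw [hα]; field_simp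
  have h1 := mul_le_mul_of_nonneg_left (sum_geometric_div_le ha hN hT hx hx1) hα0.le
  have h2 : α * ∑ j ∈ Finset.range N, (1 - α * lam / 2) ^ (N - 1 - j) ≤ 2 / lam := by
    calc _ ≤ α * (1 - (1 - α * lam / 2))⁻¹ := mul_le_mul_of_nonneg_left
          (sum_geometric_sub_le (by linarith) (by linarith) N) hα0.le
      _ = 2 / lam := by rw [sub_sub_cancel]; field_simp
  have h3 : Λ ^ 2 ≤ 49 * ℓ ^ 2 := by nlinarith
  have e : α * ∑ j ∈ Finset.range N, (1 - α * lam / 2) ^ (N - 1 - j) *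
        (530000 * σ₁ ^ 2 * (ε + Λ ^ 2 * tm / ((a + j : ℕ) : ℝ)))
      = 530000 * σ₁ ^ 2 * (ε * (α * ∑ j ∈ Finset.range N, (1 - α * lam / 2) ^ (N - 1 - j))
        + Λ ^ 2 * tm * (α * ∑ j ∈ Finset.range N,
          (1 - α * lam / 2) ^ (N - 1 - j) * (1 / ((a + j : ℕ) : ℝ)))) := by
    simp only [Finset.mul_sum, ← Finset.sum_add_distrib]
    refine Finset.sum_congr rfl fun j _ => ?_
    ring
  have h4 : 0 ≤ α * (4 / (T * (α * lam)) + 2) := by positivity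
  rw [e]
  refine mul_le_mul_of_nonneg_left (add_le_add (mul_le_mul_of_nonneg_left h2 hε) ?_)
    (by positivity)
  exact (mul_le_mul_of_nonneg_left h1 (by positivity)).trans
    (mul_le_mul_of_nonneg_right (mul_le_mul_of_nonneg_right h3 htm0) h4)

end StepSize

section RobustTD

variable {m K : ℕ} {π R' : Fin m → ℝ} {Φ : Matrix (Fin m) (Fin K) ℝ} {rbar ρ : ℝ}
  {𝒟 : Fin m → Measure ℝ} {Ω : Type*} {mΩ : MeasurableSpace Ω} {Pr : Measure Ω}
  [IsProbabilityMeasure Pr] {s : ℕ → Ω → Fin m} {r : ℕ → Ω → ℝ} {P : Matrix (Fin m) (Fin m) ℝ}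
  {Q : ℕ → Fin m → Measure ℝ} {F : Filtration ℕ mΩ} {ε : ℝ}

/-- Error of the thresholded estimate: it is small off an exceptional event of small probability,
and bounded everywhere. -/
lemma exists_threshold_fail {T t : ℕ} (h : IsRewardChain F s r P (huberLaw ε 𝒟 Q) Pr)
    (hK : 1 ≤ K) (hT : 2 ≤ T) (hP : ∀ x y, 0 ≤ P x y) (hP1 : ∀ x, ∑ y, P x y = 1)
    (herg : ∃ k : ℕ, ∀ x y, 0 < (P ^ k) x y) (hπ : ∀ x, 0 < π x) (hπ1 : ∑ x, π x = 1)
    (hst : π ᵥ* P = π) (hinj : Function.Injective Φ.mulVec) (hΦ : ∀ x, Φ x ⬝ᵥ Φ x ≤ 1)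
    (hρ : 0 < ρ) (hrbar : ∀ x, |R' x| ≤ rbar) (h𝒟 : ∀ x, IsProbabilityMeasure (𝒟 x))
    (h1 : ∀ x, Integrable (fun y => y) (𝒟 x)) (h2 : ∀ x, Integrable (fun y => y ^ 2) (𝒟 x))
    (hR : ∀ x, ∫ y, y ∂𝒟 x = R' x) (hvar : ∀ x, ∫ y, (y - R' x) ^ 2 ∂𝒟 x ≤ ρ ^ 2)
    (hε : 0 ≤ ε) (hε1 : ε ≤ 1 / 192) (hQ : ∀ k x, IsProbabilityMeasure (Q k x)) {σ₁ : ℝ}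
    (hσ1 : 1 ≤ σ₁) (hσr : rbar ≤ σ₁) (hσρ : ρ ≤ σ₁) (htT : t + 1 ≤ T)
    (hburn : 70000 * tmixMat P π * Real.log (K * T : ℝ) ^ 2 ≤ t) {b b' : Ω → Fin K → ℝ}
    (hb : ∀ ω i, IsRumemOutput (tmixMat P π) (t + 1) (1 / (K * T ^ 2 : ℝ)) ε
        (fun k => Φ (s k ω) i * r k ω) (b ω i)) {bbar : Fin K → ℝ}
    (hbbar : bbar = fun i => ∑ x, π x * Φ x i * R' x)
    (hb' : ∀ ω, b' ω =
        if 400 * Real.sqrt K * σ₁ * (Real.sqrt ε +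
            2 * Real.log (12 * K * T ^ 3 : ℝ) * Real.sqrt ((tmixMat P π : ℝ) / t)) + σ₁
          < Real.sqrt (sqNorm (b ω)) then 0 else b ω) :
    ∃ (S : Set Ω) (g B : ℝ), MeasurableSet[F t] S ∧ 0 ≤ g ∧ 0 ≤ B ∧
      (∀ ω ∉ S, sqNorm (b' ω - bbar) ≤ g) ∧ (∀ ω, sqNorm (b' ω - bbar) ≤ B) ∧
      g + B * Pr.real S ≤ 530000 * σ₁ ^ 2 *
        (ε + Real.log (12 * K * T ^ 3 : ℝ) ^ 2 * tmixMat P π / t) := by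
  obtain ⟨S, hS, hSp, hSb⟩ := exists_rumem_fail h hK hT hP hP1 herg hπ hπ1 hst hinj hΦ hρ hrbar
    h𝒟 h1 h2 hR hvar hε hε1 hQ hσ1 hσr hσρ htT hburn hb
  have htm : (1 : ℝ) ≤ tmixMat P π := by
    exact_mod_cast (tmixMat_spec hP hP1 herg hπ hπ1 hst).1
  have hℓ := log_two_le_log_mul hK hT
  have hΛℓ := log_twelve_mul_le hK hT
  have hΛ4 := four_le_log_twelve_mul hK hT
  set Λ := Real.log (12 * K * T ^ 3 : ℝ)
  set ℓ := Real.log (K * T : ℝ)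
  set tm : ℝ := (tmixMat P π : ℝ)
  have hrbar0 : 0 ≤ rbar := by
    rcases isEmpty_or_nonempty (Fin m) with hm | ⟨⟨x⟩⟩
    · simp at hπ1
    · exact (abs_nonneg _).trans (hrbar x)
  have hmean : sqNorm bbar ≤ σ₁ ^ 2 := by
    rw [hbbar]
    exact (sqNorm_mean_le hπ hπ1 hΦ hrbar).trans (pow_le_pow_left₀ hrbar0 hσr 2)
  have hℓ2 : (0.69 : ℝ) ^ 2 ≤ ℓ ^ 2 := pow_le_pow_left₀ (by norm_num) hℓ 2
  have ht : (0 : ℝ) < t := by nlinarith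
  have hx : Λ ^ 2 * tm / t ≤ 1 / 1000 := by
    rw [div_le_div_iff₀ ht (by norm_num)]
    have h3 : Λ ^ 2 ≤ 49 * ℓ ^ 2 := by nlinarith
    have h4 := mul_le_mul_of_nonneg_right h3 (by linarith : 0 ≤ tm)
    linarith
  have hG := threshold_sq_bounds (K := K) (σ₁ := σ₁) hK hε (by linarith : 0 ≤ Λ)
    (by linarith : 0 ≤ tm) ht
  have hG0 : 0 ≤ 400 * Real.sqrt K * σ₁ * (Real.sqrt ε + 2 * Λ * Real.sqrt (tm / t)) := by
    positivity
  have hthr := fun ω => sqNorm_threshold_sub_le (by linarith : 0 ≤ σ₁) hG0 (hb' ω) hmean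
  refine ⟨S, _, _, hS, by positivity, sq_nonneg _, fun ω hω => ?_, fun ω => (hthr ω).1,
    threshold_failure_le hK hε hε1 hΛ4 htm ht hx hSp⟩
  have h3 := hSb ω hω
  rw [← hbbar] at h3
  rw [(hthr ω).2 (h3.trans hG.1)]
  exact h3

/-- The centred iterates follow the linear recursion driven by the reward-estimation error. -/
lemma centred_step {γ α : ℝ} {Abar : Matrix (Fin K) (Fin K) ℝ} {bbar θstar θ θ' b : Fin K → ℝ}
    {u v : Fin m} (hfix : Abar *ᵥ θstar = -bbar) (hθ : θ' = θ + α • (tdMat Φ γ u v *ᵥ θ + b)) :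
    (WithLp.toLp 2 (θ' - θstar) : EuclideanSpace ℝ (Fin K))
      = WithLp.toLp 2 (θ - θstar) + α • (tdOp Φ γ u v (WithLp.toLp 2 (θ - θstar))
        + (tdOp Φ γ u v - Matrix.toEuclideanCLM (𝕜 := ℝ) Abar) (WithLp.toLp 2 θstar)
        + WithLp.toLp 2 (b - bbar)) := by
  rw [_root_.sub_apply, tdOp, Matrix.toEuclideanCLM_toLp, Matrix.toEuclideanCLM_toLp,
    Matrix.toEuclideanCLM_toLp, hfix, hθ, Matrix.mulVec_sub, ← WithLp.toLp_sub,
    ← WithLp.toLp_add, ← WithLp.toLp_add, ← WithLp.toLp_smul, ← WithLp.toLp_add]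
  congr 1
  module

end RobustTD

/-- **Performance of Robust-TD.**
For the stationary ergodic chain with Huber-contaminated rewards (`ε ≤ 1/192`),
with `ω > 0` the smallest eigenvalue of `Σ = ΦᵀDΦ`, `G = K/(ω²(1−γ)²)`,
`σ₁ = max{1, r̄, ρ}`, `σ = max{‖θ*‖₂, ‖θ₀‖₂, σ₁}`, `τ̄_mix = max{τ′, τ_mix}`:
there are universal constants `c₁, c₂, c₃, c₄ ≥ 1` such that if
`α = (4/(ω(1−γ))) log T/T`, `T̄ = ⌈c₁ τ_mix log²(KT)⌉`, and
`T ≥ max{T̄ + τ′, c₂ τ′ log T/(ω²(1−γ)²)}`, then the Robust-TD iterates satisfy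
`E[‖θ_T − θ*‖₂²] ≤ c₃ τ̄_mix σ² G log³(KT)/T + c₄ ε σ₁² G`. -/
theorem robust_td_performance :
    ∃ c₁ c₂ c₃ c₄ C : ℝ, 1 ≤ c₁ ∧ 1 ≤ c₂ ∧ 1 ≤ c₃ ∧ 1 ≤ c₄ ∧ 1 ≤ C ∧
    ∀ (Ω : Type) [MeasurableSpace Ω] (Pr : Measure Ω) [IsProbabilityMeasure Pr]
      (m K T : ℕ), 1 ≤ K → 2 ≤ T →
    -- ergodic transition matrix and stationary distribution
    ∀ (P : Matrix (Fin m) (Fin m) ℝ), (∀ x y, 0 ≤ P x y) → (∀ x, ∑ y, P x y = 1) →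
      (∃ k : ℕ, ∀ x y, 0 < (P ^ k) x y) →
    ∀ (π : Fin m → ℝ), (∀ x, 0 < π x) → (∑ x, π x = 1) → (Matrix.vecMul π P = π) →
    -- features: full column rank, normalized rows; discount factor
    ∀ (Φ : Matrix (Fin m) (Fin K) ℝ), Function.Injective Φ.mulVec →
      (∀ x, Φ x ⬝ᵥ Φ x ≤ 1) →
    ∀ (γ : ℝ), 0 < γ → γ < 1 →
    -- ω is the smallest eigenvalue of Σ = ΦᵀDΦ (positive by full rank)
    ∀ (hHerm : (Φᵀ * Matrix.diagonal π * Φ).IsHermitian) (ω : ℝ),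
      ω = ⨅ i, hHerm.eigenvalues i → 0 < ω →
    -- true reward distributions: means R' with |R'| ≤ r̄, variances ≤ ρ²
    ∀ (R' : Fin m → ℝ) (rbar ρ : ℝ), 0 < ρ → (∀ x, |R' x| ≤ rbar) →
    -- steady-state quantities
    ∀ (Abar : Matrix (Fin K) (Fin K) ℝ),
      Abar = Φᵀ * Matrix.diagonal π * (γ • P - 1) * Φ →
    ∀ (bbar : Fin K → ℝ), bbar = (fun i => ∑ x, π x * Φ x i * R' x) →
    ∀ (θstar : Fin K → ℝ), θstar = -(Abar⁻¹.mulVec bbar) →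
    ∀ (𝒟 : Fin m → Measure ℝ), (∀ x, IsProbabilityMeasure (𝒟 x)) →
      (∀ x, Integrable (fun y => y) (𝒟 x)) →
      (∀ x, Integrable (fun y => y ^ 2) (𝒟 x)) →
      (∀ x, (∫ y, y ∂𝒟 x) = R' x) →
      (∀ x, (∫ y, (y - R' x) ^ 2 ∂𝒟 x) ≤ ρ ^ 2) →
    -- Huber corruption of level ε ≤ 1/192 by arbitrary adversarial distributions
    ∀ (ε : ℝ), 0 ≤ ε → ε ≤ 1 / 192 →
    ∀ (Q : ℕ → Fin m → Measure ℝ), (∀ k x, IsProbabilityMeasure (Q k x)) →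
    -- the stationary chain and contaminated rewards (joint law on cylinders)
    ∀ (s : ℕ → Ω → Fin m) (rtil : ℕ → Ω → ℝ),
      (∀ k, Measurable (s k)) → (∀ k, Measurable (rtil k)) →
      (∀ (n : ℕ) (f : Fin (n + 1) → Fin m) (B : Fin (n + 1) → Set ℝ),
        (∀ k, MeasurableSet (B k)) →
        Pr {ω' | ∀ k : Fin (n + 1), s k ω' = f k ∧ rtil k ω' ∈ B k} =
          ENNReal.ofReal (π (f 0)) *
            (∏ k : Fin n, ENNReal.ofReal (P (f k.castSucc) (f k.succ))) *
            ∏ k : Fin (n + 1),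
              (ENNReal.ofReal (1 - ε) * 𝒟 (f k) (B k) +
                ENNReal.ofReal ε * Q k (f k) (B k))) →
    -- step size, burn-in time, horizon requirements
    ∀ (α : ℝ), α = 4 / (ω * (1 - γ)) * (Real.log T / T) →
    ∀ (Tbar : ℕ), Tbar = ⌈c₁ * (tmixMat P π : ℝ) * (Real.log (K * T : ℝ)) ^ 2⌉₊ →
      Tbar + tdMixTime P Φ γ Abar α ≤ T →
      c₂ * (tdMixTime P Φ γ Abar α : ℝ) * Real.log T / (ω ^ 2 * (1 - γ) ^ 2) ≤ T →
    -- the raw coordinatewise RUMEM estimates and the thresholded estimate b̂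
    ∀ (braw bhat : ℕ → Ω → Fin K → ℝ),
      (∀ t ω' i, IsRumemOutput (tmixMat P π) (t + 1) (1 / (K * T ^ 2 : ℝ)) ε
        (fun k => Φ (s k ω') i * rtil k ω') (braw t ω' i)) →
      (∀ t ω', bhat t ω' =
        if C * Real.sqrt K * max 1 (max rbar ρ) *
              (Real.sqrt ε +
                2 * Real.log (12 * K * T ^ 3 : ℝ) * Real.sqrt ((tmixMat P π : ℝ) / t)) +
            max 1 (max rbar ρ) < Real.sqrt (sqNorm (braw t ω'))
        then 0 else braw t ω') →
      (∀ t, Measurable (bhat t)) →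
    -- the Robust-TD iterates
    ∀ (θ₀ : Fin K → ℝ) (θ : ℕ → Ω → Fin K → ℝ),
      (∀ t, t ≤ Tbar → ∀ ω', θ t ω' = θ₀) →
      (∀ t, Tbar ≤ t → ∀ ω', θ (t + 1) ω' =
        θ t ω' + α • ((tdMat Φ γ (s t ω') (s (t + 1) ω')).mulVec (θ t ω') + bhat t ω')) →
    -- conclusion: finite-time mean-square error bound
    (∫ ω', sqNorm (θ T ω' - θstar) ∂Pr) ≤
      c₃ * (max (tdMixTime P Φ γ Abar α) (tmixMat P π) : ℝ) *
          (max (Real.sqrt (sqNorm θstar))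
            (max (Real.sqrt (sqNorm θ₀)) (max 1 (max rbar ρ)))) ^ 2 *
          (K / (ω ^ 2 * (1 - γ) ^ 2)) * (Real.log (K * T : ℝ)) ^ 3 / T +
        c₄ * ε * (max 1 (max rbar ρ)) ^ 2 * (K / (ω ^ 2 * (1 - γ) ^ 2)) := by
  refine ⟨70000, 3328, 30000000000, 70000000, 400, by norm_num, by norm_num, by norm_num,
    by norm_num, by norm_num, ?_⟩
  intro Ω _ Pr _ m K T hK hT P hP hP1 herg π hπ hπ1 hst Φ hinj hΦ γ hγ0 hγ1 hHerm ω hω hω0 R' rbar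
    ρ hρ hrbar Abar hAbar bbar hbbar θstar hθstar 𝒟 h𝒟 h1 h2 hR hvar ε hε hε1 Q hQ s rtil hs hr hcyl
    α hα Tbar hTbar hTτ hTc braw bhat hbraw hbhat _ θ₀ θ hθ₀ hθ
  have hm : 0 < m := by
    rcases Nat.eq_zero_or_pos m with rfl | hm
    · simp at hπ1
    · exact hm
  have hchain : IsRewardChain (historyFiltration hs hr) s rtil P (huberLaw ε 𝒟 Q) Pr := by
    refine isRewardChain_historyFiltration (π := π) hm hP
      (isProbabilityMeasure_huberLaw h𝒟 hQ hε (by linarith)) hs hr fun n f B hB => ?_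
    rw [hcyl n f B hB]
    simp only [huberLaw, Measure.add_apply, Measure.smul_apply, smul_eq_mul]
  have hT' : (2 : ℝ) ≤ T := by exact_mod_cast hT
  have hK' : (1 : ℝ) ≤ K := by exact_mod_cast hK
  have hlog : 0 < Real.log T := Real.log_pos (by linarith)
  have hω1 : ω ≤ 1 := hω ▸ iInf_eigenvalues_le_one hK hπ hπ1 hΦ hHerm
  obtain ⟨lam, hlam⟩ : ∃ lam, lam = ω * (1 - γ) := ⟨_, rfl⟩
  have hlam0 : 0 < lam := hlam ▸ mul_pos hω0 (by linarith)
  have hlam1 : lam ≤ 1 := hlam ▸ mul_le_one₀ hω1 (by linarith) (by linarith)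
  rw [← hlam] at hα
  rw [← mul_pow, ← hlam] at hTc ⊢
  have hα0 : 0 < α := by rw [hα]; positivity
  have hneg : ∀ v, inner ℝ v (Matrix.toEuclideanCLM (𝕜 := ℝ) Abar v) ≤ -lam * ‖v‖ ^ 2 :=
    fun v => by
      rw [hlam, hω]
      exact inner_meanTdMat_le hP hP1 hπ hst hγ0 hγ1 hAbar hHerm v
  obtain ⟨hτ, hmix⟩ := tdMixTime_spec hP hP1 herg hπ hπ1 hst hΦ hγ0 hγ1 hAbar hα0
  generalize tdMixTime P Φ γ Abar α = τ at hτ hmix hTτ hTc ⊢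
  have hτ' : (1 : ℝ) ≤ τ := by exact_mod_cast hτ
  have htm : (1 : ℝ) ≤ tmixMat P π := by
    exact_mod_cast (tmixMat_spec hP hP1 herg hπ hπ1 hst).1
  have hℓ := log_two_le_log_mul hK hT
  have hℓT : Real.log T ≤ Real.log (K * T : ℝ) :=
    Real.log_le_log (by linarith) (le_mul_of_one_le_left (by linarith) hK')
  have hΛℓ := log_twelve_mul_le hK hT
  have hΛ4 := four_le_log_twelve_mul hK hT
  have hTbar1 := Nat.le_ceil (70000 * (tmixMat P π : ℝ) * Real.log (K * T : ℝ) ^ 2)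
  have hTbar2 := Nat.ceil_lt_add_one
    (show 0 ≤ 70000 * (tmixMat P π : ℝ) * Real.log (K * T : ℝ) ^ 2 by positivity)
  rw [← hTbar] at hTbar1 hTbar2
  have hTbar3 : 1 ≤ Tbar := by
    have h3 : (0 : ℝ) < Tbar := lt_of_lt_of_le (by positivity) hTbar1
    exact_mod_cast h3
  have hατ : 832 * (α * τ) ≤ lam := by
    rw [div_le_iff₀ (by positivity)] at hTc
    have e : 832 * (α * τ) = 3328 * τ * Real.log T / T / lam := by rw [hα]; field_simp; norm_num
    rw [e, div_le_iff₀ hlam0, div_le_iff₀ (by linarith)]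
    linarith
  have hx1 : α * lam ≤ 1 := by nlinarith
  have hx : α * lam = 4 * Real.log T / T := by rw [hα]; field_simp
  obtain ⟨n, hn⟩ : ∃ n, Tbar + τ + n = T := ⟨T - (Tbar + τ), by omega⟩
  obtain ⟨σ₁, hσ₁⟩ : ∃ σ₁, σ₁ = max 1 (max rbar ρ) := ⟨_, rfl⟩
  have hσ1 : 1 ≤ σ₁ := hσ₁ ▸ le_max_left _ _
  have hσr : rbar ≤ σ₁ := hσ₁ ▸ (le_max_left _ _).trans (le_max_right _ _)
  have hσρ : ρ ≤ σ₁ := hσ₁ ▸ (le_max_right _ _).trans (le_max_right _ _)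
  simp only [← hσ₁] at hbhat ⊢
  have hfix : Abar *ᵥ θstar = -bbar := by
    rw [hθstar]; exact mulVec_neg_inv_mulVec hlam0 hneg bbar
  have hfail : ∀ j, ∃ (S : Set Ω) (g B : ℝ), j < n + τ →
      MeasurableSet[historyFiltration hs hr (Tbar + j)] S ∧ 0 ≤ g ∧ 0 ≤ B ∧
      (∀ ω ∉ S, sqNorm (bhat (Tbar + j) ω - bbar) ≤ g) ∧
      (∀ ω, sqNorm (bhat (Tbar + j) ω - bbar) ≤ B) ∧
      g + B * Pr.real S ≤ 530000 * σ₁ ^ 2 * (ε + Real.log (12 * K * T ^ 3 : ℝ) ^ 2 *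
        tmixMat P π / ((Tbar + j : ℕ) : ℝ)) := fun j => by
    by_cases hj : j < n + τ
    · obtain ⟨S, g, B, h3⟩ := exists_threshold_fail hchain hK hT hP hP1 herg hπ hπ1 hst hinj hΦ hρ
        hrbar h𝒟 h1 h2 hR hvar hε hε1 hQ hσ1 hσr hσρ (by omega : Tbar + j + 1 ≤ T)
        (hTbar1.trans (by exact_mod_cast Nat.le_add_right _ _)) (hbraw (Tbar + j)) hbbar
        (hbhat (Tbar + j))
      exact ⟨S, g, B, fun _ => h3⟩
    · exact ⟨∅, 0, 0, fun h3 => absurd h3 hj⟩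
  choose S g B hSgB using hfail
  have hmain := integral_norm_sq_forced_le (EuclideanSpace.basisFun (Fin K) ℝ)
    (x := fun k ω => WithLp.toLp 2 (θ (Tbar + k) ω - θstar))
    (e := fun k ω => WithLp.toLp 2 (bhat (Tbar + k) ω - bbar))
    (y₀ := WithLp.toLp 2 (θ₀ - θstar)) (w := WithLp.toLp 2 θstar)
    hchain.toIsMarkovChain hP1 (norm_tdOp_le hΦ hγ0 hγ1)
    (norm_toEuclideanCLM_meanTdMat_le hP hP1 hπ hπ1 hΦ hγ0 hγ1 hAbar) hneg hmix hα0 hτ hlam0 hlam1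
    hατ (fun ω => by rw [Nat.add_zero, hθ₀ Tbar le_rfl ω])
    (fun k ω => centred_step hfix (hθ (Tbar + k) (Nat.le_add_right _ _) ω)) (n := n) rfl
    (fun j hj => (hSgB j hj).1) (fun j hj => (hSgB j hj).2.1) (fun j hj => (hSgB j hj).2.2.1)
    (fun j hj ω hω => by rw [← sqNorm_eq_norm_sq]; exact (hSgB j hj).2.2.2.1 ω hω)
    (fun j hj ω => by rw [← sqNorm_eq_norm_sq]; exact (hSgB j hj).2.2.2.2.1 ω)
    (fun j hj => (hSgB j hj).2.2.2.2.2)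
  rw [Fintype.card_fin] at hmain
  have e1 : Tbar + (n + τ) = T := by omega
  simp only [e1, ← sqNorm_eq_norm_sq (_ - θstar)] at hmain
  refine hmain.trans ?_
  have hw : ‖(WithLp.toLp 2 θstar : EuclideanSpace ℝ (Fin K))‖
      ≤ max (Real.sqrt (sqNorm θstar)) (max (Real.sqrt (sqNorm θ₀)) σ₁) :=
    (sqrt_sqNorm θstar).symm.le.trans (le_max_left _ _)
  have hy : ‖(WithLp.toLp 2 θ₀ : EuclideanSpace ℝ (Fin K))‖
      ≤ max (Real.sqrt (sqNorm θstar)) (max (Real.sqrt (sqNorm θ₀)) σ₁) :=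
    (sqrt_sqNorm θ₀).symm.le.trans ((le_max_left _ _).trans (le_max_right _ _))
  rw [sqNorm_eq_norm_sq (θ₀ - θstar)]
  exact collect_error_le hK hT hlam0 hℓ hℓT (le_max_left _ _) (le_max_right _ _)
    (hτ'.trans (le_max_left _ _)) hlam1 (by linarith)
    ((le_max_right _ _).trans (le_max_right _ _)) hα
    (transient_le hT hℓ (hτ'.trans (le_max_left _ _)) (le_max_right _ _) (le_max_left _ _)
      hTbar2.le hn hx hx1) rfl hε (norm_nonneg _) (norm_nonneg _)
    (pow_nonneg (by linarith) _)
    (by rw [WithLp.toLp_sub]; exact (norm_sub_le _ _).trans (by linarith)) hw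
    (sum_noise_le hT hlam0 hTbar3 e1 hα hx1 (by linarith) hΛℓ (by linarith) hε)
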